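/- Let φ: (R,m,k) → (S,n,ℓ) be a surjective local ring homomorphism between commutative Noetherian local rings, and let E be the Koszul complex over R associated to a set of generators of J := ker φ. If CI-dim_R S < ∞ and H_1(E) is a free S-module, then AQ-dim_R S ≤ 2. -/

import Mathlib

/-!
Common definitions: André–Quillen homology via the standard (comonad/polynomial)
simplicial resolution, complete-intersection (flat) dimensions via quasi-deformations,
Cohen factorizations, Koszul homology `H₁`, and related notions.
-/

universe u

open TensorProduct IsLocalRing

noncomputable section

/-! ### Flat and projective dimension -/

/-- `FlatDimLE Q n N` : the `Q`-module `N` has flat dimension at most `n`,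
i.e. it admits a flat resolution of length at most `n`. -/
def FlatDimLE (Q : Type u) [CommRing Q] : ℕ → (N : Type u) → [AddCommGroup N] → [Module Q N] → Prop
  | 0, N, _, _ => Module.Flat Q N
  | n+1, N, _, _ =>
      ∃ (F : Type u) (_ : AddCommGroup F) (_ : Module Q F) (f : F →ₗ[Q] N),
        Module.Flat Q F ∧ Function.Surjective f ∧ FlatDimLE Q n (LinearMap.ker f)

/-- `ProjDimLE Q n N` : the `Q`-module `N` has projective dimension at most `n`. -/
def ProjDimLE (Q : Type u) [CommRing Q] : ℕ → (N : Type u) → [AddCommGroup N] → [Module Q N] → Prop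
  | 0, N, _, _ => Module.Projective Q N
  | n+1, N, _, _ =>
      ∃ (F : Type u) (_ : AddCommGroup F) (_ : Module Q F) (f : F →ₗ[Q] N),
        Module.Projective Q F ∧ Function.Surjective f ∧ ProjDimLE Q n (LinearMap.ker f)

/-- The flat dimension `fd_Q N` is finite. -/
def FlatDimFinite (Q : Type u) [CommRing Q] (N : Type u) [AddCommGroup N] [Module Q N] : Prop :=
  ∃ n : ℕ, FlatDimLE Q n N

/-- The projective dimension `pd_Q N` is finite. -/
def ProjDimFinite (Q : Type u) [CommRing Q] (N : Type u) [AddCommGroup N] [Module Q N] : Prop :=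
  ∃ n : ℕ, ProjDimLE Q n N

/-! ### Regular sequences, regular local rings, complete intersection conditions -/

/-- The ideal `I` is generated by an `A`-regular sequence. -/
def GeneratedByRegularSequence (A : Type u) [CommRing A] (I : Ideal A) : Prop :=
  ∃ rs : List A, RingTheory.Sequence.IsRegular A rs ∧ Ideal.span {x | x ∈ rs} = I

/-- A (Noetherian local) ring is regular iff its maximal ideal is generated by a
regular sequence. -/
def IsRegularLocal (A : Type u) [CommRing A] : Prop :=
  IsNoetherianRing A ∧
    ∃ h : IsLocalRing A, GeneratedByRegularSequence A (@IsLocalRing.maximalIdeal A _ h)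

/-- A local homomorphism is weakly regular if it is flat with regular closed fibre. -/
def IsWeaklyRegularHom (A B : Type u) [CommRing A] [CommRing B] [IsLocalRing A]
    (f : A →+* B) : Prop :=
  IsLocalHom f ∧ (letI := f.toAlgebra; Module.Flat A B) ∧
    IsRegularLocal (B ⧸ Ideal.map f (maximalIdeal A))

/-- `R'' → f → g` is a Cohen factorization of the semi-completion of `ψ : A → B`
with respect to the (maximal) ideal `J` of `B`:  `A → R'' → B̂` with `A → R''`
weakly regular, `R''` complete Noetherian local and `R'' → B̂` surjective local. -/
def IsCohenFactorizationAt (A B : Type u) [CommRing A] [CommRing B] [IsLocalRing A]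
    (ψ : A →+* B) (J : Ideal B) (R'' : Type u) [CommRing R'']
    (f : A →+* R'') (g : R'' →+* AdicCompletion J B) : Prop :=
  g.comp f = (algebraMap B (AdicCompletion J B)).comp ψ ∧
  IsNoetherianRing R'' ∧
  (∃ h : IsLocalRing R'', IsAdicComplete (@IsLocalRing.maximalIdeal R'' _ h) R'') ∧
  IsWeaklyRegularHom A R'' f ∧
  Function.Surjective g ∧ IsLocalHom g

/-- `ψ : A → B` is complete intersection (c.i.) at the ideal `J` (typically the
maximal ideal of `B`): in a Cohen factorization `A → R'' → B̂` of the
semi-completion of `ψ`, the kernel of `R'' → B̂` is generated by a regular sequence. -/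
def IsCIAt (A B : Type u) [CommRing A] [CommRing B] [IsLocalRing A]
    (ψ : A →+* B) (J : Ideal B) : Prop :=
  ∃ (R'' : Type u) (_ : CommRing R'') (f : A →+* R'') (g : R'' →+* AdicCompletion J B),
    IsCohenFactorizationAt A B ψ J R'' f g ∧ GeneratedByRegularSequence R'' (RingHom.ker g)

/-- A Noetherian local ring is a complete intersection if its completion is the
quotient of a complete regular local ring by an ideal generated by a regular sequence. -/
def IsCompleteIntersectionRing (A : Type u) [CommRing A] : Prop :=
  IsNoetherianRing A ∧
  ∃ h : IsLocalRing A,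
    ∃ (Q : Type u) (_ : CommRing Q)
      (g : Q →+* AdicCompletion (@IsLocalRing.maximalIdeal A _ h) A),
      IsRegularLocal Q ∧ (∃ hq : IsLocalRing Q, IsAdicComplete (@IsLocalRing.maximalIdeal Q _ hq) Q) ∧
      Function.Surjective g ∧ GeneratedByRegularSequence Q (RingHom.ker g)

/-! ### Complete intersection (flat) dimensions via quasi-deformations

`R → R' ← Q` is a quasi-deformation when `R → R'` is flat local and `Q → R'` is
surjective local with kernel generated by a `Q`-regular sequence (all rings
Noetherian local).  The various complete intersection (flat) dimensions
`CI-fd`, `CI-dim`, `CI*-fd`, `CI*-dim`, `cidim-fd`, `cidim` of a module `M` are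
`inf { fd_Q(R' ⊗_R M) - pd_Q R' }` over (upper / complete intersection)
quasi-deformations; such a dimension is finite iff there is a quasi-deformation
of the appropriate kind for which both `fd_Q (R' ⊗_R M)` and `pd_Q R'` are finite. -/

/-- The conditions on `R → R' ← Q` making it a quasi-deformation. -/
def IsQuasiDeformation (R R' Q : Type u) [CommRing R] [CommRing R'] [CommRing Q]
    (f : R →+* R') (g : Q →+* R') : Prop :=
  IsLocalRing R' ∧ IsLocalRing Q ∧ IsNoetherianRing R' ∧ IsNoetherianRing Q ∧
  IsLocalHom f ∧ IsLocalHom g ∧ (letI := f.toAlgebra; Module.Flat R R') ∧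
  Function.Surjective g ∧ GeneratedByRegularSequence Q (RingHom.ker g)

/-- `CI-fd_R M < ∞` (equivalently, for finitely generated `M`, `CI-dim_R M < ∞`):
there is a quasi-deformation `R → R' ← Q` with `fd_Q (R' ⊗_R M)` and `pd_Q R'` finite. -/
def HasFiniteCIDim (R : Type u) [CommRing R] (M : Type u) [AddCommGroup M] [Module R M] : Prop :=
  ∃ (R' Q : Type u) (_ : CommRing R') (_ : CommRing Q) (f : R →+* R') (g : Q →+* R'),
    IsQuasiDeformation R R' Q f g ∧
    (letI := f.toAlgebra;
     letI := g.toAlgebra;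
     letI : Module Q (R' ⊗[R] M) := Module.compHom _ g;
     FlatDimFinite Q (R' ⊗[R] M) ∧ ProjDimFinite Q R')

/-- `CI*-fd_R M < ∞` (resp. `CI*-dim_R M < ∞`): as in `HasFiniteCIDim` but over
upper quasi-deformations, i.e. `R → R'` is weakly regular. -/
def HasFiniteUpperCIDim (R : Type u) [CommRing R] [IsLocalRing R]
    (M : Type u) [AddCommGroup M] [Module R M] : Prop :=
  ∃ (R' Q : Type u) (_ : CommRing R') (_ : CommRing Q) (f : R →+* R') (g : Q →+* R'),
    IsQuasiDeformation R R' Q f g ∧ IsWeaklyRegularHom R R' f ∧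
    (letI := f.toAlgebra;
     letI := g.toAlgebra;
     letI : Module Q (R' ⊗[R] M) := Module.compHom _ g;
     FlatDimFinite Q (R' ⊗[R] M) ∧ ProjDimFinite Q R')

/-- `cidim-fd_R M < ∞` (resp. `cidim_R M < ∞`): as in `HasFiniteCIDim` but over
complete intersection quasi-deformations, i.e. `R → R'` is c.i. at the maximal
ideal of `R'`. -/
def HasFiniteCIQDDim (R : Type u) [CommRing R] [IsLocalRing R]
    (M : Type u) [AddCommGroup M] [Module R M] : Prop :=
  ∃ (R' Q : Type u) (_ : CommRing R') (_ : CommRing Q) (hR' : IsLocalRing R')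
    (f : R →+* R') (g : Q →+* R'),
    IsQuasiDeformation R R' Q f g ∧
    IsCIAt R R' f (@IsLocalRing.maximalIdeal R' _ hR') ∧
    (letI := f.toAlgebra;
     letI := g.toAlgebra;
     letI : Module Q (R' ⊗[R] M) := Module.compHom _ g;
     FlatDimFinite Q (R' ⊗[R] M) ∧ ProjDimFinite Q R')

/-! ### André–Quillen homology

`D_n(S|R, M)` is defined as the `n`-th homology of `L ⊗_S M`, where `L` is the
cotangent complex of the `R`-algebra `S`: the complex associated to the standard
simplicial resolution `X` of `S` by polynomial `R`-algebras (the comonad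
resolution `X_n = G^{n+1} S`, `G A = R[A]`), with `L_n = S ⊗_{X_n} Ω_{X_n/R}`
the free `S`-module on the variables of `X_n` and differentials the alternating
sums of the maps induced by the face maps. -/

/-- `AQV R S n` is, for `n ≥ 1`, the `n`-th ring in the standard simplicial
polynomial resolution of `S` over `R` (and `AQV R S 0 = S` as an index set). -/
def AQV (R S : Type u) [CommRing R] : ℕ → Type u
  | 0 => S
  | n+1 => MvPolynomial (AQV R S n) R

noncomputable instance (R S : Type u) [CommRing R] (n : ℕ) : CommRing (AQV R S (n+1)) :=
  inferInstanceAs (CommRing (MvPolynomial (AQV R S n) R))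

noncomputable instance (R S : Type u) [CommRing R] (n : ℕ) : Algebra R (AQV R S (n+1)) :=
  inferInstanceAs (Algebra R (MvPolynomial (AQV R S n) R))

/-- The augmentations `X_n → S` of the standard resolution. -/
def AQaug (R S : Type u) [CommRing R] [CommRing S] [Algebra R S] :
    (n : ℕ) → (AQV R S (n+1) →ₐ[R] S)
  | 0 => MvPolynomial.aeval (id : S → S)
  | n+1 => MvPolynomial.aeval (fun v : AQV R S (n+1) => AQaug R S n v)

/-- The face maps `dᵢ : X_{n+1} → X_n` of the standard resolution: `d₀` is the
counit and `d_{i+1} = G(dᵢ)`. -/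
def AQface (R S : Type u) [CommRing R] [CommRing S] [Algebra R S] :
    (n : ℕ) → (i : ℕ) → (AQV R S (n+2) →ₐ[R] AQV R S (n+1))
  | n, 0 => MvPolynomial.aeval (id : AQV R S (n+1) → AQV R S (n+1))
  | 0, _+1 => MvPolynomial.rename ⇑(AQaug R S 0)
  | n+1, i+1 => MvPolynomial.rename ⇑(AQface R S n i)

variable (R S : Type u) [CommRing R] [CommRing S] [Algebra R S]
variable (M : Type u) [AddCommGroup M] [Module S M]

/-- The map `L_{n+1} ⊗ M → L_n ⊗ M` induced by an `R`-algebra map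
`f : X_{n+1} → X_n` on the (base-changed) Kähler differentials: the free module
on the variables `v` of `X_{n+1}` maps by `e_v ↦ ∑_w aug(∂(f Xᵥ)/∂w) • e_w`. -/
def AQind (n : ℕ) (f : AQV R S (n+2) →ₐ[R] AQV R S (n+1)) :
    (AQV R S (n+1) →₀ M) →ₗ[S] (AQV R S n →₀ M) :=
  Finsupp.lsum S fun v : AQV R S (n+1) =>
    letI : DecidableEq (AQV R S n) := Classical.decEq _
    let P : MvPolynomial (AQV R S n) R := f (MvPolynomial.X v)
    ∑ w ∈ P.vars,
      (Finsupp.lsingle w).comp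
        ((AQaug R S n ((MvPolynomial.pderiv w) P) : S) • (LinearMap.id : M →ₗ[S] M))

/-- The differential `L_{n+1} ⊗ M → L_n ⊗ M` of the cotangent complex:
the alternating sum of the maps induced by the face maps. -/
def AQdiff (n : ℕ) : (AQV R S (n+1) →₀ M) →ₗ[S] (AQV R S n →₀ M) :=
  ∑ i ∈ Finset.range (n+2), ((-1 : ℤ)^i) • AQind R S M n (AQface R S n i)

/-- Cycles of the cotangent complex with coefficients in `M`. -/
def AQcycles : (n : ℕ) → Submodule S (AQV R S n →₀ M)
  | 0 => ⊤
  | n+1 => LinearMap.ker (AQdiff R S M n)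

/-- André–Quillen homology `D_n(S|R, M)`. -/
def AQH (n : ℕ) : Type u :=
  AQcycles R S M n ⧸
    (LinearMap.range (AQdiff R S M n)).comap (AQcycles R S M n).subtype

noncomputable instance (n : ℕ) : AddCommGroup (AQH R S M n) :=
  inferInstanceAs (AddCommGroup (AQcycles R S M n ⧸
    (LinearMap.range (AQdiff R S M n)).comap (AQcycles R S M n).subtype))

/-- `AQdimLE R S d`: the André–Quillen dimension of the `R`-algebra `S` is at
most `d`, i.e. `D_n(S|R, -) = 0` for all `n > d`. -/
def AQdimLE (d : ℕ) : Prop :=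
  ∀ n : ℕ, d < n → ∀ (N : Type u) (iN : AddCommGroup N) (mN : Module S N),
    Subsingleton (@AQH R S _ _ _ N iN mN n)

/-- `AQ-dim_R S < ∞`. -/
def AQdimFinite : Prop := ∃ d : ℕ, AQdimLE R S d

/-! ### Koszul homology `H₁` -/

/-- First differential of the Koszul complex on `x : Fin c → A`. -/
def koszulD1 (A : Type u) [CommRing A] {c : ℕ} (x : Fin c → A) : (Fin c → A) →ₗ[A] A :=
  ∑ i, x i • (LinearMap.proj i : ((Fin c → A)) →ₗ[A] A)

/-- One-cycles of the Koszul complex on `x`. -/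
def koszulZ1 (A : Type u) [CommRing A] {c : ℕ} (x : Fin c → A) : Submodule A (Fin c → A) :=
  LinearMap.ker (koszulD1 A x)

/-- One-boundaries of the Koszul complex on `x` (the image of the second Koszul
differential, spanned by the elements `xᵢ eⱼ - xⱼ eᵢ`). -/
def koszulB1 (A : Type u) [CommRing A] {c : ℕ} (x : Fin c → A) : Submodule A (Fin c → A) :=
  Submodule.span A
    {v : Fin c → A | ∃ i j, v =
      x i • (Pi.single j (1 : A) : Fin c → A) - x j • (Pi.single i (1 : A) : Fin c → A)}

/-- First Koszul homology of the sequence `x : Fin c → A`. -/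
def KoszulH1 (A : Type u) [CommRing A] {c : ℕ} (x : Fin c → A) : Type u :=
  koszulZ1 A x ⧸ (koszulB1 A x).comap (koszulZ1 A x).subtype

noncomputable instance (A : Type u) [CommRing A] {c : ℕ} (x : Fin c → A) :
    AddCommGroup (KoszulH1 A x) :=
  inferInstanceAs (AddCommGroup (koszulZ1 A x ⧸ (koszulB1 A x).comap (koszulZ1 A x).subtype))

noncomputable instance (A : Type u) [CommRing A] {c : ℕ} (x : Fin c → A) :
    Module A (KoszulH1 A x) :=
  inferInstanceAs (Module A (koszulZ1 A x ⧸ (koszulB1 A x).comap (koszulZ1 A x).subtype))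

/-- `H₁(K(σ))` is a free `T̂`-module:  for any Cohen factorization
`S → S'' → T̂` of the semi-completion of `σ` and any finite generating set `x` of
`ker (S'' → T̂)`, the first Koszul homology of `x`, base-changed to `T̂`
(it is killed by `ker (S'' → T̂)`), is a free `T̂`-module. -/
def KoszulH1FreeHom (S T : Type u) [CommRing S] [CommRing T] [IsLocalRing S] [IsLocalRing T]
    (σ : S →+* T) : Prop :=
  ∀ (S'' : Type u) (_ : CommRing S'') (f : S →+* S'')
    (g : S'' →+* AdicCompletion (maximalIdeal T) T),
    IsCohenFactorizationAt S T σ (maximalIdeal T) S'' f g →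
    ∀ (c : ℕ) (x : Fin c → S''), Ideal.span (Set.range x) = RingHom.ker g →
      (letI := g.toAlgebra;
       Module.Free (AdicCompletion (maximalIdeal T) T)
         ((AdicCompletion (maximalIdeal T) T) ⊗[S''] (KoszulH1 S'' x)))

/-! ### Separability (MacLane) -/

/-- A field extension `ℓ/k` is separable (in the sense of MacLane, allowing
non-algebraic extensions) iff `K ⊗_k ℓ` is reduced for every field extension `K/k`. -/
def IsSeparableFieldExtension (k ℓ : Type u) [Field k] [Field ℓ] [Algebra k ℓ] : Prop :=
  ∀ (K : Type u) (_ : Field K) (_ : Algebra k K), IsReduced (K ⊗[k] ℓ)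

end


namespace AQ
open Finset

/-- alternating sum of faces, augmented indexing -/
noncomputable def bd {X : ℕ → Type*} [∀ n, AddCommGroup (X n)] (d : ∀ n : ℕ, ℕ → X (n+1) →+ X n) (n : ℕ) :
    X (n+1) →+ X n := ∑ i ∈ range (n+1), ((-1 : ℤ)^i) • d n i

theorem sum_split {M : Type*} [AddCommMonoid M] (f : ℕ → M) (N a b : ℕ) (h : N = a + b) :
    ∑ i ∈ range N, f i = ∑ i ∈ range a, f i + ∑ i ∈ range b, f (a + i) := by
  rw [h, Finset.sum_range_add]

section
variable {X : ℕ → Type*} [∀ n, AddCommGroup (X n)] (d : ∀ n : ℕ, ℕ → X (n+1) →+ X n)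

theorem bd_apply (n : ℕ) (x : X (n+1)) :
    bd d n x = ∑ i ∈ range (n+1), ((-1 : ℤ)^i) • d n i x := by
  simp [bd]

theorem bd_bd (hd : ∀ n i j, i ≤ j → j ≤ n → ∀ x, d n i (d (n+1) (j+1) x) = d n j (d (n+1) i x))
    (n : ℕ) (x : X (n+2)) : bd d n (bd d (n+1) x) = 0 := by
  rw [bd_apply, bd_apply]
  simp only [map_sum, map_zsmul, Finset.smul_sum, smul_smul]
  rw [← Finset.sum_product']
  refine Finset.sum_involution
    (fun p _ => if p.1 < p.2 then (p.2 - 1, p.1) else (p.2, p.1 + 1)) ?_ ?_ ?_ ?_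
  · rintro ⟨i, j⟩ h
    simp only [Finset.mem_product, Finset.mem_range] at h
    by_cases hij : i < j
    · simp only [hij, if_true]
      obtain ⟨k, rfl⟩ : ∃ k, j = k + 1 := ⟨j - 1, by omega⟩
      rw [hd n i k (by omega) (by omega)]
      simp only [Nat.add_sub_cancel]
      rw [← add_smul, ← pow_add, ← pow_add]
      have : (-1 : ℤ)^(i + (k+1)) + (-1)^(k+i) = 0 := by ring
      rw [this, zero_smul]
    · simp only [hij, if_false]
      rw [hd n j i (by omega) (by omega)]
      rw [← add_smul, ← pow_add, ← pow_add]
      have : (-1 : ℤ)^(i + j) + (-1)^(j+(i+1)) = 0 := by ring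
      rw [this, zero_smul]
  · rintro ⟨i, j⟩ h _
    by_cases hij : i < j
    · simp only [hij, if_true]; intro h; simp only [Prod.mk.injEq] at h; omega
    · simp only [hij, if_false]; intro h; simp only [Prod.mk.injEq] at h; omega
  · rintro ⟨i, j⟩ h
    simp only [Finset.mem_product, Finset.mem_range] at h ⊢
    by_cases hij : i < j
    · simp only [hij, if_true]; omega
    · simp only [hij, if_false]; omega
  · rintro ⟨i, j⟩ h
    by_cases hij : i < j
    · have : ¬ (j - 1 < i) := by omega
      simp only [hij, if_true, this, if_false]; ext <;> simp; omega
    · have : j < i + 1 := by omega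
      simp only [hij, if_false, this, if_true]; ext <;> simp

/-- augmented acyclicity -/
def Acyc : Prop := Function.Surjective (d 0 0) ∧ ∀ n, ∀ x : X (n+1), bd d n x = 0 → ∃ y, bd d (n+1) y = x

theorem bd_first (s : ∀ n, X n →+ X (n+1)) 
    (h0 : ∀ n x, d n 0 (s n x) = x)
    (h1 : ∀ n i, i ≤ n → ∀ x, d (n+1) (i+1) (s (n+1) x) = s n (d n i x)) (n : ℕ) (x : X (n+1)) :
    bd d (n+1) (s (n+1) x) = x - s n (bd d n x) := by
  rw [bd_apply, bd_apply, Finset.sum_range_succ', h0, map_sum, pow_zero, one_smul, add_comm _ x, sub_eq_add_neg,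
    ← Finset.sum_neg_distrib]
  congr 1
  refine Finset.sum_congr rfl fun i hi => ?_
  rw [h1 n i (by have := Finset.mem_range.1 hi; omega), map_zsmul, pow_succ]; simp

theorem acyc_first (s : ∀ n, X n →+ X (n+1)) 
    (h0 : ∀ n x, d n 0 (s n x) = x)
    (h1 : ∀ n i, i ≤ n → ∀ x, d (n+1) (i+1) (s (n+1) x) = s n (d n i x)) : Acyc d := by
  refine ⟨fun x => ⟨s 0 x, h0 _ _⟩, fun n x hx => ⟨s (n+1) x, ?_⟩⟩
  rw [bd_first d s h0 h1, hx, map_zero, sub_zero]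

theorem acyc_last (s : ∀ n, X n →+ X (n+1)) 
    (h0 : ∀ n x, d n n (s n x) = x)
    (h1 : ∀ n i, i ≤ n → ∀ x, d (n+1) i (s (n+1) x) = s n (d n i x)) : Acyc d := by
  refine ⟨fun x => ⟨s 0 x, h0 _ _⟩, fun n x hx => ⟨((-1:ℤ)^(n+1)) • s (n+1) x, ?_⟩⟩
  have : bd d (n+1) (s (n+1) x) = s n (bd d n x) + ((-1:ℤ)^(n+1)) • x := by
    rw [bd_apply, bd_apply, Finset.sum_range_succ, h0, map_sum]
    congr 1
    refine Finset.sum_congr rfl fun i hi => ?_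
    rw [h1 n i (by have := Finset.mem_range.1 hi; omega), map_zsmul]
  rw [map_zsmul, this, hx, map_zero, zero_add, smul_smul, ← pow_add, ← two_mul, pow_mul]; simp

end

/-- faces and degeneracies, augmented indexing -/
structure SD (X : ℕ → Type*) [∀ n, AddCommGroup (X n)] where
  d : ∀ n : ℕ, ℕ → X (n+1) →+ X n
  s : ∀ n : ℕ, ℕ → X (n+1) →+ X (n+2)
  dd : ∀ n i j, i ≤ j → j ≤ n → ∀ x, d n i (d (n+1) (j+1) x) = d n j (d (n+1) i x)
  ds1 : ∀ n i j, i ≤ j → j ≤ n → ∀ x, d (n+2) i (s (n+1) (j+1) x) = s n j (d (n+1) i x)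
  ds2 : ∀ n j, j ≤ n → ∀ x, d (n+1) j (s n j x) = x
  ds2' : ∀ n j, j ≤ n → ∀ x, d (n+1) (j+1) (s n j x) = x
  ds3 : ∀ n i j, j ≤ i → i ≤ n → ∀ x, d (n+2) (i+2) (s (n+1) j x) = s n j (d (n+1) (i+1) x)

namespace SD
variable {X : ℕ → Type*} [∀ n, AddCommGroup (X n)] (D : SD X)

/-- sum over k ≤ j+1 of a degenerate element, given vanishing -/
theorem bd_s (n j : ℕ) (hj : j ≤ n) (x : X (n+2)) (hx : ∀ k, j + 1 < k → k ≤ n + 1 → D.d (n+1) k x = 0) :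
    bd D.d (n+2) (D.s (n+1) (j+1) x) = D.s n j (∑ k ∈ range (j+1), (-1:ℤ)^k • D.d (n+1) k x) := by
  rw [bd_apply]
  have e : n + 2 + 1 = (j + 1) + (2 + (n - j)) := by omega
  rw [sum_split _ _ _ _ e, sum_split _ (2 + (n - j)) 2 (n - j) rfl]
  have h2 : ∑ x_1 ∈ range 2, (-1:ℤ) ^ (j + 1 + x_1) • (D.d (n + 2) (j + 1 + x_1)) ((D.s (n + 1) (j + 1)) x) = 0 := by
    rw [Finset.sum_range_succ, Finset.sum_range_one]
    rw [show j + 1 + 0 = j + 1 from rfl, D.ds2 (n+1) (j+1) (by omega), D.ds2' (n+1) (j+1) (by omega), ← add_smul]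
    have : (-1:ℤ)^(j+1) + (-1)^(j+1+1) = 0 := by ring
    rw [this, zero_smul]
  rw [h2, zero_add, Finset.sum_eq_zero (s := range (n - j)), add_zero, map_sum]
  · refine Finset.sum_congr rfl fun i hi => ?_
    rw [D.ds1 n i j (by have := Finset.mem_range.1 hi; omega) hj, map_zsmul]
  · intro i hi
    have := Finset.mem_range.1 hi
    obtain ⟨m, rfl⟩ : ∃ m, n = m := ⟨n, rfl⟩
    have : j + 1 + (2 + i) = (j + 1 + i) + 2 := by omega
    rw [this, D.ds3 n (j+1+i) (j+1) (by omega) (by omega), hx _ (by omega) (by omega), map_zero, smul_zero]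

theorem bd_s0 (n : ℕ) (x : X (n+1)) (hx : ∀ k, 0 < k → k ≤ n → D.d n k x = 0) :
    bd D.d (n+1) (D.s n 0 x) = 0 := by
  rw [bd_apply, Finset.sum_range_succ', Finset.sum_range_succ', D.ds2 n 0 (by omega), D.ds2' n 0 (by omega)]
  rw [Finset.sum_eq_zero]
  · simp
  · intro i hi
    have := Finset.mem_range.1 hi
    obtain ⟨m, rfl⟩ : ∃ m, n = m + 1 := ⟨n - 1, by omega⟩
    rw [show i + 1 + 1 = i + 2 from rfl, D.ds3 m i 0 (by omega) (by omega), hx _ (by omega) (by omega), map_zero, smul_zero]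

/-- faces of `x - s_j d_{j+1} x` -/
theorem face_norm (n j : ℕ) (hj : j ≤ n) (x : X (n+2)) (hx : ∀ k, j + 1 < k → k ≤ n + 1 → D.d (n+1) k x = 0)
    (k : ℕ) (hk : j < k) (hk' : k ≤ n + 1) : D.d (n+1) k (x - D.s n j (D.d (n+1) (j+1) x)) = 0 := by
  rw [map_sub]
  rcases Nat.lt_or_ge (j+1) k with h | h
  · rw [hx k h hk']
    obtain ⟨n, rfl⟩ : ∃ m, n = m + 1 := ⟨n - 1, by omega⟩
    obtain ⟨k, rfl⟩ : ∃ m, k = m + 2 := ⟨k - 2, by omega⟩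
    rw [D.ds3 n k j (by omega) (by omega), ← D.dd (n+1) (j+1) (k+1) (by omega) (by omega),
      hx _ (by omega) (by omega)]; simp
  · obtain rfl : k = j + 1 := by omega
    rw [D.ds2' n j hj, sub_self]

/-- Moore acyclic implies acyclic -/
theorem acyc_of_moore (hs : Function.Surjective (D.d 0 0))
    (h : ∀ n (u : X (n+1)), (∀ k ≤ n, D.d n k u = 0) → ∃ w, bd D.d (n+1) w = u) : Acyc D.d := by
  refine ⟨hs, fun n x hx => ?_⟩
  have key : ∀ j, ∀ x : X (n+1), bd D.d n x = 0 → (∀ k, j < k → k ≤ n → D.d n k x = 0) →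
      ∃ y, bd D.d (n+1) y = x := by
    intro j
    induction j with
    | zero =>
      intro x hx hk
      refine h n x fun k hk' => ?_
      rcases Nat.eq_zero_or_pos k with rfl | h0
      · rw [bd_apply, Finset.sum_range_succ', Finset.sum_eq_zero] at hx
        · simpa using hx
        · intro i hi
          have := Finset.mem_range.1 hi
          rw [hk _ (by omega) (by omega), smul_zero]
      · exact hk k h0 hk'
    | succ j ih =>
      intro x hx hk
      rcases Nat.lt_or_ge n (j+1) with hj | hj
      · exact ih x hx fun k h1 h2 => by omega
      obtain ⟨n, rfl⟩ : ∃ m, n = m + 1 := ⟨n - 1, by omega⟩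
      have e := D.bd_s n j (by omega) x hk
      have e2 : bd D.d (n+1) x = (∑ k ∈ range (j+1), (-1:ℤ)^k • D.d (n+1) k x) + (-1:ℤ)^(j+1) • D.d (n+1) (j+1) x := by
        rw [bd_apply, sum_split _ _ (j + 1 + 1) (n - j) (by omega), Finset.sum_range_succ,
          Finset.sum_eq_zero (s := range (n-j)), add_zero]
        intro i hi
        have := Finset.mem_range.1 hi
        rw [hk _ (by omega) (by omega), smul_zero]
      rw [hx] at e2
      rw [eq_neg_of_add_eq_zero_left e2.symm] at e
      have e3 : D.s n j (D.d (n+1) (j+1) x) = bd D.d (n+2) (-((-1:ℤ)^(j+1)) • D.s (n+1) (j+1) x) := by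
        rw [map_zsmul, e, map_neg, map_zsmul, smul_neg, neg_smul, neg_neg, smul_smul, ← pow_add, ← two_mul, pow_mul]; simp
      obtain ⟨y, hy⟩ := ih (x - D.s n j (D.d (n+1) (j+1) x)) (by
        rw [map_sub, hx, e3, bd_bd _ D.dd, sub_zero]) (D.face_norm n j (by omega) x hk)
      refine ⟨y + (-((-1:ℤ)^(j+1)) • D.s (n+1) (j+1) x), ?_⟩
      rw [map_add, hy, ← e3, sub_add_cancel]
  exact key n x hx fun k h1 h2 => by omega

theorem normalise (n : ℕ) (u : X (n+1)) (hu : ∀ k ≤ n, D.d n k u = 0) (j : ℕ) : ∀ v : X (n+2), bd D.d (n+1) v = u →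
    (∀ k, j < k → k ≤ n + 1 → D.d (n+1) k v = 0) → ∃ w, D.d (n+1) 0 w = u ∧ ∀ k, 0 < k → k ≤ n + 1 → D.d (n+1) k w = 0 := by
  induction j with
  | zero =>
    intro v hv hk
    refine ⟨v, ?_, hk⟩
    rw [bd_apply, Finset.sum_range_succ', Finset.sum_eq_zero] at hv
    · simpa using hv
    · intro i hi
      have := Finset.mem_range.1 hi
      rw [hk _ (by omega) (by omega), smul_zero]
  | succ j ih =>
    intro v hv hk
    rcases Nat.lt_or_ge n j with hj | hj
    · exact ih v hv fun k h1 h2 => by omega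
    refine ih (v - D.s n j (D.d (n+1) (j+1) v)) ?_ (D.face_norm n j hj v hk)
    rw [map_sub, hv, sub_eq_self]
    have hdu := hu j hj
    have hk2 : ∀ k, j < k → k ≤ n → D.d n k (D.d (n+1) (j+1) v) = 0 := by
      intro k h1 h2
      rw [← D.dd n (j+1) k h1 h2, hk _ (by omega) (by omega), map_zero]
    rcases j with _ | j
    · rw [D.bd_s0 n _ hk2]
    obtain ⟨n, rfl⟩ : ∃ m, n = m + 1 := ⟨n - 1, by omega⟩
    rw [D.bd_s n j (by omega) _ hk2]
    have : (∑ k ∈ range (j+1), (-1:ℤ)^k • D.d (n+1) k (D.d (n+2) (j+2) v)) = 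
        D.d (n+1) (j+1) (∑ k ∈ range (j+1), (-1:ℤ)^k • D.d (n+2) k v) := by
      rw [map_sum]
      refine Finset.sum_congr rfl fun k hk => ?_
      have := Finset.mem_range.1 hk
      rw [D.dd (n+1) k (j+1) (by omega) (by omega), map_zsmul]
    rw [this]
    have e2 : u = (∑ k ∈ range (j+1), (-1:ℤ)^k • D.d (n+2) k v) + (-1:ℤ)^(j+1) • D.d (n+2) (j+1) v
         + (-1:ℤ)^(j+2) • D.d (n+2) (j+2) v := by
      rw [← hv, bd_apply, sum_split _ _ (j + 1 + 1 + 1) (n - j) (by omega), Finset.sum_range_succ,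
          Finset.sum_range_succ, Finset.sum_eq_zero (s := range (n-j)), add_zero]
      intro i hi
      have := Finset.mem_range.1 hi
      rw [hk _ (by omega) (by omega), smul_zero]
    rw [e2, map_add, map_add, map_zsmul, map_zsmul, D.dd (n+1) (j+1) (j+1) (by omega) (by omega), add_assoc,
      ← add_smul, pow_succ _ (j+1)] at hdu
    have hz : ((-1:ℤ)^(j+1) + (-1)^(j+1) * (-1)) = 0 := by ring
    rw [hz, zero_smul, add_zero] at hdu
    rw [hdu, map_zero]

theorem filler (hA : Acyc D.d) (n : ℕ) (y : ℕ → X (n+1))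
    (hy : ∀ i j, i ≤ j → j ≤ n → D.d n i (y (j+1)) = D.d n j (y i)) :
    ∃ w, ∀ k ≤ n + 1, D.d (n+1) k w = y k := by
  have kan : ∀ m, m ≤ n + 1 → ∃ w, ∀ k, n + 1 - m < k → k ≤ n + 1 → D.d (n+1) k w = y k := by
    intro m
    induction m with
    | zero => intro _; exact ⟨0, fun k h1 h2 => by omega⟩
    | succ m ih =>
      intro hm
      obtain ⟨w, hw⟩ := ih (by omega)
      obtain ⟨j, hj⟩ : ∃ j, n + 1 - m = j + 1 := ⟨n - m, by omega⟩
      refine ⟨w - D.s n j (D.d (n+1) (j+1) w - y (j+1)), fun k h1 h2 => ?_⟩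
      rw [map_sub]
      rcases Nat.lt_or_ge (j+1) k with h | h
      · rw [hw k (by omega) h2]
        obtain ⟨n, rfl⟩ : ∃ m, n = m + 1 := ⟨n - 1, by omega⟩
        obtain ⟨k, rfl⟩ : ∃ m, k = m + 2 := ⟨k - 2, by omega⟩
        rw [D.ds3 n k j (by omega) (by omega), map_sub, ← D.dd (n+1) (j+1) (k+1) (by omega) (by omega),
          hw _ (by omega) (by omega), hy _ _ (by omega) (by omega)]; simp
      · obtain rfl : k = j + 1 := by omega
        rw [D.ds2' n j (by omega)]; abel
  obtain ⟨w, hw⟩ := kan (n+1) le_rfl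
  have hu : ∀ k ≤ n, D.d n k (y 0 - D.d (n+1) 0 w) = 0 := by
    intro k hk
    rw [map_sub, ← D.dd n 0 k (by omega) hk, hw _ (by omega) (by omega), hy 0 k (by omega) hk, sub_self]
  obtain ⟨v, hv⟩ := hA.2 n (y 0 - D.d (n+1) 0 w) (by
    rw [bd_apply]; exact Finset.sum_eq_zero fun i hi => by
      rw [hu i (by have := Finset.mem_range.1 hi; omega), smul_zero])
  obtain ⟨v, hv0, hv1⟩ := D.normalise n _ hu (n+1) v hv fun k h1 h2 => by omega
  refine ⟨w + v, fun k hk => ?_⟩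
  rw [map_add]
  rcases Nat.eq_zero_or_pos k with rfl | h
  · rw [hv0]; abel
  · rw [hv1 k h hk, hw k (by omega) hk, add_zero]

theorem exists_contraction (hA : Acyc D.d) : ∃ h : ∀ n, X n → X (n+1), (∀ n x, D.d n 0 (h n x) = x) ∧
    ∀ n i, i ≤ n → ∀ x, D.d (n+1) (i+1) (h (n+1) x) = h n (D.d n i x) := by
  let P : ∀ n, (X n → X (n+1)) → Prop := fun n h => (∀ x, D.d n 0 (h x) = x) ∧
    ∀ i j, i + 1 ≤ j → j ≤ n → ∀ x, D.d n (i+1) (h (D.d n j x)) = D.d n j (h (D.d n i x))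
  have step : ∀ n (h : {h // P n h}), ∃ h' : {h // P (n+1) h},
      ∀ i, i ≤ n → ∀ x, D.d (n+1) (i+1) (h'.1 x) = h.1 (D.d n i x) := by
    rintro n ⟨h, h0, h1⟩
    have : ∀ x : X (n+1), ∃ w, ∀ k ≤ n + 1, D.d (n+1) k w = (fun k => Nat.casesOn k x (fun i => h (D.d n i x)) : ℕ → X (n+1)) k := by
      intro x
      refine D.filler hA n _ fun i j hij hj => ?_
      rcases i with _ | i
      · exact h0 _
      · exact h1 i j hij hj x
    choose h' hh' using this
    have a : ∀ i, i ≤ n → ∀ x, D.d (n+1) (i+1) (h' x) = h (D.d n i x) := fun i hi x => hh' x (i+1) (by omega)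
    refine ⟨⟨h', fun x => hh' x 0 (by omega), fun i j hij hj x => ?_⟩, a⟩
    obtain ⟨j, rfl⟩ : ∃ k, j = k + 1 := ⟨j - 1, by omega⟩
    rw [a i (by omega), a j (by omega), D.dd n i j (by omega) (by omega)]
  choose nx hnx using step
  have start : ∃ h : X 0 → X 1, P 0 h := by
    refine ⟨fun x => (hA.1 x).choose, fun x => (hA.1 x).choose_spec, fun i j _ _ => by omega⟩
  let H : ∀ n, {h // P n h} := fun n => Nat.rec ⟨start.choose, start.choose_spec⟩ (fun n h => nx n h) n
  exact ⟨fun n => (H n).1, fun n => (H n).2.1, fun n i hi x => hnx n (H n) i hi x⟩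

end SD

/-- double complex lemma -/
theorem double_complex {D : ℕ → ℕ → Type*} [∀ p q, AddCommGroup (D p q)]
    {A B : ℕ → Type*} [∀ p, AddCommGroup (A p)] [∀ p, AddCommGroup (B p)]
    (dh : ∀ p q, D (p+1) q →+ D p q) (dv : ∀ p q, D p (q+1) →+ D p q)
    (eA : ∀ q, D 0 q →+ A q) (dA : ∀ q, A (q+1) →+ A q) (eB : ∀ p, D p 0 →+ B p) (dB : ∀ q, B (q+1) →+ B q)
    (c1 : ∀ p q x, dh p q (dv (p+1) q x) = dv p q (dh p (q+1) x))
    (c2 : ∀ q x, eA q (dv 0 q x) = dA q (eA (q+1) x))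
    (c3 : ∀ p x, eB p (dh p 0 x) = dB p (eB (p+1) x))
    (hh : ∀ p q x, dh p q (dh (p+1) q x) = 0) (hh0 : ∀ q x, eA q (dh 0 q x) = 0)
    (vv : ∀ p q x, dv p q (dv p (q+1) x) = 0) (vv0 : ∀ p x, eB p (dv p 0 x) = 0)
    (rs : ∀ q, Function.Surjective (eA q)) (r0 : ∀ q x, eA q x = 0 → ∃ y, dh 0 q y = x)
    (r1 : ∀ p q x, dh p q x = 0 → ∃ y, dh (p+1) q y = x)
    (vs : ∀ p, Function.Surjective (eB p)) (v0 : ∀ p x, eB p x = 0 → ∃ y, dv p 0 y = x)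
    (v1 : ∀ p q x, dv p q x = 0 → ∃ y, dv p (q+1) y = x)
    (n : ℕ) (hA : ∀ a, dA n a = 0 → ∃ b, dA (n+1) b = a) :
    ∀ b, dB n b = 0 → ∃ c, dB (n+1) c = b := by
  have claim : ∀ p q, p + q = n → ∀ x : D (p+1) q, (∃ z, dh p q x = dv p q z) → 
      ∃ y y', x = dv (p+1) q y + dh (p+1) q y' := by
    intro p
    induction p with
    | zero =>
      intro q hq x ⟨z, hz⟩
      obtain rfl : q = n := by omega
      have : dA q (eA (q+1) z) = 0 := by rw [← c2, ← hz, hh0]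
      obtain ⟨a, ha⟩ := hA _ this
      obtain ⟨y, rfl⟩ := rs _ a
      rw [← c2] at ha
      obtain ⟨y', hy'⟩ := r0 (q+1) (z - dv 0 (q+1) y) (by rw [map_sub, ha, sub_self])
      obtain ⟨w, hw⟩ := r1 0 q (x - dv 1 q y') (by
        rw [map_sub, c1, hy', hz, map_sub, vv]; simp)
      exact ⟨y', w, by rw [hw]; abel⟩
    | succ p ih =>
      intro q hq x ⟨z, hz⟩
      have : dv p q (dh p (q+1) z) = 0 := by rw [← c1, ← hz, hh]
      obtain ⟨t, ht⟩ := v1 p q _ this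
      obtain ⟨y, y', hy⟩ := ih (q+1) (by omega) z ⟨t, ht.symm⟩
      obtain ⟨w, hw⟩ := r1 (p+1) q (x - dv (p+1+1) q y') (by
        rw [map_sub, c1, hz, hy, map_add, vv]; simp)
      exact ⟨y', w, by rw [hw]; abel⟩
  intro b hb
  obtain ⟨x, rfl⟩ := vs _ b
  rw [← c3] at hb
  obtain ⟨z, hz⟩ := v0 _ _ hb
  obtain ⟨y, y', hy⟩ := claim n 0 rfl x ⟨z, hz.symm⟩
  exact ⟨eB _ y', by rw [← c3, hy, map_add, vv0, zero_add]⟩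
end AQ

namespace AQ
open MvPolynomial

section J
variable {A : Type*} [CommRing A] {S : Type*} [CommRing S] [Algebra A S] (N : Type*) [AddCommGroup N] [Module S N]
variable {σ τ υ : Type*}

/-- Jacobian row -/
noncomputable def jac (a : MvPolynomial σ A →ₐ[A] S) (p : MvPolynomial σ A) : N →ₗ[S] (σ →₀ N) :=
  ∑ w ∈ p.vars, (Finsupp.lsingle w).comp ((a (pderiv w p) : S) • (LinearMap.id : N →ₗ[S] N))

/-- Jacobian map -/
noncomputable def J (a : MvPolynomial τ A →ₐ[A] S) (φ : MvPolynomial σ A →ₐ[A] MvPolynomial τ A) :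
    (σ →₀ N) →ₗ[S] (τ →₀ N) := Finsupp.lsum S fun v => jac N a (φ (X v))

variable {N}
theorem jac_apply (a : MvPolynomial σ A →ₐ[A] S) (p : MvPolynomial σ A) (n : N) (w : σ) :
    jac N a p n w = a (pderiv w p) • n := by
  classical
  simp only [jac, LinearMap.sum_apply, LinearMap.comp_apply, LinearMap.smul_apply, LinearMap.id_apply,
    Finsupp.lsingle_apply, Finsupp.finsetSum_apply, Finsupp.single_apply]
  rw [Finset.sum_ite_eq' p.vars w]
  split_ifs with h
  · rfl
  · rw [pderiv_eq_zero_of_notMem_vars h, map_zero, zero_smul]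

theorem jac_add (a : MvPolynomial σ A →ₐ[A] S) (p q : MvPolynomial σ A) (n : N) :
    jac N a (p + q) n = jac N a p n + jac N a q n := by
  ext w; simp [jac_apply, add_smul]

theorem jac_mul (a : MvPolynomial σ A →ₐ[A] S) (p q : MvPolynomial σ A) (n : N) :
    jac N a (p * q) n = a p • jac N a q n + a q • jac N a p n := by
  ext w
  simp only [jac_apply, Finsupp.add_apply, Finsupp.smul_apply, Derivation.leibniz, map_add, smul_eq_mul, map_mul,
    add_smul, mul_smul]

theorem jac_C (a : MvPolynomial σ A →ₐ[A] S) (r : A) (n : N) : jac N a (C r) n = 0 := by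
  ext w; simp [jac_apply]

theorem jac_X (a : MvPolynomial σ A →ₐ[A] S) (v : σ) (n : N) : jac N a (X v) n = Finsupp.single v n := by
  classical
  ext w
  by_cases h : v = w
  · subst h; simp [jac_apply]
  · simp [jac_apply, h, pderiv_X_of_ne h]

theorem J_single (a : MvPolynomial τ A →ₐ[A] S) (φ : MvPolynomial σ A →ₐ[A] MvPolynomial τ A) (v : σ) (n : N) :
    J N a φ (Finsupp.single v n) = jac N a (φ (X v)) n := by
  simp [J]

theorem J_jac (a : MvPolynomial τ A →ₐ[A] S) (φ : MvPolynomial σ A →ₐ[A] MvPolynomial τ A) 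
    (b : MvPolynomial σ A →ₐ[A] S) (hb : ∀ p, a (φ p) = b p) (p : MvPolynomial σ A) (n : N) :
    J N a φ (jac N b p n) = jac N a (φ p) n := by
  induction p using MvPolynomial.induction_on with
  | C r => 
    rw [jac_C, map_zero, show φ (C r) = C r from φ.commutes r, jac_C]
  | add p q hp hq => rw [jac_add, map_add, map_add, jac_add, hp, hq]
  | mul_X p v hp => 
    rw [jac_mul, map_mul, jac_mul, map_add, map_smul, map_smul, hp, jac_X, J_single, hb, hb]

theorem J_J (a : MvPolynomial υ A →ₐ[A] S) (ψ : MvPolynomial τ A →ₐ[A] MvPolynomial υ A)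
    (φ : MvPolynomial σ A →ₐ[A] MvPolynomial τ A) 
    (b : MvPolynomial τ A →ₐ[A] S) (hb : ∀ p, a (ψ p) = b p) (x : σ →₀ N) :
    J N a ψ (J N b φ x) = J N a (ψ.comp φ) x := by
  induction x using Finsupp.induction_linear with
  | zero => simp
  | add x y hx hy => simp only [map_add, hx, hy]
  | single v n => rw [J_single, J_single, J_jac a ψ b hb]; rfl

theorem J_congr (a : MvPolynomial τ A →ₐ[A] S) (φ ψ : MvPolynomial σ A →ₐ[A] MvPolynomial τ A) 
    (h : ∀ v, φ (X v) = ψ (X v)) (x : σ →₀ N) : J N a φ x = J N a ψ x := by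
  rw [MvPolynomial.algHom_ext (f := φ) (g := ψ) h]

theorem J_rename (a : MvPolynomial τ A →ₐ[A] S) (f : σ → τ) (x : σ →₀ N) : 
    J N a (rename f) x = Finsupp.mapDomain f x := by
  induction x using Finsupp.induction_linear with
  | zero => simp
  | add x y hx hy => simp only [map_add, hx, hy, Finsupp.mapDomain_add]
  | single v n => rw [J_single, rename_X, jac_X, Finsupp.mapDomain_single]

theorem J_id (a : MvPolynomial σ A →ₐ[A] S) (φ : MvPolynomial σ A →ₐ[A] MvPolynomial σ A) 
    (h : ∀ v, φ (X v) = X v) (x : σ →₀ N) : J N a φ x = x := by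
  induction x using Finsupp.induction_linear with
  | zero => simp
  | add x y hx hy => simp only [map_add, hx, hy]
  | single v n => rw [J_single, h, jac_X]
end J

section std
variable (A : Type u) [CommRing A] (T : Type u) [CommRing T] [Algebra A T]

/-- standard resolution, as polynomial rings -/
abbrev PX (n : ℕ) : Type u := MvPolynomial (AQV A T n) A

noncomputable def ag (n : ℕ) : PX A T n →ₐ[A] T := AQaug A T n
noncomputable def fc (n i : ℕ) : PX A T (n+1) →ₐ[A] PX A T n := AQface A T n i
/-- an element of `AQV (n+1)` as a polynomial -/
def pp {A T : Type u} [CommRing A] {n : ℕ} (v : AQV A T (n+1)) : PX A T n := v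
def qq {A T : Type u} [CommRing A] {n : ℕ} (v : PX A T n) : AQV A T (n+1) := v
def p0 {A T : Type u} [CommRing A] (v : AQV A T 0) : T := v
def q0 {A T : Type u} [CommRing A] (v : T) : AQV A T 0 := v

theorem ag_zero (v : AQV A T 0) : ag A T 0 (X v) = p0 v := aeval_X _ _
theorem ag_succ (n : ℕ) (v : AQV A T (n+1)) : ag A T (n+1) (X v) = ag A T n (pp v) := aeval_X _ _
theorem fc_zero (n : ℕ) (v : AQV A T (n+1)) : fc A T n 0 (X v) = pp v := by
  cases n <;> exact aeval_X _ _
theorem fc_one (i : ℕ) (v : AQV A T 1) : fc A T 0 (i+1) (X v) = X (q0 (ag A T 0 (pp v))) := rename_X _ _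
theorem fc_succ (n i : ℕ) (v : AQV A T (n+2)) : fc A T (n+1) (i+1) (X v) = X (qq (fc A T n i (pp v))) := rename_X _ _

theorem ag_fc (n i : ℕ) (p : PX A T (n+1)) : ag A T n (fc A T n i p) = ag A T (n+1) p := by
  suffices h : (ag A T n).comp (fc A T n i) = ag A T (n+1) from DFunLike.congr_fun h p
  clear p
  refine MvPolynomial.algHom_ext fun v => ?_
  rw [AlgHom.comp_apply, ag_succ]
  induction n generalizing i with
  | zero => 
    rcases i with _ | i
    · rw [fc_zero]
    · rw [fc_one, ag_zero]; rfl
  | succ n ih =>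
    rcases i with _ | i
    · rw [fc_zero]
    · rw [fc_succ, ag_succ]
      have := MvPolynomial.algHom_ext (f := (ag A T n).comp (fc A T n i)) (g := ag A T (n+1)) fun w => by
        rw [AlgHom.comp_apply, ag_succ, ih]
      exact DFunLike.congr_fun this (pp v)

theorem fc_fc (n i j : ℕ) (h : i ≤ j) (p : PX A T (n+2)) : 
    fc A T n i (fc A T (n+1) (j+1) p) = fc A T n j (fc A T (n+1) i p) := by
  suffices h : (fc A T n i).comp (fc A T (n+1) (j+1)) = (fc A T n j).comp (fc A T (n+1) i) from DFunLike.congr_fun h p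
  clear p
  induction n generalizing i j with
  | zero => 
    refine MvPolynomial.algHom_ext fun v => ?_
    rw [AlgHom.comp_apply, AlgHom.comp_apply, fc_succ]
    rcases i with _ | i
    · rw [fc_zero, fc_zero]; rfl
    · obtain ⟨j, rfl⟩ : ∃ k, j = k + 1 := ⟨j - 1, by omega⟩
      rw [fc_succ, fc_one, fc_one]
      exact congrArg (fun z => X (q0 z)) ((ag_fc A T 0 (j+1) (pp v)).trans (ag_fc A T 0 i (pp v)).symm)
  | succ n ih =>
    refine MvPolynomial.algHom_ext fun v => ?_
    rw [AlgHom.comp_apply, AlgHom.comp_apply, fc_succ]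
    rcases i with _ | i
    · rw [fc_zero, fc_zero]; rfl
    · obtain ⟨j, rfl⟩ : ∃ k, j = k + 1 := ⟨j - 1, by omega⟩
      rw [fc_succ, fc_succ, fc_succ]
      exact congrArg (fun z => X (qq z)) (DFunLike.congr_fun (ih i j (by omega)) (pp v))

/-- functoriality on sets -/
noncomputable def gm (A : Type u) [CommRing A] {T T' : Type u} (h : T → T') : ∀ n, AQV A T n → AQV A T' n
  | 0 => h
  | n+1 => fun v => qq (rename (gm A h n) (pp v))

theorem gm_succ {T T' : Type u} (h : T → T') (n : ℕ) (v : AQV A T (n+1)) :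
  gm A h (n+1) v = qq (rename (gm A h n) (pp v)) := rfl

theorem gm_gm {T T' T'' : Type u} (h : T → T') (h' : T' → T'') (n : ℕ) (v : AQV A T n) :
    gm A h' n (gm A h n v) = gm A (fun x => h' (h x)) n v := by
  induction n with
  | zero => rfl
  | succ n ih => 
    rw [gm_succ, gm_succ, gm_succ]
    refine congrArg qq ((rename_rename _ _ _).trans ?_)
    congr 2
    funext w; exact ih w

theorem gm_id {T : Type u} (n : ℕ) (v : AQV A T n) : gm A (fun x : T => x) n v = v := by
  induction n with
  | zero => rfl
  | succ n ih => 
    rw [gm_succ, show gm A (fun x : T => x) n = id from funext ih, rename_id_apply]; rfl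

variable {A T} {T' : Type u} [CommRing T'] [Algebra A T']
theorem ag_gm (h : T →ₐ[A] T') (n : ℕ) (p : PX A T n) : ag A T' n (rename (gm A h n) p) = h (ag A T n p) := by
  suffices hh : (ag A T' n).comp (rename (gm A h n)) = h.comp (ag A T n) from DFunLike.congr_fun hh p
  clear p
  induction n with
  | zero => 
    refine MvPolynomial.algHom_ext fun v => ?_
    rw [AlgHom.comp_apply, AlgHom.comp_apply, rename_X, ag_zero, ag_zero]; rfl
  | succ n ih =>
    refine MvPolynomial.algHom_ext fun v => ?_
    rw [AlgHom.comp_apply, AlgHom.comp_apply, rename_X, ag_succ, ag_succ]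
    exact DFunLike.congr_fun (ih) (pp v)

theorem fc_gm (h : T →ₐ[A] T') (n i : ℕ) (p : PX A T (n+1)) : 
    fc A T' n i (rename (gm A h (n+1)) p) = rename (gm A h n) (fc A T n i p) := by
  suffices hh : (fc A T' n i).comp (rename (gm A h (n+1))) = (rename (gm A h n)).comp (fc A T n i) from 
    DFunLike.congr_fun hh p
  clear p
  induction n generalizing i with
  | zero => 
    refine MvPolynomial.algHom_ext fun v => ?_
    rw [AlgHom.comp_apply, AlgHom.comp_apply, rename_X]
    rcases i with _ | i
    · rw [fc_zero, fc_zero]; rfl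
    · rw [fc_one, fc_one, rename_X]
      exact congrArg (fun z => X (q0 z)) (ag_gm h 0 (pp v))
  | succ n ih =>
    refine MvPolynomial.algHom_ext fun v => ?_
    rw [AlgHom.comp_apply, AlgHom.comp_apply, rename_X]
    rcases i with _ | i
    · rw [fc_zero, fc_zero]; rfl
    · rw [fc_succ, fc_succ, rename_X]
      exact congrArg (fun z => X (qq z)) (DFunLike.congr_fun (ih i) (pp v))
end std

section cc
variable {A : Type u} [CommRing A] {V : Type u}
/-- section of the counit -/
noncomputable def gam (A V : Type u) [CommRing A] : MvPolynomial V A →ₐ[A] PX A (MvPolynomial V A) 0 :=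
  aeval fun v => X (q0 (X v))
noncomputable def cc (A V : Type u) [CommRing A] : ∀ n, AQV A (MvPolynomial V A) n → AQV A (MvPolynomial V A) (n+1)
  | 0 => fun v => qq (gam A V (p0 v))
  | n+1 => fun v => qq (rename (cc A V n) (pp v))

theorem ag_gam (p : MvPolynomial V A) : ag A _ 0 (gam A V p) = p := by
  suffices hh : (ag A _ 0).comp (gam A V) = AlgHom.id A _ from DFunLike.congr_fun hh p
  refine MvPolynomial.algHom_ext fun v => ?_
  rw [AlgHom.comp_apply, gam, aeval_X, ag_zero]; rfl

theorem ag_cc (n : ℕ) (p) : ag A _ (n+1) (rename (cc A V n) p) = ag A _ n p := by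
  suffices hh : (ag A _ (n+1)).comp (rename (cc A V n)) = ag A _ n from DFunLike.congr_fun hh p
  clear p
  induction n with
  | zero => 
    refine MvPolynomial.algHom_ext fun v => ?_
    rw [AlgHom.comp_apply, rename_X, ag_zero, ag_succ]; exact ag_gam _
  | succ n ih =>
    refine MvPolynomial.algHom_ext fun v => ?_
    rw [AlgHom.comp_apply, rename_X, ag_succ, ag_succ]; exact DFunLike.congr_fun ih (pp v)

theorem fc_cc_last (n : ℕ) (p) : fc A _ n (n+1) (rename (cc A V n) p) = p := by
  suffices hh : (fc A _ n (n+1)).comp (rename (cc A V n)) = AlgHom.id A _ from DFunLike.congr_fun hh p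
  clear p
  induction n with
  | zero => 
    refine MvPolynomial.algHom_ext fun v => ?_
    rw [AlgHom.comp_apply, rename_X, fc_one]; exact congrArg (fun z => X (q0 z)) (ag_gam (p0 v))
  | succ n ih =>
    refine MvPolynomial.algHom_ext fun v => ?_
    rw [AlgHom.comp_apply, rename_X, fc_succ]; 
    exact congrArg (fun z => X (qq z)) (DFunLike.congr_fun ih (pp v))

theorem fc_cc_zero (p) : fc A _ 0 0 (rename (cc A V 0) p) = gam A V (ag A _ 0 p) := by
  suffices hh : (fc A _ 0 0).comp (rename (cc A V 0)) = (gam A V).comp (ag A _ 0) from DFunLike.congr_fun hh p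
  refine MvPolynomial.algHom_ext fun v => ?_
  rw [AlgHom.comp_apply, AlgHom.comp_apply, rename_X, fc_zero, ag_zero]; rfl

theorem fc_cc (n i : ℕ) (hi : i ≤ n + 1) (p) : 
    fc A _ (n+1) i (rename (cc A V (n+1)) p) = rename (cc A V n) (fc A _ n i p) := by
  suffices hh : (fc A _ (n+1) i).comp (rename (cc A V (n+1))) = (rename (cc A V n)).comp (fc A _ n i) from 
    DFunLike.congr_fun hh p
  clear p
  induction n generalizing i with
  | zero => 
    refine MvPolynomial.algHom_ext fun v => ?_
    rw [AlgHom.comp_apply, AlgHom.comp_apply, rename_X]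
    rcases i with _ | i
    · rw [fc_zero, fc_zero]; rfl
    · obtain rfl : i = 0 := by omega
      rw [fc_one, fc_succ, rename_X]
      exact congrArg (fun z => X (qq z)) (fc_cc_zero (pp v))
  | succ n ih =>
    refine MvPolynomial.algHom_ext fun v => ?_
    rw [AlgHom.comp_apply, AlgHom.comp_apply, rename_X]
    rcases i with _ | i
    · rw [fc_zero, fc_zero]; rfl
    · rw [fc_succ, fc_succ, rename_X]
      exact congrArg (fun z => X (qq z)) (DFunLike.congr_fun (ih i (by omega)) (pp v))
end cc

end AQ

namespace AQ
open MvPolynomial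

/-- augmented family -/
def AugX (S : Type u) (X : ℕ → Type u) : ℕ → Type u
  | 0 => S
  | n+1 => X n

instance augXinst (S : Type u) (X : ℕ → Type u) [i1 : AddCommGroup S] [i2 : ∀ n, AddCommGroup (X n)] : 
    ∀ n, AddCommGroup (AugX S X n)
  | 0 => i1
  | n+1 => i2 n

/-- augmented faces -/
def augd {S : Type u} {X : ℕ → Type u} [AddCommGroup S] [∀ n, AddCommGroup (X n)] (ε : X 0 →+ S)
    (d : ∀ n, ℕ → X (n+1) →+ X n) : ∀ n, ℕ → AugX S X (n+1) →+ AugX S X n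
  | 0, _ => ε
  | n+1, i => d n i

/-- unaugmented boundary -/
noncomputable def bdu {X : ℕ → Type u} [∀ n, AddCommGroup (X n)] (d : ∀ n, ℕ → X (n+1) →+ X n) (n : ℕ) : X (n+1) →+ X n :=
  ∑ i ∈ Finset.range (n+2), ((-1 : ℤ)^i) • d n i

section
variable {S : Type u} {X : ℕ → Type u} [AddCommGroup S] [∀ n, AddCommGroup (X n)] (ε : X 0 →+ S)
    (d : ∀ n, ℕ → X (n+1) →+ X n)

theorem bdu_apply (n : ℕ) (x : X (n+1)) :
    bdu d n x = ∑ i ∈ Finset.range (n+2), ((-1 : ℤ)^i) • d n i x := by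
  simp [bdu]

theorem bd_aug_zero (x : X 0) : bd (augd ε d) 0 x = ε x := by
  have := bd_apply (augd ε d) 0 x
  rw [Finset.sum_range_one, pow_zero, one_smul] at this
  exact this

theorem bd_aug_succ (n : ℕ) : bd (augd ε d) (n+1) = bdu d n := rfl

/-- augmented acyclicity, unaugmented indexing -/
def AcycU : Prop := Function.Surjective ε ∧ (∀ x, ε x = 0 → ∃ y, bdu d 0 y = x) ∧ 
  ∀ n x, bdu d n x = 0 → ∃ y, bdu d (n+1) y = x

theorem acycU_iff : AcycU ε d ↔ Acyc (augd ε d) := by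
  constructor
  · rintro ⟨h1, h2, h3⟩
    refine ⟨h1, fun n => ?_⟩
    rcases n with _ | n
    · intro x hx
      exact h2 x ((bd_aug_zero ε d x).symm.trans hx)
    · exact h3 n
  · rintro ⟨h1, h2⟩
    exact ⟨h1, fun x hx => h2 0 x ((bd_aug_zero ε d x).trans hx), fun n => h2 (n+1)⟩

theorem bdu_bdu (hd : ∀ n i j, i ≤ j → j ≤ n + 1 → ∀ x, d n i (d (n+1) (j+1) x) = d n j (d (n+1) i x)) (n : ℕ) (x : X (n+2)) :
    bdu d n (bdu d (n+1) x) = 0 := by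
  refine bd_bd (X := AugX PUnit.{u+1} X) (augd (0 : X 0 →+ PUnit.{u+1}) d) ?_ (n+1) x
  intro n i j h1 h2 x
  rcases n with _ | n
  · rfl
  · exact hd n i j h1 h2 x

theorem eps_bdu (he : ∀ x, ε (d 0 1 x) = ε (d 0 0 x)) (x : X 1) : ε (bdu d 0 x) = 0 := by
  rw [bdu_apply, Finset.sum_range_succ, Finset.sum_range_one, map_add, map_zsmul, map_zsmul, he]; simp
end

theorem acycU_first {S : Type u} {X : ℕ → Type u} [AddCommGroup S] [∀ n, AddCommGroup (X n)] (ε : X 0 →+ S)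
    (d : ∀ n, ℕ → X (n+1) →+ X n) (t : S →+ X 0) (s : ∀ n, X n →+ X (n+1))
    (h0 : ∀ x, ε (t x) = x) (h1 : ∀ n x, d n 0 (s n x) = x) (h2 : ∀ x, d 0 1 (s 0 x) = t (ε x))
    (h3 : ∀ n i, i ≤ n + 1 → ∀ x, d (n+1) (i+1) (s (n+1) x) = s n (d n i x)) : AcycU ε d := by
  rw [acycU_iff]
  refine acyc_first _ (fun n => match n with | 0 => t | n+1 => s n) ?_ ?_
  · intro n x
    rcases n with _ | n
    exacts [h0 x, h1 n x]
  · intro n i hi x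
    rcases n with _ | n
    · obtain rfl : i = 0 := by omega
      exact h2 x
    · exact h3 n i hi x

theorem acycU_last {S : Type u} {X : ℕ → Type u} [AddCommGroup S] [∀ n, AddCommGroup (X n)] (ε : X 0 →+ S)
    (d : ∀ n, ℕ → X (n+1) →+ X n) (t : S →+ X 0) (s : ∀ n, X n →+ X (n+1))
    (h0 : ∀ x, ε (t x) = x) (h1 : ∀ n x, d n (n+1) (s n x) = x) (h2 : ∀ x, d 0 0 (s 0 x) = t (ε x))
    (h3 : ∀ n i, i ≤ n + 1 → ∀ x, d (n+1) i (s (n+1) x) = s n (d n i x)) : AcycU ε d := by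
  rw [acycU_iff]
  refine acyc_last _ (fun n => match n with | 0 => t | n+1 => s n) ?_ ?_
  · intro n x
    rcases n with _ | n
    exacts [h0 x, h1 n x]
  · intro n i hi x
    rcases n with _ | n
    · obtain rfl : i = 0 := by omega
      exact h2 x
    · exact h3 n i hi x

/-- simplicial polynomial algebra with augmentation -/
structure PR (A S : Type u) [CommRing A] [CommRing S] [Algebra A S] where
  V : ℕ → Type u
  d : ∀ n : ℕ, ℕ → MvPolynomial (V (n+1)) A →ₐ[A] MvPolynomial (V n) A
  s : ∀ n : ℕ, ℕ → MvPolynomial (V n) A →ₐ[A] MvPolynomial (V (n+1)) A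
  ε : MvPolynomial (V 0) A →ₐ[A] S
  dd : ∀ n i j, i ≤ j → j ≤ n + 1 → ∀ x, d n i (d (n+1) (j+1) x) = d n j (d (n+1) i x)
  de : ∀ x, ε (d 0 1 x) = ε (d 0 0 x)
  ds1 : ∀ n i j, i ≤ j → j ≤ n → ∀ x, d (n+1) i (s (n+1) (j+1) x) = s n j (d n i x)
  ds2 : ∀ n j, j ≤ n → ∀ x, d n j (s n j x) = x
  ds2' : ∀ n j, j ≤ n → ∀ x, d n (j+1) (s n j x) = x
  ds3 : ∀ n i j, j ≤ i → i ≤ n → ∀ x, d (n+1) (i+2) (s (n+1) j x) = s n j (d n (i+1) x)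

namespace PR
variable {A S : Type u} [CommRing A] [CommRing S] [Algebra A S] (P : PR A S)

abbrev X (n : ℕ) : Type u := MvPolynomial (P.V n) A
/-- underlying faces -/
noncomputable def da (n i : ℕ) : MvPolynomial (P.V (n+1)) A →+ MvPolynomial (P.V n) A := (P.d n i : _ →+ _)

noncomputable def toSD : SD (AugX S P.X) where
  d := augd (X := P.X) (P.ε : P.X 0 →+ S) P.da
  s n i := (P.s n i : P.X n →+ P.X (n+1))
  dd n i j h1 h2 x := by
    rcases n with _ | n
    · obtain rfl : j = 0 := by omega
      obtain rfl : i = 0 := by omega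
      exact P.de x
    · exact P.dd n i j h1 h2 x
  ds1 n i j h1 h2 x := P.ds1 n i j h1 h2 x
  ds2 n j h x := P.ds2 n j h x
  ds2' n j h x := P.ds2' n j h x
  ds3 n i j h1 h2 x := P.ds3 n i j h1 h2 x

/-- acyclicity -/
def Ac : Prop := AcycU (X := P.X) (P.ε : P.X 0 →+ S) P.da

noncomputable def aug : ∀ n, MvPolynomial (P.V n) A →ₐ[A] S
  | 0 => P.ε
  | n+1 => (aug n).comp (P.d n 0)

theorem aug_d (n i : ℕ) (hi : i ≤ n + 1) (x) : P.aug n (P.d n i x) = P.aug (n+1) x := by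
  induction n generalizing i with
  | zero => 
    rcases i with _ | i
    · rfl
    · obtain rfl : i = 0 := by omega
      exact P.de x
  | succ n ih =>
    rcases i with _ | i
    · rfl
    · change P.aug n (P.d n 0 (P.d (n+1) (i+1) x)) = P.aug (n+1) (P.d (n+1) 0 x)
      rw [P.dd n 0 i (by omega) (by omega), ih i (by omega)]

variable (N : Type u) [AddCommGroup N] [Module S N]
abbrev L (n : ℕ) : Type u := P.V n →₀ N
/-- induced faces on differentials -/
noncomputable def jd (n i : ℕ) : (P.V (n+1) →₀ N) →+ (P.V n →₀ N) := (J N (P.aug n) (P.d n i)).toAddMonoidHom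

/-- exactness at `n+1` -/
def ExJ (n : ℕ) : Prop := ∀ x, bdu (X := P.L N) (P.jd N) n x = 0 → ∃ y, bdu (X := P.L N) (P.jd N) (n+1) y = x
end PR

/-- exactness of the cotangent complex at `n+1` -/
def ExAQ (A S : Type u) [CommRing A] [CommRing S] [Algebra A S] (N : Type u) [AddCommGroup N] [Module S N] (n : ℕ) : Prop :=
  ∀ x, AQdiff A S N n x = 0 → ∃ y, AQdiff A S N (n+1) y = x

theorem AQind_eq (A S : Type u) [CommRing A] [CommRing S] [Algebra A S] (N : Type u) [AddCommGroup N] [Module S N] (n i : ℕ) :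
    AQind A S N n (AQface A S n i) = J N (ag A S n) (fc A S n i) := rfl

section C
variable {A S : Type u} [CommRing A] [CommRing S] [Algebra A S] (N : Type u) [AddCommGroup N] [Module S N]

abbrev AX (A S N : Type u) [CommRing A] [AddCommGroup N] (n : ℕ) : Type u := AQV A S n →₀ N
noncomputable def aqd (n i : ℕ) : (AQV A S (n+1) →₀ N) →+ (AQV A S n →₀ N) := (J N (ag A S n) (fc A S n i)).toAddMonoidHom

theorem AQdiff_eq (n : ℕ) (x) : AQdiff A S N n x = bdu (X := AX A S N) (aqd N) n x := by
  rw [bdu_apply]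
  simp only [AQdiff, LinearMap.sum_apply, LinearMap.smul_apply, AQind_eq]
  rfl

/-- column faces -/
noncomputable def cold {V : Type u} (a : MvPolynomial V A →ₐ[A] S) (q i : ℕ) :
    (AQV A (MvPolynomial V A) (q+1) →₀ N) →+ (AQV A (MvPolynomial V A) q →₀ N) :=
  (J N (a.comp (ag A _ q)) (fc A _ q i)).toAddMonoidHom

noncomputable def cole {V : Type u} (a : MvPolynomial V A →ₐ[A] S) :
    (AQV A (MvPolynomial V A) 0 →₀ N) →+ (V →₀ N) := (J N a (ag A _ 0)).toAddMonoidHom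

theorem col_dd {V : Type u} (a : MvPolynomial V A →ₐ[A] S) (n i j : ℕ) (h : i ≤ j) (x) : 
    cold N a n i (cold N a (n+1) (j+1) x) = cold N a n j (cold N a (n+1) i x) := by
  change J N _ _ (J N _ _ x) = J N _ _ (J N _ _ x)
  rw [J_J _ (fc A _ n i) _ _ (fun p => congrArg a (ag_fc A _ n i p)), J_J _ (fc A _ n j) _ _ (fun p => congrArg a (ag_fc A _ n j p))]
  exact J_congr _ _ _ (fun v => fc_fc A _ n i j h _) x

theorem col_de {V : Type u} (a : MvPolynomial V A →ₐ[A] S) (x) : 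
    cole N a (cold N a 0 1 x) = cole N a (cold N a 0 0 x) := by
  change J N _ _ (J N _ _ x) = J N _ _ (J N _ _ x)
  rw [J_J _ _ _ _ (fun p => rfl), J_J _ _ _ _ (fun p => rfl)]
  exact J_congr _ _ _ (fun v => (ag_fc A _ 0 1 _).trans (ag_fc A _ 0 0 _).symm) x

theorem col_acyc {V : Type u} (a : MvPolynomial V A →ₐ[A] S) : AcycU (X := AX A (MvPolynomial V A) N) (cole N a) (cold N a) := by
  refine acycU_last (X := AX A (MvPolynomial V A) N) _ _ (J N (a.comp (ag A _ 0)) (gam A V)).toAddMonoidHom 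
    (fun n => (J N (a.comp (ag A _ (n+1))) (rename (cc A V n))).toAddMonoidHom) ?_ ?_ ?_ ?_
  · intro x
    change J N _ _ (J N _ _ x) = x
    rw [J_J _ _ _ _ (fun p => rfl)]
    exact J_id _ _ (fun v => ag_gam _) x
  · intro n x
    change J N _ _ (J N _ _ x) = x
    rw [J_J _ (fc A _ n (n+1)) _ _ (fun p => congrArg a (ag_fc A _ n _ p))]
    exact J_id _ _ (fun v => fc_cc_last _ _) x
  · intro x
    change J N _ _ (J N _ _ x) = J N _ _ (J N _ _ x)
    rw [J_J _ (fc A _ 0 0) _ _ (fun p => congrArg a (ag_fc A _ 0 0 p)), J_J _ (gam A V) _ _ (fun p => congrArg a (ag_gam p))]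
    exact J_congr _ _ _ (fun v => fc_cc_zero _) x
  · intro n i hi x
    change J N _ _ (J N _ _ x) = J N _ _ (J N _ _ x)
    rw [J_J _ (fc A _ (n+1) i) _ _ (fun p => congrArg a (ag_fc A _ _ _ p)), J_J _ (rename (cc A V n)) _ _ (fun p => congrArg a (ag_cc n p))]
    exact J_congr _ _ _ (fun v => fc_cc _ _ hi _) x

variable (P : PR A S)
abbrev RX (q p : ℕ) : Type u := AQV A (MvPolynomial (P.V p) A) q →₀ N
noncomputable def rowd (q p i : ℕ) : (AQV A (MvPolynomial (P.V (p+1)) A) q →₀ N) →+ (AQV A (MvPolynomial (P.V p) A) q →₀ N) :=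
  Finsupp.mapDomain.addMonoidHom (gm A (P.d p i) q)

noncomputable def rowe (q : ℕ) : (AQV A (MvPolynomial (P.V 0) A) q →₀ N) →+ (AQV A S q →₀ N) :=
  Finsupp.mapDomain.addMonoidHom (gm A P.ε q)

theorem mapDomain_gm {T T' T'' : Type u} (h : T → T') (h' : T' → T'') (n : ℕ) (x : AQV A T n →₀ N) :
    Finsupp.mapDomain (gm A h' n) (Finsupp.mapDomain (gm A h n) x) = Finsupp.mapDomain (gm A (fun x => h' (h x)) n) x := by
  rw [← Finsupp.mapDomain_comp]
  congr 1
  funext v; exact gm_gm A h h' n v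

theorem row_dd (q n i j : ℕ) (h : i ≤ j) (h' : j ≤ n + 1) (x) : 
    rowd N P q n i (rowd N P q (n+1) (j+1) x) = rowd N P q n j (rowd N P q (n+1) i x) := by
  change Finsupp.mapDomain _ (Finsupp.mapDomain _ x) = Finsupp.mapDomain _ (Finsupp.mapDomain _ x)
  rw [mapDomain_gm, mapDomain_gm]
  congr 2
  funext y; exact P.dd n i j h h' y

theorem row_de (q : ℕ) (x) : 
    rowe N P q (rowd N P q 0 1 x) = rowe N P q (rowd N P q 0 0 x) := by
  change Finsupp.mapDomain _ (Finsupp.mapDomain _ x) = Finsupp.mapDomain _ (Finsupp.mapDomain _ x)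
  rw [mapDomain_gm, mapDomain_gm]
  congr 2
  funext y; exact P.de y

theorem mapDomain_gm_id {T T' : Type u} (h : T → T') (h' : T' → T) (hh : ∀ x, h' (h x) = x) (n : ℕ) (x : AQV A T n →₀ N) :
    Finsupp.mapDomain (gm A h' n) (Finsupp.mapDomain (gm A h n) x) = x := by
  rw [mapDomain_gm, show (fun x => h' (h x)) = fun x => x from funext hh, 
    show gm A (fun x : T => x) n = id from funext fun v => gm_id A n v]
  exact Finsupp.mapDomain_id

theorem row_acyc' (q : ℕ) (t : S → P.X 0) (h : ∀ n, P.X n → P.X (n+1)) (h0 : ∀ x, P.ε (t x) = x)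
    (h1 : ∀ n x, P.d n 0 (h n x) = x) (h2 : ∀ x, P.d 0 1 (h 0 x) = t (P.ε x))
    (h3 : ∀ n i, i ≤ n + 1 → ∀ x, P.d (n+1) (i+1) (h (n+1) x) = h n (P.d n i x)) : AcycU (X := RX N P q) (rowe N P q) (rowd N P q) := by
  refine acycU_first (X := RX N P q) _ _ (Finsupp.mapDomain.addMonoidHom (gm A t q)) 
    (fun n => Finsupp.mapDomain.addMonoidHom (gm A (h n) q)) ?_ ?_ ?_ ?_
  · exact fun x => mapDomain_gm_id N _ _ h0 q x
  · exact fun n x => mapDomain_gm_id N _ _ (h1 n) q x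
  · intro x
    change Finsupp.mapDomain _ (Finsupp.mapDomain _ x) = Finsupp.mapDomain _ (Finsupp.mapDomain _ x)
    rw [mapDomain_gm, mapDomain_gm]
    congr 2
    funext y; exact h2 y
  · intro n i hi x
    change Finsupp.mapDomain _ (Finsupp.mapDomain _ x) = Finsupp.mapDomain _ (Finsupp.mapDomain _ x)
    rw [mapDomain_gm, mapDomain_gm]
    congr 2
    funext y; exact h3 n i hi y

theorem row_acyc (hP : P.Ac) (q : ℕ) : AcycU (X := RX N P q) (rowe N P q) (rowd N P q) := by
  obtain ⟨h, h0, h1⟩ := P.toSD.exists_contraction ((acycU_iff _ _).1 hP)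
  exact row_acyc' N P q (h 0) (fun n => h (n+1)) (fun x => h0 0 x) (fun n x => h0 (n+1) x) (fun x => h1 0 0 le_rfl x)
    (fun n i hi x => h1 (n+1) i hi x)

theorem bdu_comm {X Y : ℕ → Type u} [∀ n, AddCommGroup (X n)] [∀ n, AddCommGroup (Y n)] 
    (d : ∀ n, ℕ → X (n+1) →+ X n) (d' : ∀ n, ℕ → Y (n+1) →+ Y n) (n : ℕ) (f : X (n+1) →+ Y (n+1)) (g : X n →+ Y n)
    (h : ∀ i, i ≤ n + 1 → ∀ x, g (d n i x) = d' n i (f x)) (x) : g (bdu d n x) = bdu d' n (f x) := by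
  rw [bdu_apply, bdu_apply, map_sum]
  refine Finset.sum_congr rfl fun i hi => ?_
  rw [map_zsmul, h i (by have := Finset.mem_range.1 hi; omega)]

theorem mapDomain_eq_J {T T' : Type u} [CommRing T] [CommRing T'] [Algebra A T] [Algebra A T'] (h : T → T') (n : ℕ) 
    (a : PX A T' n →ₐ[A] S) (x : AQV A T n →₀ N) : 
    Finsupp.mapDomain (gm A h n) x = J N a (rename (gm A h n)) x := (J_rename a _ x).symm

theorem comparison (hP : P.Ac) (n : ℕ) : P.ExJ N n ↔ ExAQ A S N n := by
  have c1' : ∀ p q i j, i ≤ p + 1 → j ≤ q + 1 → ∀ x, rowd N P q p i (cold N (P.aug (p+1)) q j x) = cold N (P.aug p) q j (rowd N P (q+1) p i x) := by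
    intro p q i j hi hj x
    change Finsupp.mapDomain _ _ = J N _ _ (Finsupp.mapDomain _ x)
    rw [mapDomain_eq_J N _ _ ((P.aug p).comp (ag A _ q)), mapDomain_eq_J N _ _ ((P.aug p).comp (ag A _ (q+1)))]
    change J N _ _ (J N _ _ x) = J N _ _ (J N _ _ x)
    rw [J_J _ _ _ _ (fun y => by
      change P.aug p (ag A _ q _) = P.aug (p+1) (ag A _ q y)
      rw [ag_gm, P.aug_d p i hi]), J_J _ (fc A _ q j) _ _ (fun y => congrArg (P.aug p) (ag_fc A _ q j y))]
    exact J_congr _ _ _ (fun v => (fc_gm _ _ _ _).symm) x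
  have c2' : ∀ q j, j ≤ q + 1 → ∀ x, rowe N P q (cold N (P.aug 0) q j x) = aqd N q j (rowe N P (q+1) x) := by
    intro q j hj x
    change Finsupp.mapDomain _ _ = J N _ _ (Finsupp.mapDomain _ x)
    rw [mapDomain_eq_J N _ _ (ag A _ q), mapDomain_eq_J N _ _ (ag A _ (q+1))]
    change J N _ _ (J N _ _ x) = J N _ _ (J N _ _ x)
    rw [J_J _ _ _ _ (fun y => by
      change (ag A _ q _) = P.ε (ag A _ q y)
      rw [ag_gm]), J_J _ _ _ _ (fun y => (ag_fc A _ q j y))]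
    exact J_congr _ _ _ (fun v => (fc_gm _ _ _ _).symm) x
  have c3' : ∀ p i, i ≤ p + 1 → ∀ x, cole N (P.aug p) (rowd N P 0 p i x) = P.jd N p i (cole N (P.aug (p+1)) x) := by
    intro p i hi x
    change J N _ _ (Finsupp.mapDomain _ x) = J N _ _ (J N _ _ x)
    rw [mapDomain_eq_J N _ _ ((P.aug p).comp (ag A _ 0))]
    rw [J_J _ _ _ _ (fun y => rfl), J_J _ _ _ _ (fun y => P.aug_d p i hi y)]
    exact J_congr _ _ _ (fun v => ag_gm (P.d p i) 0 (X v)) x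
  have c1 : ∀ p q x, bdu (X := RX N P q) (rowd N P q) p (bdu (X := AX A (P.X (p+1)) N) (cold N (P.aug (p+1))) q x) = bdu (X := AX A (P.X p) N) (cold N (P.aug p)) q (bdu (X := RX N P (q+1)) (rowd N P (q+1)) p x) := by
    intro p q x
    refine bdu_comm (X := AX A (P.X (p+1)) N) (Y := AX A (P.X p) N) _ _ q (bdu (X := RX N P (q+1)) (rowd N P (q+1)) p) (bdu (X := RX N P q) (rowd N P q) p) (fun j hj y => ?_) x
    exact (bdu_comm (X := RX N P (q+1)) (Y := RX N P q) (rowd N P (q+1)) (rowd N P q) p (cold N (P.aug (p+1)) q j) (cold N (P.aug p) q j) (fun i hi z => (c1' p q i j hi hj z).symm) y).symm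
  have c2 : ∀ q x, rowe N P q (bdu (X := AX A (P.X 0) N) (cold N (P.aug 0)) q x) = bdu (X := AX A S N) (aqd N) q (rowe N P (q+1) x) := fun q x =>
    bdu_comm (X := AX A (P.X 0) N) (Y := AX A S N) _ _ q (rowe N P (q+1)) (rowe N P q) (fun j hj y => c2' q j hj y) x
  have c3 : ∀ p x, cole N (P.aug p) (bdu (X := RX N P 0) (rowd N P 0) p x) = bdu (X := P.L N) (P.jd N) p (cole N (P.aug (p+1)) x) := fun p x =>
    bdu_comm (X := RX N P 0) (Y := P.L N) _ _ p (cole N (P.aug (p+1))) (cole N (P.aug p)) (fun j hj y => c3' p j hj y) x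
  have R := fun q => row_acyc N P hP q
  have Cc := fun p => col_acyc N (P.aug p)
  have hh : ∀ p q x, bdu (X := RX N P q) (rowd N P q) p (bdu (X := RX N P q) (rowd N P q) (p+1) x) = 0 := fun p q x => 
    bdu_bdu _ (fun n i j h1 h2 y => row_dd N P q n i j h1 h2 y) p x
  have vv : ∀ p q x, bdu (X := AX A (P.X p) N) (cold N (P.aug p)) q (bdu (X := AX A (P.X p) N) (cold N (P.aug p)) (q+1) x) = 0 := fun p q x => 
    bdu_bdu _ (fun n i j h1 h2 y => col_dd N (P.aug p) n i j h1 y) q x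
  have hh0 : ∀ q x, rowe N P q (bdu (X := RX N P q) (rowd N P q) 0 x) = 0 := fun q x => eps_bdu _ _ (row_de N P q) x
  have vv0 : ∀ q x, cole N (P.aug q) (bdu (X := AX A (P.X q) N) (cold N (P.aug q)) 0 x) = 0 := fun q x => eps_bdu _ _ (col_de N (P.aug q)) x
  simp only [ExAQ, AQdiff_eq, PR.ExJ]
  constructor
  · exact double_complex (D := fun q p => AQV A (MvPolynomial (P.V p) A) q →₀ N)
      (fun q p => bdu (X := AX A (P.X p) N) (cold N (P.aug p)) q) (fun q p => bdu (X := RX N P q) (rowd N P q) p) (fun p => cole N (P.aug p)) (fun p => bdu (X := P.L N) (P.jd N) p)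
      (fun q => rowe N P q) (fun q => bdu (X := AX A S N) (aqd N) q) (fun q p x => (c1 p q x).symm) c3 c2 (fun q p => vv p q) vv0 
      (fun q p => hh p q) hh0 (fun p => (Cc p).1) (fun p => (Cc p).2.1) (fun q p => (Cc p).2.2 q) 
      (fun q => (R q).1) (fun q => (R q).2.1) (fun q p => (R q).2.2 p) n
  · exact double_complex (D := fun p q => AQV A (MvPolynomial (P.V p) A) q →₀ N)
      (fun p q => bdu (X := RX N P q) (rowd N P q) p) (fun p q => bdu (X := AX A (P.X p) N) (cold N (P.aug p)) q) (fun q => rowe N P q) 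
      (fun q => bdu (X := AX A S N) (aqd N) q) (fun p => cole N (P.aug p)) (fun p => bdu (X := P.L N) (P.jd N) p) c1 c2 c3 hh hh0 vv vv0 
      (fun q => (R q).1) (fun q => (R q).2.1) (fun p q => (R q).2.2 p) (fun p => (Cc p).1) (fun p => (Cc p).2.1) (fun p q => (Cc p).2.2 q) n
end C
end AQ

namespace AQ
/-- augmented simplicial group -/
structure SU (S : Type u) (X : ℕ → Type u) [AddCommGroup S] [∀ n, AddCommGroup (X n)] where
  d : ∀ n : ℕ, ℕ → X (n+1) →+ X n
  s : ∀ n : ℕ, ℕ → X n →+ X (n+1)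
  ε : X 0 →+ S
  dd : ∀ n i j, i ≤ j → j ≤ n + 1 → ∀ x, d n i (d (n+1) (j+1) x) = d n j (d (n+1) i x)
  de : ∀ x, ε (d 0 1 x) = ε (d 0 0 x)
  ds1 : ∀ n i j, i ≤ j → j ≤ n → ∀ x, d (n+1) i (s (n+1) (j+1) x) = s n j (d n i x)
  ds2 : ∀ n j, j ≤ n → ∀ x, d n j (s n j x) = x
  ds2' : ∀ n j, j ≤ n → ∀ x, d n (j+1) (s n j x) = x
  ds3 : ∀ n i j, j ≤ i → i ≤ n → ∀ x, d (n+1) (i+2) (s (n+1) j x) = s n j (d n (i+1) x)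

namespace SU
variable {S : Type u} {X : ℕ → Type u} [AddCommGroup S] [∀ n, AddCommGroup (X n)] (P : SU S X)

noncomputable def toSD : SD (AugX S X) where
  d := augd P.ε P.d
  s n i := P.s n i
  dd n i j h1 h2 x := by
    rcases n with _ | n
    · obtain rfl : j = 0 := by omega
      obtain rfl : i = 0 := by omega
      exact P.de x
    · exact P.dd n i j h1 h2 x
  ds1 n i j h1 h2 x := P.ds1 n i j h1 h2 x
  ds2 n j h x := P.ds2 n j h x
  ds2' n j h x := P.ds2' n j h x
  ds3 n i j h1 h2 x := P.ds3 n i j h1 h2 x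

def Ac : Prop := AcycU P.ε P.d

theorem ac_of_moore (hs : Function.Surjective P.ε) (h0 : ∀ u, P.ε u = 0 → ∃ w, bdu P.d 0 w = u)
    (h : ∀ n u, (∀ k ≤ n + 1, P.d n k u = 0) → ∃ w, bdu P.d (n+1) w = u) : P.Ac := by
  refine (acycU_iff _ _).2 (P.toSD.acyc_of_moore hs fun n u hu => ?_)
  rcases n with _ | n
  · exact h0 u (hu 0 le_rfl)
  · exact h n u hu

theorem contraction (hP : P.Ac) : ∃ (t : S → X 0) (h : ∀ n, X n → X (n+1)), (∀ x, P.ε (t x) = x) ∧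
    (∀ n x, P.d n 0 (h n x) = x) ∧ (∀ x, P.d 0 1 (h 0 x) = t (P.ε x)) ∧ 
    ∀ n i, i ≤ n + 1 → ∀ x, P.d (n+1) (i+1) (h (n+1) x) = h n (P.d n i x) := by
  obtain ⟨h, h0, h1⟩ := P.toSD.exists_contraction ((acycU_iff _ _).1 hP)
  exact ⟨h 0, fun n => h (n+1), fun x => h0 0 x, fun n x => h0 (n+1) x, fun x => h1 0 0 le_rfl x,
    fun n i hi x => h1 (n+1) i hi x⟩
end SU

section H
variable {Z : ℕ → Type u} (d : ∀ n, ℕ → Z (n+1) → Z n) (h : ∀ n, Z n → Z (n+1))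

/-- vertical homotopy -/
def HH : ∀ n, ℕ → Z (n+1) → Z (n+2)
  | n, 0 => h (n+1)
  | 0, _+1 => h 1
  | n+1, j+1 => fun x => h (n+2) (HH n j (d (n+1) 0 x))

def ee : ∀ n, Z n → Z 0
  | 0 => id
  | n+1 => fun x => ee n (d n 0 x)
def ch : ∀ n, Z 0 → Z n
  | 0 => id
  | n+1 => fun x => h n (ch n x)

variable {d h} (h0 : ∀ n x, d n 0 (h n x) = x) (h1 : ∀ n i, i ≤ n → ∀ x, d (n+1) (i+1) (h (n+1) x) = h n (d n i x))
  (dd : ∀ n i j, i ≤ j → j ≤ n → ∀ x, d n i (d (n+1) (j+1) x) = d n j (d (n+1) i x))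
theorem HH_zero (n : ℕ) : HH d h n 0 = h (n+1) := by cases n <;> rfl
theorem HH_succ (n j : ℕ) (x) : HH d h (n+1) (j+1) x = h (n+2) (HH d h n j (d (n+1) 0 x)) := rfl

include h0 in
theorem HH_d0 (n : ℕ) (x) : d (n+1) 0 (HH d h n 0 x) = x := by rw [HH_zero, h0]
include h0 h1 dd in
theorem HH_a (n i j : ℕ) (hi : i ≤ j) (hj : j ≤ n) (x) : 
    d (n+2) i (HH d h (n+1) (j+1) x) = HH d h n j (d (n+1) i x) := by
  induction n generalizing i j with
  | zero => 
    obtain rfl : j = 0 := by omega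
    obtain rfl : i = 0 := by omega
    rw [HH_succ, h0]
  | succ n ih =>
    rw [HH_succ]
    rcases i with _ | i
    · rw [h0]
    · obtain ⟨j, rfl⟩ : ∃ k, j = k + 1 := ⟨j - 1, by omega⟩
      rw [h1 _ _ (by omega), ih i j (by omega) (by omega), HH_succ, dd _ 0 i (by omega) (by omega)]
include h0 h1 in
theorem HH_b (n j : ℕ) (hj : j + 1 ≤ n) (x) : d (n+1) (j+1) (HH d h n (j+1) x) = d (n+1) (j+1) (HH d h n j x) := by
  induction n generalizing j with
  | zero => omega
  | succ n ih =>
    rw [HH_succ, h1 _ _ (by omega)]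
    rcases j with _ | j
    · rw [HH_zero, HH_zero, h0, h1 _ _ (by omega)]
    · rw [ih j (by omega), HH_succ, h1 _ _ (by omega)]
include h1 dd in
theorem HH_c (n i j : ℕ) (hj : j < i) (hi : i ≤ n + 1) (x) : 
    d (n+2) (i+1) (HH d h (n+1) j x) = HH d h n j (d (n+1) i x) := by
  induction n generalizing i j with
  | zero => 
    obtain rfl : j = 0 := by omega
    rw [HH_zero, HH_zero, h1 _ _ (by omega)]
  | succ n ih =>
    rcases j with _ | j
    · rw [HH_zero, HH_zero, h1 _ _ (by omega)]
    · obtain ⟨i, rfl⟩ : ∃ k, i = k + 1 := ⟨i - 1, by omega⟩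
      rw [HH_succ, h1 _ _ (by omega), ih i j (by omega) (by omega), HH_succ, dd _ 0 i (by omega) (by omega)]
include h1 in
theorem HH_last (n : ℕ) (x) : d (n+1) (n+1) (HH d h n n x) = ch h (n+1) (ee d (n+1) x) := by
  induction n with
  | zero => rw [HH_zero, h1 _ _ (by omega)]; rfl
  | succ n ih => rw [HH_succ, h1 _ _ (by omega), ih]; rfl
include dd in
theorem ee_d (n i : ℕ) (hi : i ≤ n) (x) : ee d n (d n i x) = ee d (n+1) x := by
  induction n generalizing i with
  | zero => obtain rfl : i = 0 := by omega
            rfl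
  | succ n ih =>
    rcases i with _ | i
    · rfl
    · change ee d n (d n 0 (d (n+1) (i+1) x)) = _
      rw [dd _ 0 i (by omega) (by omega), ih i (by omega)]; rfl
include h0 in
theorem ee_ch (n : ℕ) (x) : ee d n (ch h n x) = x := by
  induction n with
  | zero => rfl
  | succ n ih => change ee d n (d n 0 (h n _)) = x; rw [h0, ih]
include h0 h1 in
theorem d_ch (n i : ℕ) (hi : i ≤ n) (x) : d n i (ch h (n+1) x) = ch h n x := by
  induction n generalizing i with
  | zero => obtain rfl : i = 0 := by omega
            exact h0 _ _
  | succ n ih =>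
    rcases i with _ | i
    · exact h0 _ _
    · change d (n+1) (i+1) (h (n+1) _) = _
      rw [h1 _ _ (by omega), ih i (by omega)]; rfl
end H

section nat
variable {Z Z' : ℕ → Type u} {d : ∀ n, ℕ → Z (n+1) → Z n} {h : ∀ n, Z n → Z (n+1)} {d' : ∀ n, ℕ → Z' (n+1) → Z' n} {h' : ∀ n, Z' n → Z' (n+1)}
  (f : ∀ n, Z n → Z' n) (fd : ∀ n x, f n (d n 0 x) = d' n 0 (f (n+1) x)) (fh : ∀ n x, f (n+1) (h n x) = h' n (f n x))
include fd fh in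
theorem HH_nat (n j : ℕ) (x) : f (n+2) (HH d h n j x) = HH d' h' n j (f (n+1) x) := by
  induction n generalizing j with
  | zero => cases j <;> exact fh _ _
  | succ n ih =>
    cases j with
    | zero => exact fh _ _
    | succ j => rw [HH_succ, HH_succ, fh, ih, fd]
include fd in
theorem ee_nat (n : ℕ) (x) : f 0 (ee d n x) = ee d' n (f n x) := by
  induction n with
  | zero => rfl
  | succ n ih => change f 0 (ee d n (d n 0 x)) = ee d' n (d' n 0 _); rw [ih, fd]
include fh in
theorem ch_nat (n : ℕ) (x) : f n (ch h n x) = ch h' n (f 0 x) := by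
  induction n with
  | zero => rfl
  | succ n ih => change f (n+1) (h n _) = h' n _; rw [fh, ih]
end nat

theorem tele {M : Type*} [AddCommGroup M] (n : ℕ) (f : ℕ → ℕ → M) (hz : ∀ i j, i ≤ n + 1 → j ≤ n → (i < j ∨ j + 1 < i) → f i j = 0)
    (hm : ∀ j, j + 1 ≤ n → f (j+1) (j+1) = f (j+1) j) : 
    ∑ i ∈ Finset.range (n+2), (-1:ℤ)^i • ∑ j ∈ Finset.range (n+1), (-1:ℤ)^j • f i j = f 0 0 - f (n+1) n := by
  simp only [Finset.smul_sum]
  rw [Finset.sum_comm]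
  have : ∀ j ∈ Finset.range (n+1), ∑ i ∈ Finset.range (n+2), (-1:ℤ)^i • (-1:ℤ)^j • f i j = f j j - f (j+1) j := by
    intro j hj
    have hj := Finset.mem_range.1 hj
    rw [← Finset.sum_subset (s₁ := {j, j+1})]
    · rw [Finset.sum_pair (by omega), smul_smul, smul_smul, ← pow_add, ← pow_add, ← two_mul, pow_mul,
        show j + 1 + j = 2 * j + 1 by ring, pow_succ, pow_mul]
      simp [sub_eq_add_neg]
    · intro i hi
      simp at hi ⊢; omega
    · intro i hi hi'
      have hi := Finset.mem_range.1 hi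
      simp at hi'
      rw [hz i j (by omega) (by omega) (by omega), smul_zero, smul_zero]
  rw [Finset.sum_congr rfl this, Finset.sum_sub_distrib, Finset.sum_range_succ', Finset.sum_range_succ _ n]
  rw [Finset.sum_congr rfl fun j hj => hm j (by have := Finset.mem_range.1 hj; omega)]
  abel

section NCD
variable {B : ℕ → ℕ → Type u} [∀ p q, AddCommGroup (B p q)] (dh : ∀ p q : ℕ, ℕ → B (p+1) q →+ B p q)
  (sh : ∀ p q : ℕ, ℕ → B p q →+ B (p+1) q) (dv : ∀ p q : ℕ, ℕ → B p (q+1) →+ B p q) (h : ∀ p q, B p q → B p (q+1))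
  {S : Type u} [AddCommGroup S] (D : SU S (fun n => B n (n+1))) (E : SU S (fun n => B n 0))
  (hD : ∀ n i, i ≤ n + 1 → ∀ x, D.d n i x = dh n (n+1) i (dv (n+1) (n+1) i x)) (hDε : ∀ x, D.ε x = E.ε (dv 0 0 0 x))
  (hE : ∀ n i, i ≤ n + 1 → ∀ x, E.d n i x = dh n 0 i x)
  (dd : ∀ p n i j, i ≤ j → j ≤ n → ∀ x, dv p n i (dv p (n+1) (j+1) x) = dv p n j (dv p (n+1) i x))
  (h0 : ∀ p n x, dv p n 0 (h p n x) = x) (h1 : ∀ p n i, i ≤ n → ∀ x, dv p (n+1) (i+1) (h p (n+1) x) = h p n (dv p n i x))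
  (ds1 : ∀ n q i j, i ≤ j → j ≤ n → ∀ x, dh (n+1) q i (sh (n+1) q (j+1) x) = sh n q j (dh n q i x))
  (ds2 : ∀ n q j, j ≤ n → ∀ x, dh n q j (sh n q j x) = x)
  (ds2' : ∀ n q j, j ≤ n → ∀ x, dh n q (j+1) (sh n q j x) = x)
  (ds3 : ∀ n q i j, j ≤ i → i ≤ n → ∀ x, dh (n+1) q (i+2) (sh (n+1) q j x) = sh n q j (dh n q (i+1) x))
  (hdd : ∀ p q i j, i ≤ p + 1 → j ≤ q → ∀ x, dh p q i (dv (p+1) q j x) = dv p q j (dh p (q+1) i x))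
  (hsd : ∀ p q i j, i ≤ p → j ≤ q → ∀ x, sh p q i (dv p q j x) = dv (p+1) q j (sh p (q+1) i x))
  (hdh : ∀ p q i, i ≤ p + 1 → ∀ x, dh p (q+1) i (h (p+1) q x) = h p q (dh p q i x))
include hD dd h0 h1 ds1 ds2 ds2' ds3 hdd hsd hdh

theorem ncd_main (n : ℕ) (x : B n (n+1)) (hx : ∀ m, ∀ e : n = m + 1, ∀ k ≤ m + 1, D.d m k (e ▸ x) = 0)
    (he : ee (fun q i => (dv n q i : B n (q+1) → B n q)) (n+1) x = 0) : ∃ w, bdu (X := fun n => B n (n+1)) D.d n w = x := by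
  let H : ℕ → B n (n+1) → B n (n+2) := HH (fun q i => (dv n q i : B n (q+1) → B n q)) (h n) n
  let k : ℕ → B n (n+1) → B (n+1) (n+2) := fun j x => sh n (n+2) j (H j x)
  have hee : ∀ n, ee (fun q i => (dv n q i : B n (q+1) → B n q)) (n+1) 0 = 0 := by
    intro n
    have : ∀ q, ee (fun q i => (dv n q i : B n (q+1) → B n q)) q 0 = 0 := by
      intro q
      induction q with
      | zero => rfl
      | succ q ih => change ee _ q (dv n q 0 0) = 0; rw [map_zero, ih]
    exact this _
  refine ⟨∑ j ∈ Finset.range (n+1), (-1:ℤ)^j • (k j x - k j 0), ?_⟩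
  rw [bdu_apply]
  simp only [map_sum, map_zsmul, map_sub]
  have hk : ∀ i j, i ≤ n + 1 → j ≤ n → ∀ x, D.d n i (k j x) = dh n (n+1) i (sh n (n+1) j (dv n (n+1) i (H j x))) := by
    intro i j hi hj x
    rw [hD _ _ hi, hsd _ _ _ _ hj hi]
  have hm : ∀ j ≤ n, ∀ x, D.d n j (k j x) = dv n (n+1) j (H j x) := fun j hj x => by rw [hk _ _ (by omega) hj, ds2 _ _ _ hj]
  have hm' : ∀ j ≤ n, ∀ x, D.d n (j+1) (k j x) = dv n (n+1) (j+1) (H j x) := fun j hj x => by rw [hk _ _ (by omega) hj, ds2' _ _ _ hj]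
  rw [tele n (fun i j => D.d n i (k j x) - D.d n i (k j 0))]
  · skip
    rw [hm 0 (by omega), hm' n le_rfl, hm 0 (by omega), hm' n le_rfl]
    have e1 : ∀ y, dv n (n+1) 0 (H 0 y) = y := fun y => HH_d0 (h0 n) n y
    have e2 : ∀ y, dv n (n+1) (n+1) (H n y) = _ := fun y => HH_last (h1 n) n y
    rw [e1, e1, e2, e2, he, hee]; simp
  · intro i j hi hj hij
    rcases n with _ | n
    · omega
    have hx := hx n rfl
    have hx' : ∀ k ≤ n + 1, dh n (n+1) k (dv (n+1) (n+1) k x) = 0 := fun k hk => (hD _ _ hk _).symm.trans (hx k hk)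
    have key : ∀ i j, i ≤ n + 1 → j ≤ n → dh n (n+2) i (HH (fun q i => (dv (n+1) q i : B (n+1) (q+1) → B (n+1) q)) (h (n+1)) n j (dv (n+1) (n+1) i x))
        = dh n (n+2) i (HH (fun q i => (dv (n+1) q i : B (n+1) (q+1) → B (n+1) q)) (h (n+1)) n j (dv (n+1) (n+1) i 0)) := by
      intro i j hi hj
      have := HH_nat (Z := B (n+1)) (Z' := B n) (d := (fun q i => (dv (n+1) q i : B (n+1) (q+1) → B (n+1) q))) (h := h (n+1))
        (d' := (fun q i => (dv n q i : B n (q+1) → B n q))) (h' := h n) (fun q => dh n q i) (fun q x => hdd n q i 0 hi (by omega) x) (fun q x => hdh n q i hi x) n j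
      rw [this, this, hx' i hi, map_zero, map_zero]
    rcases hij with hij | hij
    · obtain ⟨j, rfl⟩ : ∃ k, j = k + 1 := ⟨j - 1, by omega⟩
      rw [hk _ _ (by omega) (by omega), hk _ _ (by omega) (by omega), ds1 _ _ _ _ (by omega) (by omega), ds1 _ _ _ _ (by omega) (by omega)]
      have := HH_a (d := (fun q i => (dv (n+1) q i : B (n+1) (q+1) → B (n+1) q))) (h0 (n+1)) (h1 (n+1)) (dd (n+1)) n i j (by omega) (by omega)
      have e1 : ∀ x, dv (n+1) (n+2) i (H (j+1) x) = _ := this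
      rw [e1, e1, key i j (by omega) (by omega), sub_self]
    · obtain ⟨i, rfl⟩ : ∃ k, i = k + 2 := ⟨i - 2, by omega⟩
      rw [hk _ _ (by omega) (by omega), hk _ _ (by omega) (by omega), ds3 _ _ _ _ (by omega) (by omega), ds3 _ _ _ _ (by omega) (by omega)]
      have := HH_c (d := (fun q i => (dv (n+1) q i : B (n+1) (q+1) → B (n+1) q))) (h1 (n+1)) (dd (n+1)) n (i+1) j (by omega) (by omega)
      have e1 : ∀ x, dv (n+1) (n+2) (i+2) (H j x) = _ := this
      rw [e1, e1, key (i+1) j (by omega) (by omega), sub_self]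
  · intro j hj
    rw [hm _ hj, hm _ hj, hm' j (by omega), hm' j (by omega)]
    have e1 : ∀ x, dv n (n+1) (j+1) (H (j+1) x) = dv n (n+1) (j+1) (H j x) := HH_b (h0 n) (h1 n) n j hj
    rw [e1, e1]

include hE hDε in
theorem ncd (hA : E.Ac) : D.Ac := by
  obtain ⟨t, g, g0, g1, g2, g3⟩ := E.contraction hA
  let en : ∀ n, B n (n+1) → B n 0 := fun n => ee (fun q i => (dv n q i : B n (q+1) → B n q)) (n+1)
  have hen : ∀ n x y, en n (x - y) = en n x - en n y := by
    intro n
    have : ∀ q (x y : B n q), ee (fun q i => (dv n q i : B n (q+1) → B n q)) q (x - y) = 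
      ee (fun q i => (dv n q i : B n (q+1) → B n q)) q x - ee (fun q i => (dv n q i : B n (q+1) → B n q)) q y := by
      intro q
      induction q with
      | zero => intro x y; rfl
      | succ q ih => intro x y; change ee _ q (dv n q 0 (x - y)) = _; rw [map_sub, ih]; rfl
    exact this (n+1)
  have step : ∀ n (x : B n (n+1)) (y : B (n+1) 0), dh n 0 0 y = en n x → (∀ k ≤ n, dh n 0 (k+1) y = 0) → 
      (∀ m, ∀ e : n = m + 1, ∀ k ≤ m + 1, D.d m k (e ▸ x) = 0) → ∃ w, bdu (X := fun n => B n (n+1)) D.d n w = x := by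
    intro n x y hy hy' hx
    let z : B (n+1) (n+2) := ch (h (n+1)) (n+2) y - ch (h (n+1)) (n+2) 0
    have hz : ∀ k ≤ n + 1, D.d n k z = ch (h n) (n+1) (dh n 0 k y) - ch (h n) (n+1) 0 := by
      intro k hk
      rw [hD _ _ hk, map_sub, map_sub]
      have e1 : ∀ y, dv (n+1) (n+1) k (ch (h (n+1)) (n+2) y) = ch (h (n+1)) (n+1) y :=
        d_ch (d := (fun q i => (dv (n+1) q i : B (n+1) (q+1) → B (n+1) q))) (h0 (n+1)) (h1 (n+1)) (n+1) k hk
      have e2 : ∀ y, dh n (n+1) k (ch (h (n+1)) (n+1) y) = ch (h n) (n+1) (dh n 0 k y) := 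
        ch_nat (Z := B (n+1)) (Z' := B n) (fun q => dh n q k) (fun q x => hdh n q k hk x) (n+1)
      rw [e1, e1, e2, e2, map_zero]
    have hbz : bdu (X := fun n => B n (n+1)) D.d n z = D.d n 0 z := by
      rw [bdu_apply, Finset.sum_range_succ', Finset.sum_eq_zero]
      · simp
      · intro k hk
        have := Finset.mem_range.1 hk
        rw [hz _ (by omega), hy' k (by omega), sub_self, smul_zero]
    obtain ⟨w, hw⟩ := ncd_main dh sh dv h D hD dd h0 h1 ds1 ds2 ds2' ds3 hdd hsd hdh n (x - D.d n 0 z) (by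
      rintro m rfl k hk
      simp only [map_sub, hx m rfl k hk]
      have := hx m rfl k hk
      rw [← D.dd m 0 k (by omega) hk, hz _ (by omega), hy' k (by omega), sub_self, map_zero, sub_zero]) (by
      change en n _ = 0
      have e1 : ∀ y, en n (ch (h n) (n+1) y) = y := ee_ch (h0 n) (n+1)
      rw [hen, hz _ (by omega), hen, e1, e1, hy, sub_zero, sub_self])
    exact ⟨w + z, by rw [map_add, hw, hbz]; abel⟩
  refine D.ac_of_moore ?_ ?_ ?_
  · intro s
    obtain ⟨a, rfl⟩ := hA.1 s
    exact ⟨h 0 0 a, by rw [hDε, h0]⟩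
  · intro x hx
    rw [hDε] at hx
    refine step 0 x (g 0 (dv 0 0 0 x) - g 0 0) ?_ ?_ (fun m e => by omega)
    · rw [map_sub, ← hE _ _ (by omega), ← hE _ _ (by omega), g1, g1, sub_zero]; rfl
    · intro k hk
      obtain rfl : k = 0 := by omega
      rw [map_sub, ← hE _ _ (by omega), ← hE _ _ (by omega), g2, g2, hx, map_zero, sub_self]
  · intro n x hx
    refine step (n+1) x (g (n+1) (en (n+1) x) - g (n+1) 0) ?_ ?_ (fun m e => ?_)
    · rw [map_sub, ← hE _ _ (by omega), ← hE _ _ (by omega), g1, g1, sub_zero]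
    · intro k hk
      rw [map_sub, ← hE _ _ (by omega), ← hE _ _ (by omega), g3 _ _ hk, g3 _ _ hk, map_zero, hE _ _ hk]
      have e2 : dh n 0 k (en (n+1) x) = ee (fun q i => (dv n q i : B n (q+1) → B n q)) (n+2) (dh n (n+2) k x) := 
        ee_nat (Z := B (n+1)) (Z' := B n) (fun q => dh n q k) (fun q x => hdd n q k 0 (by omega) (by omega) x) (n+2) x
      have e3 := ee_d (d := (fun q i => (dv n q i : B n (q+1) → B n q))) (dd n) (n+1) k hk (dh n (n+2) k x)
      rw [e2, ← e3]
      rw [← hdd _ _ _ _ (by omega) (by omega), ← hD _ _ (by omega), hx k hk]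
      have := hen n 0 0
      rw [sub_self, sub_self] at this
      change g n (en n 0) - g n 0 = 0
      rw [this, sub_self]
    · obtain rfl : n = m := by omega
      exact hx
end NCD
end AQ

namespace AQ
/-- bisimplicial abelian group -/
structure BS (M : ℕ → ℕ → Type u) [∀ p q, AddCommGroup (M p q)] where
  dh : ∀ p q : ℕ, ℕ → M (p+1) q →+ M p q
  sh : ∀ p q : ℕ, ℕ → M p q →+ M (p+1) q
  dv : ∀ p q : ℕ, ℕ → M p (q+1) →+ M p q
  sv : ∀ p q : ℕ, ℕ → M p q →+ M p (q+1)
  hdd : ∀ n q i j, i ≤ j → j ≤ n + 1 → ∀ x, dh n q i (dh (n+1) q (j+1) x) = dh n q j (dh (n+1) q i x)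
  hds1 : ∀ n q i j, i ≤ j → j ≤ n → ∀ x, dh (n+1) q i (sh (n+1) q (j+1) x) = sh n q j (dh n q i x)
  hds2 : ∀ n q j, j ≤ n → ∀ x, dh n q j (sh n q j x) = x
  hds2' : ∀ n q j, j ≤ n → ∀ x, dh n q (j+1) (sh n q j x) = x
  hds3 : ∀ n q i j, j ≤ i → i ≤ n → ∀ x, dh (n+1) q (i+2) (sh (n+1) q j x) = sh n q j (dh n q (i+1) x)
  vdd : ∀ p n i j, i ≤ j → j ≤ n + 1 → ∀ x, dv p n i (dv p (n+1) (j+1) x) = dv p n j (dv p (n+1) i x)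
  vds1 : ∀ p n i j, i ≤ j → j ≤ n → ∀ x, dv p (n+1) i (sv p (n+1) (j+1) x) = sv p n j (dv p n i x)
  vds2 : ∀ p n j, j ≤ n → ∀ x, dv p n j (sv p n j x) = x
  vds2' : ∀ p n j, j ≤ n → ∀ x, dv p n (j+1) (sv p n j x) = x
  vds3 : ∀ p n i j, j ≤ i → i ≤ n → ∀ x, dv p (n+1) (i+2) (sv p (n+1) j x) = sv p n j (dv p n (i+1) x)
  cdd : ∀ p q i j, i ≤ p + 1 → j ≤ q + 1 → ∀ x, dh p q i (dv (p+1) q j x) = dv p q j (dh p (q+1) i x)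
  csd : ∀ p q i j, i ≤ p → j ≤ q + 1 → ∀ x, sh p q i (dv p q j x) = dv (p+1) q j (sh p (q+1) i x)
  cds : ∀ p q i j, i ≤ p + 1 → j ≤ q → ∀ x, dh p (q+1) i (sv (p+1) q j x) = sv p q j (dh p q i x)
  css : ∀ p q i j, i ≤ p → j ≤ q → ∀ x, sh p (q+1) i (sv p q j x) = sv (p+1) q j (sh p q i x)

open Classical in
/-- restriction -/
noncomputable def resM {G H : Type*} [AddCommGroup G] [AddCommGroup H] (K : AddSubgroup G) (L : AddSubgroup H) (f : G →+ H) : K →+ L :=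
  if h : ∀ x ∈ K, f x ∈ L then (f.comp K.subtype).codRestrict L (fun x => h x x.2) else 0
theorem resM_coe {G H : Type*} [AddCommGroup G] [AddCommGroup H] {K : AddSubgroup G} {L : AddSubgroup H} {f : G →+ H}
  (h : ∀ x ∈ K, f x ∈ L) (x : K) : (resM K L f x : H) = f x := by
  rw [resM, dif_pos h]; rfl

theorem bdu_congr {X : ℕ → Type u} [∀ n, AddCommGroup (X n)] (d d' : ∀ n, ℕ → X (n+1) →+ X n) (n : ℕ) (x : X (n+1)) 
   (h : ∀ i ≤ n+1, d n i x = d' n i x) : bdu d n x = bdu d' n x := by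
  rw [bdu_apply, bdu_apply]
  refine Finset.sum_congr rfl fun i hi => ?_
  rw [h i (by have := Finset.mem_range.1 hi; omega)]

theorem bdu_map {X Y : ℕ → Type u} [∀ n, AddCommGroup (X n)] [∀ n, AddCommGroup (Y n)] (d : ∀ n, ℕ → X (n+1) →+ X n)
   (d' : ∀ n, ℕ → Y (n+1) →+ Y n) (n : ℕ) (f : X n →+ Y n) (g : X (n+1) →+ Y (n+1)) 
   (h : ∀ i ≤ n+1, ∀ x, f (d n i x) = d' n i (g x)) (x : X (n+1)) : f (bdu d n x) = bdu d' n (g x) := by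
  rw [bdu_apply, bdu_apply, map_sum]
  refine Finset.sum_congr rfl fun i hi => ?_
  rw [map_zsmul, h i (by have := Finset.mem_range.1 hi; omega)]

namespace BS
variable {M : ℕ → ℕ → Type u} [∀ p q, AddCommGroup (M p q)] (B : BS M)

/-- diagonal faces -/
noncomputable def dg (n i : ℕ) : M (n+1) (n+1) →+ M n n := (B.dh n n i).comp (B.dv (n+1) n i)
/-- diagonal faces of Dec -/
noncomputable def dg' (n i : ℕ) : M (n+1) (n+2) →+ M n (n+1) := (B.dh n (n+1) i).comp (B.dv (n+1) (n+1) (i+1))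
theorem dg_apply (n i x) : B.dg n i x = B.dh n n i (B.dv (n+1) n i x) := rfl
theorem dg'_apply (n i x) : B.dg' n i x = B.dh n (n+1) i (B.dv (n+1) (n+1) (i+1) x) := rfl

def RowEx : Prop := ∀ q, (∀ x, ∃ y, bdu (X := fun p => M p q) (fun p i => B.dh p q i) 0 y = x) ∧ 
   ∀ n x, bdu (X := fun p => M p q) (fun p i => B.dh p q i) n x = 0 → ∃ y, bdu (X := fun p => M p q) (fun p i => B.dh p q i) (n+1) y = x

noncomputable def rowSU (q : ℕ) : SU PUnit.{u+1} (fun n => M n q) where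
  d n i := B.dh n q i
  s n i := B.sh n q i
  ε := 0
  dd n i j h1 h2 x := B.hdd n q i j h1 h2 x
  de _ := rfl
  ds1 n i j h1 h2 x := B.hds1 n q i j h1 h2 x
  ds2 n j h x := B.hds2 n q j h x
  ds2' n j h x := B.hds2' n q j h x
  ds3 n i j h1 h2 x := B.hds3 n q i j h1 h2 x

theorem dg_dg (n i j : ℕ) (h1 : i ≤ j) (h2 : j ≤ n + 1) (x) : B.dg n i (B.dg (n+1) (j+1) x) = B.dg n j (B.dg (n+1) i x) := by
  simp only [dg_apply]
  rw [← B.cdd _ _ _ _ (by omega) (by omega), ← B.cdd _ _ _ _ (by omega) (by omega), B.vdd _ _ _ _ h1 h2, B.hdd _ _ _ _ h1 h2]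

noncomputable def decSU : SU PUnit.{u+1} (fun n => M n (n+1)) where
  d n i := B.dg' n i
  s n i := (B.sh n (n+2) i).comp (B.sv n (n+1) (i+1))
  ε := 0
  dd n i j h1 h2 x := by
    simp only [dg'_apply]
    rw [← B.cdd _ _ _ _ (by omega) (by omega), ← B.cdd _ _ _ _ (by omega) (by omega), B.vdd _ _ _ _ (by omega) (by omega), B.hdd _ _ _ _ h1 h2]
  de _ := rfl
  ds1 n i j h1 h2 x := by
    simp only [dg'_apply, AddMonoidHom.comp_apply]
    rw [← B.csd _ _ _ _ (by omega) (by omega), B.vds1 _ _ _ _ (by omega) (by omega), B.hds1 _ _ _ _ h1 h2, B.cds _ _ _ _ (by omega) (by omega)]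
  ds2 n j h x := by
    simp only [dg'_apply, AddMonoidHom.comp_apply]
    rw [← B.csd _ _ _ _ (by omega) (by omega), B.vds2 _ _ _ (by omega), B.hds2 _ _ _ h]
  ds2' n j h x := by
    simp only [dg'_apply, AddMonoidHom.comp_apply]
    rw [← B.csd _ _ _ _ (by omega) (by omega), B.vds2' _ _ _ (by omega), B.hds2' _ _ _ h]
  ds3 n i j h1 h2 x := by
    simp only [dg'_apply, AddMonoidHom.comp_apply]
    rw [← B.csd _ _ _ _ (by omega) (by omega), B.vds3 _ _ _ _ (by omega) (by omega), B.hds3 _ _ _ _ h1 h2, B.cds _ _ _ _ (by omega) (by omega)]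

theorem dec_ac (hB : B.RowEx) : B.decSU.Ac :=
  ncd B.dh B.sh (fun p q i => B.dv p q (i+1)) (fun p q => B.sv p q 0) B.decSU (B.rowSU 0) (fun n i hi x => rfl) (fun x => rfl)
    (fun n i hi x => rfl) (fun p n i j h1 h2 x => B.vdd _ _ _ _ (by omega) (by omega) x) (fun p n x => B.vds2' _ _ _ (by omega) x)
    (fun p n i hi x => B.vds3 _ _ _ _ (by omega) hi x) (fun n q i j h1 h2 x => B.hds1 _ _ _ _ h1 h2 x) (fun n q j h x => B.hds2 _ _ _ h x)
    (fun n q j h x => B.hds2' _ _ _ h x) (fun n q i j h1 h2 x => B.hds3 _ _ _ _ h1 h2 x) (fun p q i j h1 h2 x => B.cdd _ _ _ _ h1 (by omega) x)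
    (fun p q i j h1 h2 x => B.csd _ _ _ _ h1 (by omega) x) (fun p q i h x => B.cds _ _ _ _ h (by omega) x) 
    ⟨fun _ => ⟨0, rfl⟩, fun x _ => (hB 0).1 x, (hB 0).2⟩

section sub
variable (K : ∀ p q, AddSubgroup (M p q)) (k1 : ∀ p q i, i ≤ p + 1 → ∀ x ∈ K (p+1) q, B.dh p q i x ∈ K p q)
  (k2 : ∀ p q i, i ≤ p → ∀ x ∈ K p q, B.sh p q i x ∈ K (p+1) q) (k3 : ∀ p q i, i ≤ q + 1 → ∀ x ∈ K p (q+1), B.dv p q i x ∈ K p q)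
  (k4 : ∀ p q i, i ≤ q → ∀ x ∈ K p q, B.sv p q i x ∈ K p (q+1))
include k1 k2 k3 k4
/-- sub-object -/
noncomputable def sub : BS (fun p q => K p q) where
  dh p q i := resM _ _ (B.dh p q i)
  sh p q i := resM _ _ (B.sh p q i)
  dv p q i := resM _ _ (B.dv p q i)
  sv p q i := resM _ _ (B.sv p q i)
  hdd n q i j h1 h2 x := by
    apply Subtype.ext; rw [resM_coe (k1 _ _ _ (by omega)), resM_coe (k1 _ _ _ (by omega)), resM_coe (k1 _ _ _ (by omega)), resM_coe (k1 _ _ _ (by omega)), B.hdd _ _ _ _ h1 h2]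
  hds1 n q i j h1 h2 x := by
    apply Subtype.ext; rw [resM_coe (k1 _ _ _ (by omega)), resM_coe (k2 _ _ _ (by omega)), resM_coe (k2 _ _ _ (by omega)), resM_coe (k1 _ _ _ (by omega)), B.hds1 _ _ _ _ h1 h2]
  hds2 n q j h x := by
    apply Subtype.ext; rw [resM_coe (k1 _ _ _ (by omega)), resM_coe (k2 _ _ _ (by omega)), B.hds2 _ _ _ h]
  hds2' n q j h x := by
    apply Subtype.ext; rw [resM_coe (k1 _ _ _ (by omega)), resM_coe (k2 _ _ _ (by omega)), B.hds2' _ _ _ h]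
  hds3 n q i j h1 h2 x := by
    apply Subtype.ext; rw [resM_coe (k1 _ _ _ (by omega)), resM_coe (k2 _ _ _ (by omega)), resM_coe (k2 _ _ _ (by omega)), resM_coe (k1 _ _ _ (by omega)), B.hds3 _ _ _ _ h1 h2]
  vdd n q i j h1 h2 x := by
    apply Subtype.ext; rw [resM_coe (k3 _ _ _ (by omega)), resM_coe (k3 _ _ _ (by omega)), resM_coe (k3 _ _ _ (by omega)), resM_coe (k3 _ _ _ (by omega)), B.vdd _ _ _ _ h1 h2]
  vds1 n q i j h1 h2 x := by
    apply Subtype.ext; rw [resM_coe (k3 _ _ _ (by omega)), resM_coe (k4 _ _ _ (by omega)), resM_coe (k4 _ _ _ (by omega)), resM_coe (k3 _ _ _ (by omega)), B.vds1 _ _ _ _ (by omega) (by omega)]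
  vds2 n q j h x := by
    apply Subtype.ext; rw [resM_coe (k3 _ _ _ (by omega)), resM_coe (k4 _ _ _ (by omega)), B.vds2 _ _ _ (by omega)]
  vds2' n q j h x := by
    apply Subtype.ext; rw [resM_coe (k3 _ _ _ (by omega)), resM_coe (k4 _ _ _ (by omega)), B.vds2' _ _ _ (by omega)]
  vds3 n q i j h1 h2 x := by
    apply Subtype.ext; rw [resM_coe (k3 _ _ _ (by omega)), resM_coe (k4 _ _ _ (by omega)), resM_coe (k4 _ _ _ (by omega)), resM_coe (k3 _ _ _ (by omega)), B.vds3 _ _ _ _ (by omega) (by omega)]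
  cdd p q i j h1 h2 x := by
    apply Subtype.ext; rw [resM_coe (k1 _ _ _ (by omega)), resM_coe (k3 _ _ _ (by omega)), resM_coe (k3 _ _ _ (by omega)), resM_coe (k1 _ _ _ (by omega)), B.cdd _ _ _ _ (by omega) (by omega)]
  csd p q i j h1 h2 x := by
    apply Subtype.ext; rw [resM_coe (k2 _ _ _ (by omega)), resM_coe (k3 _ _ _ (by omega)), resM_coe (k3 _ _ _ (by omega)), resM_coe (k2 _ _ _ (by omega)), B.csd _ _ _ _ (by omega) (by omega)]
  cds p q i j h1 h2 x := by
    apply Subtype.ext; rw [resM_coe (k1 _ _ _ (by omega)), resM_coe (k4 _ _ _ (by omega)), resM_coe (k4 _ _ _ (by omega)), resM_coe (k1 _ _ _ (by omega)), B.cds _ _ _ _ (by omega) (by omega)]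
  css p q i j h1 h2 x := by
    apply Subtype.ext; rw [resM_coe (k2 _ _ _ (by omega)), resM_coe (k4 _ _ _ (by omega)), resM_coe (k4 _ _ _ (by omega)), resM_coe (k2 _ _ _ (by omega)), B.css _ _ _ _ (by omega) (by omega)]
end sub

/-- kernel of the last projection -/
def KK (p q : ℕ) : AddSubgroup (M p (q+1)) := (B.dv p q 0).ker

theorem k1 (p q i : ℕ) (hi : i ≤ p + 1) : ∀ x ∈ B.KK (p+1) q, B.dh p (q+1) i x ∈ B.KK p q := by
  intro x hx
  change B.dv _ _ _ _ = 0
  rw [← B.cdd _ _ _ _ hi (by omega), (show B.dv _ _ _ _ = 0 from hx), map_zero]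
theorem k2 (p q i : ℕ) (hi : i ≤ p) : ∀ x ∈ B.KK p q, B.sh p (q+1) i x ∈ B.KK (p+1) q := by
  intro x hx
  change B.dv _ _ _ _ = 0
  rw [← B.csd _ _ _ _ hi (by omega), (show B.dv _ _ _ _ = 0 from hx), map_zero]
theorem k3 (p q i : ℕ) (hi : i ≤ q + 1) : ∀ x ∈ B.KK p (q+1), B.dv p (q+1) (i+1) x ∈ B.KK p q := by
  intro x hx
  change B.dv _ _ _ _ = 0
  rw [B.vdd _ _ _ _ (by omega) hi, (show B.dv _ _ _ _ = 0 from hx), map_zero]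
theorem k4 (p q i : ℕ) (hi : i ≤ q) : ∀ x ∈ B.KK p q, B.sv p (q+1) (i+1) x ∈ B.KK p (q+1) := by
  intro x hx
  change B.dv _ _ _ _ = 0
  rw [B.vds1 _ _ _ _ (by omega) hi, (show B.dv _ _ _ _ = 0 from hx), map_zero]

/-- decalage -/
noncomputable def dec : BS (fun p q => M p (q+1)) where
  dh p q i := B.dh p (q+1) i
  sh p q i := B.sh p (q+1) i
  dv p q i := B.dv p (q+1) (i+1)
  sv p q i := B.sv p (q+1) (i+1)
  hdd n q := B.hdd n (q+1)
  hds1 n q := B.hds1 n (q+1)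
  hds2 n q := B.hds2 n (q+1)
  hds2' n q := B.hds2' n (q+1)
  hds3 n q := B.hds3 n (q+1)
  vdd n q i j h1 h2 := B.vdd _ _ _ _ (by omega) (by omega)
  vds1 n q i j h1 h2 := B.vds1 _ _ _ _ (by omega) (by omega)
  vds2 n q j h := B.vds2 _ _ _ (by omega)
  vds2' n q j h := B.vds2' _ _ _ (by omega)
  vds3 n q i j h1 h2 := B.vds3 _ _ _ _ (by omega) (by omega)
  cdd p q i j h1 h2 := B.cdd _ _ _ _ (by omega) (by omega)
  csd p q i j h1 h2 := B.csd _ _ _ _ (by omega) (by omega)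
  cds p q i j h1 h2 := B.cds _ _ _ _ (by omega) (by omega)
  css p q i j h1 h2 := B.css _ _ _ _ (by omega) (by omega)

noncomputable def ker : BS (fun p q => B.KK p q) := B.dec.sub B.KK B.k1 B.k2 B.k3 B.k4

theorem ker_row (hB : B.RowEx) : B.ker.RowEx := by
  intro q
  have e : ∀ n y, ((bdu (X := fun p => B.KK p q) (fun p i => B.ker.dh p q i) n y : B.KK n q) : M n (q+1)) = 
      bdu (X := fun p => M p (q+1)) (fun p i => B.dh p (q+1) i) n (y : M (n+1) (q+1)) := fun n y =>
    bdu_map (X := fun p => B.KK p q) (Y := fun p => M p (q+1)) (fun p i => B.ker.dh p q i) (fun p i => B.dh p (q+1) i) n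
      (B.KK n q).subtype (B.KK (n+1) q).subtype (fun i hi x => resM_coe (B.k1 _ _ _ hi) x) y
  have key : ∀ n (x : B.KK n q) (y : M (n+1) (q+1)), bdu (X := fun p => M p (q+1)) (fun p i => B.dh p (q+1) i) n y = x → 
     ∃ y, bdu (X := fun p => B.KK p q) (fun p i => B.ker.dh p q i) n y = x := by
    intro n x y hy
    refine ⟨⟨y - B.sv (n+1) q 0 (B.dv (n+1) q 0 y), ?_⟩, Subtype.ext ?_⟩
    · change B.dv _ _ _ _ = 0
      rw [map_sub, B.vds2 _ _ _ (by omega), sub_self]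
    · rw [e]
      simp only
      rw [map_sub, hy]
      have := bdu_map (X := fun p => M p (q+1)) (Y := fun p => M p (q+1)) (fun p i => B.dh p (q+1) i) (fun p i => B.dh p (q+1) i) n
        ((B.sv n q 0).comp (B.dv n q 0)) ((B.sv (n+1) q 0).comp (B.dv (n+1) q 0)) (fun i hi x => by
          simp only [AddMonoidHom.comp_apply]
          rw [B.cds _ _ _ _ hi (by omega), B.cdd _ _ _ _ hi (by omega)]) y
      rw [hy] at this
      have h2 : B.dv n q 0 x = 0 := x.2
      simp only [AddMonoidHom.comp_apply, h2, map_zero] at this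
      rw [← this, sub_zero]
  refine ⟨fun x => ?_, fun n x hx => ?_⟩
  · obtain ⟨y, hy⟩ := (hB (q+1)).1 x
    exact key 0 x y hy
  · obtain ⟨y, hy⟩ := (hB (q+1)).2 n x (by rw [← e, hx]; rfl)
    exact key _ x y hy

/-- cycles -/
def Cyc : ∀ n, M n n → Prop
  | 0, _ => True
  | n+1, x => bdu (X := fun n => M n n) B.dg n x = 0

theorem diag (hB : B.RowEx) (n : ℕ) (x : M n n) (hx : B.Cyc n x) : ∃ y, bdu (X := fun n => M n n) B.dg n y = x := by
  induction n generalizing M with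
  | zero =>
    obtain ⟨y, rfl⟩ := (hB 0).1 x
    refine ⟨B.sv 1 0 0 y, ?_⟩
    rw [bdu_apply, bdu_apply]
    simp only [Finset.sum_range_succ, Finset.sum_range_zero, dg_apply]
    have h1 := B.vds2 1 0 0 le_rfl y
    have h2 := B.vds2' 1 0 0 le_rfl y
    rw [h1, h2]
  | succ n ih =>
    have pi : ∀ n y, B.dv n n 0 (bdu (X := fun n => M n (n+1)) B.dg' n y) = bdu (X := fun n => M n n) B.dg n (B.dv (n+1) (n+1) 0 y) := fun n =>
      bdu_map (X := fun n => M n (n+1)) (Y := fun n => M n n) B.dg' B.dg n (B.dv n n 0) (B.dv (n+1) (n+1) 0) (fun i hi x => by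
        rw [dg_apply, dg'_apply, ← B.cdd _ _ _ _ hi (by omega), B.vdd _ _ _ _ (by omega) hi])
    have ek : ∀ n y, ((bdu (X := fun n => B.KK n n) B.ker.dg n y : B.KK n n) : M n (n+1)) = bdu (X := fun n => M n (n+1)) B.dg' n (y : M (n+1) (n+2)) := fun n =>
      bdu_map (X := fun n => B.KK n n) (Y := fun n => M n (n+1)) B.ker.dg B.dg' n (B.KK n n).subtype (B.KK (n+1) (n+1)).subtype (fun i hi x => by
        rw [dg_apply, dg'_apply]
        exact (resM_coe (B.k1 _ _ _ hi) _).trans (congrArg _ (resM_coe (B.k3 _ _ _ hi) x)))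
    let xt := B.sv (n+1) (n+1) 0 x
    have hxt : B.dv (n+1) (n+1) 0 xt = x := B.vds2 _ _ _ (by omega) _
    let z : B.KK n n := ⟨bdu (X := fun n => M n (n+1)) B.dg' n xt, by
      change B.dv _ _ _ _ = 0
      rw [pi, hxt]; exact hx⟩
    obtain ⟨k, hk⟩ := ih B.ker (B.ker_row hB) z (by
      rcases n with _ | n
      · trivial
      · apply Subtype.ext
        rw [ek]
        exact bdu_bdu (X := fun n => M n (n+1)) B.dg' B.decSU.dd n xt)
    have hk2 := congrArg Subtype.val hk
    rw [ek] at hk2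
    obtain ⟨y, hy⟩ := (B.dec_ac hB).2.2 n (xt - k) (by
      change bdu (X := fun n => M n (n+1)) B.dg' n _ = 0
      rw [map_sub, hk2, sub_self])
    refine ⟨B.dv _ _ 0 y, ?_⟩
    rw [← pi]
    have h3 : B.dv (n+1) (n+1) 0 k = 0 := k.2
    refine (congrArg _ hy).trans ?_
    rw [map_sub, hxt, h3, sub_zero]
end BS
end AQ

namespace AQ
open MvPolynomial
section sg
variable (A : Type u) [CommRing A] (T : Type u) [CommRing T] [Algebra A T]
/-- augmented faces on index sets -/
noncomputable def fa : ∀ n, ℕ → AQV A T (n+1) → AQV A T n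
  | 0, _ => fun v => q0 (ag A T 0 (pp v))
  | n+1, i => fun v => qq (fc A T n i (pp v))
theorem fc_fa (n i : ℕ) (v : AQV A T (n+1)) : fc A T n (i+1) (X v) = X (fa A T n i v) := by
  cases n
  exacts [fc_one A T i v, fc_succ A T _ i v]
theorem fc_eq_rename (n i : ℕ) : fc A T n (i+1) = rename (fa A T n i) := 
  MvPolynomial.algHom_ext fun v => by rw [fc_fa, rename_X]

/-- degeneracies on index sets -/
noncomputable def sgs (A T : Type u) [CommRing A] : ∀ n, ℕ → AQV A T n → AQV A T (n+1)
  | _, 0 => fun v => qq (X v)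
  | 0, _+1 => fun v => qq (X v)
  | n+1, i+1 => fun v => qq (rename (sgs A T n i) (pp v))
theorem sgs_zero {A T : Type u} [CommRing A] (n : ℕ) (v : AQV A T n) : sgs A T n 0 v = qq (X v) := by cases n <;> rfl
theorem sgs_succ {A T : Type u} [CommRing A] (n i : ℕ) (v : AQV A T (n+1)) : sgs A T (n+1) (i+1) v = qq (rename (sgs A T n i) (pp v)) := rfl
noncomputable def sg (n i : ℕ) : PX A T n →ₐ[A] PX A T (n+1) := rename (sgs A T n i)

theorem fa_zero (n : ℕ) (v : AQV A T n) : fa A T n 0 (qq (X v)) = v := by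
  cases n
  · exact ag_zero A T v
  · exact fc_zero A T _ v

theorem ag_sg (n i : ℕ) (p) : ag A T (n+1) (sg A T n i p) = ag A T n p := by
  suffices h : (ag A T (n+1)).comp (sg A T n i) = ag A T n from DFunLike.congr_fun h p
  clear p
  induction n generalizing i with
  | zero =>
    refine MvPolynomial.algHom_ext fun v => ?_
    rw [AlgHom.comp_apply, sg, rename_X, ag_succ]
    cases i <;> rfl
  | succ n ih =>
    refine MvPolynomial.algHom_ext fun v => ?_
    rw [AlgHom.comp_apply, sg, rename_X, ag_succ]
    rcases i with _ | i
    · rfl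
    · rw [sgs_succ, ag_succ]; exact DFunLike.congr_fun (ih i) (pp v)

theorem ds2 (n j : ℕ) (h : j ≤ n) (p) : fc A T n j (sg A T n j p) = p := by
  suffices h : (fc A T n j).comp (sg A T n j) = AlgHom.id A _ from DFunLike.congr_fun h p
  clear p
  induction n generalizing j with
  | zero =>
    obtain rfl : j = 0 := by omega
    refine MvPolynomial.algHom_ext fun v => ?_
    rw [AlgHom.comp_apply, sg, rename_X, fc_zero, sgs_zero]; rfl
  | succ n ih =>
    refine MvPolynomial.algHom_ext fun v => ?_
    rw [AlgHom.comp_apply, sg, rename_X]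
    rcases j with _ | j
    · rw [fc_zero, sgs_zero]; rfl
    · rw [fc_succ, sgs_succ]; exact congrArg (fun z => X (qq z)) (DFunLike.congr_fun (ih j (by omega)) (pp v))

theorem ds2' (n j : ℕ) (h : j ≤ n) (p) : fc A T n (j+1) (sg A T n j p) = p := by
  suffices h : (fc A T n (j+1)).comp (sg A T n j) = AlgHom.id A _ from DFunLike.congr_fun h p
  clear p
  induction n generalizing j with
  | zero =>
    obtain rfl : j = 0 := by omega
    refine MvPolynomial.algHom_ext fun v => ?_
    rw [AlgHom.comp_apply, sg, rename_X, fc_fa, sgs_zero, fa_zero]; rfl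
  | succ n ih =>
    refine MvPolynomial.algHom_ext fun v => ?_
    rw [AlgHom.comp_apply, sg, rename_X, fc_fa]
    rcases j with _ | j
    · rw [sgs_zero, fa_zero]; rfl
    · rw [sgs_succ]; exact congrArg (fun z => X (qq z)) (DFunLike.congr_fun (ih j (by omega)) (pp v))

theorem ds1 (n i j : ℕ) (h1 : i ≤ j) (h2 : j ≤ n) (p) : fc A T (n+1) i (sg A T (n+1) (j+1) p) = sg A T n j (fc A T n i p) := by
  suffices h : (fc A T (n+1) i).comp (sg A T (n+1) (j+1)) = (sg A T n j).comp (fc A T n i) from DFunLike.congr_fun h p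
  clear p
  induction n generalizing i j with
  | zero =>
    obtain rfl : j = 0 := by omega
    obtain rfl : i = 0 := by omega
    refine MvPolynomial.algHom_ext fun v => ?_
    rw [AlgHom.comp_apply, AlgHom.comp_apply, sg, rename_X, fc_zero, fc_zero, sgs_succ]; rfl
  | succ n ih =>
    refine MvPolynomial.algHom_ext fun v => ?_
    rw [AlgHom.comp_apply, AlgHom.comp_apply, sg, rename_X]
    rcases i with _ | i
    · rw [fc_zero, fc_zero, sgs_succ]; rfl
    · obtain ⟨j, rfl⟩ : ∃ k, j = k + 1 := ⟨j - 1, by omega⟩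
      rw [fc_succ, fc_succ, sgs_succ, sg, rename_X]
      exact congrArg (fun z => X (qq z)) (DFunLike.congr_fun (ih i j (by omega) (by omega)) (pp v))

theorem fa_succ (n i : ℕ) (v : AQV A T (n+1)) : fa A T (n+1) (i+1) (qq (X v)) = qq (X (fa A T n i v)) := fc_fa A T n i v

theorem ds3 (n i j : ℕ) (h1 : j ≤ i) (h2 : i ≤ n) (p) : fc A T (n+1) (i+2) (sg A T (n+1) j p) = sg A T n j (fc A T n (i+1) p) := by
  suffices h : (fc A T (n+1) (i+2)).comp (sg A T (n+1) j) = (sg A T n j).comp (fc A T n (i+1)) from DFunLike.congr_fun h p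
  clear p
  induction n generalizing i j with
  | zero =>
    obtain rfl : i = 0 := by omega
    obtain rfl : j = 0 := by omega
    refine MvPolynomial.algHom_ext fun v => ?_
    rw [AlgHom.comp_apply, AlgHom.comp_apply, sg, rename_X, fc_fa, fc_fa, sgs_zero, sg, rename_X, sgs_zero, fa_succ]
  | succ n ih =>
    refine MvPolynomial.algHom_ext fun v => ?_
    rw [AlgHom.comp_apply, AlgHom.comp_apply, sg, rename_X, fc_fa, fc_fa]
    rcases j with _ | j
    · rw [sgs_zero, sg, rename_X, sgs_zero, fa_succ]
    · obtain ⟨i, rfl⟩ : ∃ k, i = k + 1 := ⟨i - 1, by omega⟩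
      rw [sgs_succ, sg, rename_X]
      exact congrArg (fun z => X (qq z)) (DFunLike.congr_fun (ih i j (by omega) (by omega)) (pp v))

/-- standard resolution -/
noncomputable def std : PR A T where
  V := AQV A T
  d := fc A T
  s := sg A T
  ε := ag A T 0
  dd n i j h _ x := fc_fc A T n i j h x
  de x := (ag_fc A T 0 1 x).trans (ag_fc A T 0 0 x).symm
  ds1 := ds1 A T
  ds2 := ds2 A T
  ds2' := ds2' A T
  ds3 := ds3 A T

theorem std_aug (n : ℕ) (p) : (std A T).aug n p = ag A T n p := by
  induction n with
  | zero => rfl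
  | succ n ih => exact (ih _).trans (ag_fc A T n 0 p)
end sg

section gb
variable {A B D K : Type u} [CommRing A] [CommRing B] [CommRing D]
/-- change of base on index sets -/
noncomputable def gb (K : Type u) (f : A →+* B) : ∀ n, AQV A K n → AQV B K n
  | 0 => fun v => v
  | n+1 => fun v => qq (map f (rename (gb K f n) (pp v)))
/-- change of base -/
noncomputable def G (K : Type u) (f : A →+* B) (n : ℕ) : PX A K n →+* PX B K n := (map f).comp (rename (gb K f n)).toRingHom

theorem G_X (f : A →+* B) (n : ℕ) (v) : G K f n (X v) = X (gb K f n v) := by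
  change map f (rename _ (X v)) = _
  rw [rename_X, map_X]
theorem G_C (f : A →+* B) (n : ℕ) (r) : G K f n (C r) = C (f r) := by
  change map f (rename _ (C r)) = _
  rw [rename_C, map_C]
theorem gb_succ (f : A →+* B) (n : ℕ) (v) : gb K f (n+1) v = qq (G K f n (pp v)) := rfl

theorem gb_gb (f : A →+* B) (g : B →+* D) (h : A →+* D) (hh : ∀ x, g (f x) = h x) (n : ℕ) (v) : gb K g n (gb K f n v) = gb K h n v := by
  induction n with
  | zero => rfl
  | succ n ih =>
    have : (G K g n).comp (G K f n) = G K h n := by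
      refine MvPolynomial.ringHom_ext (fun r => ?_) fun v => ?_
      · simp only [RingHom.comp_apply, G_C, hh]
      · simp only [RingHom.comp_apply, G_X, ih]
    exact DFunLike.congr_fun this (pp v)
theorem gb_id (f : A →+* A) (hh : ∀ x, f x = x) (n : ℕ) (v) : gb K f n v = v := by
  induction n with
  | zero => rfl
  | succ n ih =>
    have : G K f n = RingHom.id _ := by
      refine MvPolynomial.ringHom_ext (fun r => ?_) fun v => ?_
      · simp only [RingHom.id_apply, G_C, hh]
      · simp only [RingHom.id_apply, G_X, ih]
    exact DFunLike.congr_fun this (pp v)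
theorem gb_sq {D' : Type u} [CommRing D'] (f : A →+* B) (g : B →+* D) (f' : A →+* D') (g' : D' →+* D) 
    (hh : ∀ x, g (f x) = g' (f' x)) (n : ℕ) (v) : gb K g n (gb K f n v) = gb K g' n (gb K f' n v) := by
  rw [gb_gb f g (g.comp f) (fun _ => rfl), gb_gb f' g' (g.comp f) (fun x => (hh x).symm)]

theorem G_sgs (f : A →+* B) (n i : ℕ) (v) : gb K f (n+1) (sgs A K n i v) = sgs B K n i (gb K f n v) := by
  induction n generalizing i with
  | zero => cases i <;> exact G_X _ _ _
  | succ n ih =>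
    rcases i with _ | i
    · exact G_X _ _ _
    · rw [sgs_succ, sgs_succ]
      have : (G K f (n+1)).comp (rename (sgs A K n i)).toRingHom = (rename (sgs B K n i)).toRingHom.comp (G K f n) := by
        refine MvPolynomial.ringHom_ext (fun r => ?_) fun v => ?_
        · change G K f (n+1) (rename _ (C r)) = rename _ (G K f n (C r))
          rw [rename_C, G_C, G_C, rename_C]
        · change G K f (n+1) (rename _ (X v)) = rename _ (G K f n (X v))
          rw [rename_X, G_X, G_X, rename_X, ih]
      exact DFunLike.congr_fun this (pp v)

variable [CommRing K] [Algebra A K] [Algebra B K] (f : A →+* B) (hf : ∀ x, algebraMap B K (f x) = algebraMap A K x)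
include hf
theorem ag_G (n : ℕ) (p) : ag B K n (G K f n p) = ag A K n p := by
  suffices h : (ag B K n).toRingHom.comp (G K f n) = (ag A K n).toRingHom from DFunLike.congr_fun h p
  clear p
  have hC : ∀ n r, ((ag B K n).toRingHom.comp (G K f n)) (C r) = (ag A K n).toRingHom (C r) := by
    intro n r
    change ag B K n (G K f n (C r)) = ag A K n (C r)
    rw [G_C]
    exact ((ag B K n).commutes _).trans ((hf r).trans ((ag A K n).commutes r).symm)
  induction n with
  | zero =>
    refine MvPolynomial.ringHom_ext (hC 0) fun v => ?_
    change ag B K 0 (G K f 0 (X v)) = ag A K 0 (X v)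
    rw [G_X, ag_zero, ag_zero]; rfl
  | succ n ih =>
    refine MvPolynomial.ringHom_ext (hC (n+1)) fun v => ?_
    change ag B K (n+1) (G K f (n+1) (X v)) = ag A K (n+1) (X v)
    rw [G_X, ag_succ, ag_succ]; exact DFunLike.congr_fun ih (pp v)

theorem fc_G (n i : ℕ) (p) : fc B K n i (G K f (n+1) p) = G K f n (fc A K n i p) := by
  suffices h : (fc B K n i).toRingHom.comp (G K f (n+1)) = (G K f n).comp (fc A K n i).toRingHom from DFunLike.congr_fun h p
  clear p
  have hC : ∀ n i r, ((fc B K n i).toRingHom.comp (G K f (n+1))) (C r) = ((G K f n).comp (fc A K n i).toRingHom) (C r) := by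
    intro n i r
    change fc B K n i (G K f (n+1) (C r)) = G K f n (fc A K n i (C r))
    rw [G_C]
    have h1 : fc A K n i (C r) = C r := (fc A K n i).commutes r
    have h2 : fc B K n i (C (f r)) = C (f r) := (fc B K n i).commutes _
    rw [h1, h2, G_C]
  induction n generalizing i with
  | zero =>
    refine MvPolynomial.ringHom_ext (hC 0 i) fun v => ?_
    change fc B K 0 i (G K f 1 (X v)) = G K f 0 (fc A K 0 i (X v))
    rcases i with _ | i
    · rw [G_X, fc_zero, fc_zero]; rfl
    · rw [G_X, fc_one, fc_one, G_X]; exact congrArg (fun z => X (q0 z)) (ag_G f hf 0 (pp v))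
  | succ n ih =>
    refine MvPolynomial.ringHom_ext (hC (n+1) i) fun v => ?_
    change fc B K (n+1) i (G K f (n+2) (X v)) = G K f (n+1) (fc A K (n+1) i (X v))
    rcases i with _ | i
    · rw [G_X, fc_zero, fc_zero]; rfl
    · rw [G_X, fc_succ, fc_succ, G_X]; exact congrArg (fun z => X (qq z)) (DFunLike.congr_fun (ih i) (pp v))
end gb

/-- Jacobian and base change -/
theorem jac_base {A B S W W' N : Type*} [CommRing A] [CommRing B] [CommRing S] [Algebra A S] [Algebra B S] [AddCommGroup N] [Module S N]
   (F : MvPolynomial W A →+* MvPolynomial W' B) (f : A → B) (γ : W → W') (hF : ∀ v, F (X v) = X (γ v)) (hF' : ∀ r, F (C r) = C (f r)) 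
   (a : MvPolynomial W A →ₐ[A] S) (b : MvPolynomial W' B →ₐ[B] S) (hab : ∀ p, b (F p) = a p) (p) (n : N) :
   Finsupp.mapDomain γ (jac N a p n) = jac N b (F p) n := by
  induction p using MvPolynomial.induction_on with
  | C r => rw [jac_C, hF', jac_C, Finsupp.mapDomain_zero]
  | add p q hp hq => rw [jac_add, Finsupp.mapDomain_add, hp, hq, map_add, jac_add]
  | mul_X p v hp => 
    rw [jac_mul, Finsupp.mapDomain_add, Finsupp.mapDomain_smul, Finsupp.mapDomain_smul, hp, map_mul, jac_mul, hab, hab, hF, jac_X, jac_X, Finsupp.mapDomain_single]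

section M
variable {A B K : Type u} [CommRing A] [CommRing B] [CommRing K] [Algebra A K] [Algebra B K] (f : A →+* B) (hf : ∀ x, algebraMap B K (f x) = algebraMap A K x)
   (N : Type u) [AddCommGroup N] [Module K N]
include hf
theorem mD_aqd (n i : ℕ) (x : AQV A K (n+1) →₀ N) : Finsupp.mapDomain (gb K f n) (aqd N n i x) = aqd N n i (Finsupp.mapDomain (gb K f (n+1)) x) := by
  change Finsupp.mapDomain (gb K f n) (J N (ag A K n) (fc A K n i) x) = J N (ag B K n) (fc B K n i) (Finsupp.mapDomain (gb K f (n+1)) x)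
  induction x using Finsupp.induction_linear with
  | zero => simp [Finsupp.mapDomain_zero]
  | add x y hx hy => simp only [map_add, Finsupp.mapDomain_add, hx, hy]
  | single v m => 
    rw [J_single, Finsupp.mapDomain_single, J_single, jac_base (G K f n) f (gb K f n) (fun v => G_X f n v) (fun r => G_C f n r) (ag A K n) (ag B K n) (fun p => ag_G f hf n p),
      ← fc_G f hf, G_X]
end M
end AQ

namespace AQ
open MvPolynomial
/-- functor from rings to abelian groups -/
structure RF where
  obj : ∀ R : Type u, [CommRing R] → Type u
  inst : ∀ (R : Type u) [CommRing R], AddCommGroup (obj R)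
  map : ∀ {R R' : Type u} [CommRing R] [CommRing R'], (R →+* R') → obj R →+ obj R'
  sq : ∀ {R R₁ R₂ R' : Type u} [CommRing R] [CommRing R'] [CommRing R₁] [CommRing R₂] (f : R →+* R₁) (g : R₁ →+* R') (f' : R →+* R₂) (g' : R₂ →+* R'),
    (∀ x, g (f x) = g' (f' x)) → ∀ x, map g (map f x) = map g' (map f' x)
  mid : ∀ {R R₁ : Type u} [CommRing R] [CommRing R₁] (f : R →+* R₁) (g : R₁ →+* R), (∀ x, g (f x) = x) → ∀ x, map g (map f x) = x
instance (F : RF.{u}) (R : Type u) [CommRing R] : AddCommGroup (F.obj R) := F.inst R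

/-- augmented simplicial ring over `K` -/
structure SR (K : Type u) [CommRing K] (Xa : ℕ → Type u) [∀ n, CommRing (Xa n)] [∀ n, Algebra (Xa n) K] where
  d : ∀ n : ℕ, ℕ → Xa (n+1) →+* Xa n
  s : ∀ n : ℕ, ℕ → Xa (n+1) →+* Xa (n+2)
  dd : ∀ n i j, i ≤ j → j ≤ n → ∀ x, d n i (d (n+1) (j+1) x) = d n j (d (n+1) i x)
  ds1 : ∀ n i j, i ≤ j → j ≤ n → ∀ x, d (n+2) i (s (n+1) (j+1) x) = s n j (d (n+1) i x)
  ds2 : ∀ n j, j ≤ n → ∀ x, d (n+1) j (s n j x) = x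
  ds2' : ∀ n j, j ≤ n → ∀ x, d (n+1) (j+1) (s n j x) = x
  ds3 : ∀ n i j, j ≤ i → i ≤ n → ∀ x, d (n+2) (i+2) (s (n+1) j x) = s n j (d (n+1) (i+1) x)
  hd : ∀ n i x, algebraMap (Xa n) K (d n i x) = algebraMap (Xa (n+1)) K x
  hs : ∀ n i x, algebraMap (Xa (n+2)) K (s n i x) = algebraMap (Xa (n+1)) K x

/-- identity functor -/
noncomputable def idF : RF.{u} where
  obj R := R
  inst R := inferInstance
  map f := f.toAddMonoidHom
  sq f g f' g' h x := h x
  mid f g h x := h x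
/-- polynomials -/
noncomputable def polF (T : Type u) : RF.{u} where
  obj R := MvPolynomial T R
  inst R := inferInstance
  map f := (MvPolynomial.map f).toAddMonoidHom
  sq f g f' g' h x := by
    change MvPolynomial.map g (MvPolynomial.map f x) = MvPolynomial.map g' (MvPolynomial.map f' x)
    rw [MvPolynomial.map_map, MvPolynomial.map_map, RingHom.ext (f := g.comp f) (g := g'.comp f') h]
  mid f g h x := by
    change MvPolynomial.map g (MvPolynomial.map f x) = x
    rw [MvPolynomial.map_map, RingHom.ext (f := g.comp f) (g := RingHom.id _) h, MvPolynomial.map_id]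
theorem G_sq {A B D D' : Type u} [CommRing A] [CommRing B] [CommRing D] [CommRing D'] (K : Type u) (f : A →+* B) (g : B →+* D) (f' : A →+* D') (g' : D' →+* D) 
    (hh : ∀ x, g (f x) = g' (f' x)) (n : ℕ) (v) : G K g n (G K f n v) = G K g' n (G K f' n v) := gb_sq (K := K) f g f' g' hh (n+1) v
theorem G_mid {A B : Type u} [CommRing A] [CommRing B] (K : Type u) (f : A →+* B) (g : B →+* A)
    (hh : ∀ x, g (f x) = x) (n : ℕ) (v) : G K g n (G K f n v) = v := 
  (gb_gb (K := K) f g (g.comp f) (fun _ => rfl) (n+1) v).trans (gb_id (K := K) _ hh (n+1) v)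
/-- standard resolution in fixed degree -/
noncomputable def pxF (K : Type u) (q : ℕ) : RF.{u} where
  obj R := PX R K q
  inst R := inferInstance
  map f := (G K f q).toAddMonoidHom
  sq f g f' g' h x := G_sq K f g f' g' h q x
  mid f g h x := G_mid K f g h q x
theorem md_md {N X Y Z : Type u} [AddCommGroup N] (f : X → Y) (g : Y → Z) (x : X →₀ N) : 
  Finsupp.mapDomain g (Finsupp.mapDomain f x) = Finsupp.mapDomain (fun x => g (f x)) x := Finsupp.mapDomain_comp.symm
/-- cotangent complex in fixed degree -/
noncomputable def avF (N : Type u) [AddCommGroup N] (K : Type u) (q : ℕ) : RF.{u} where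
  obj R := AQV R K q →₀ N
  inst R := inferInstance
  map f := Finsupp.mapDomain.addMonoidHom (gb K f q)
  sq f g f' g' h x := by
    change Finsupp.mapDomain _ (Finsupp.mapDomain _ _) = Finsupp.mapDomain _ (Finsupp.mapDomain _ _)
    rw [md_md, md_md, funext fun x => gb_sq f g f' g' h q x]
  mid f g h x := by
    change Finsupp.mapDomain _ (Finsupp.mapDomain _ _) = _
    rw [md_md, funext fun x => (gb_gb f g (g.comp f) (fun _ => rfl) q x).trans (gb_id _ h q x)]
    exact Finsupp.mapDomain_id

namespace SR
variable {K : Type u} [CommRing K] {Xa : ℕ → Type u} [∀ n, CommRing (Xa n)] [∀ n, Algebra (Xa n) K] (Q : SR K Xa)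

/-- apply a functor -/
noncomputable def app (F : RF.{u}) : SU (F.obj (Xa 0)) (fun n => F.obj (Xa (n+1))) where
  d n i := F.map (Q.d (n+1) i)
  s n i := F.map (Q.s n i)
  ε := F.map (Q.d 0 0)
  dd n i j h1 h2 := F.sq _ _ _ _ (Q.dd _ _ _ h1 h2)
  de := F.sq _ _ _ _ (Q.dd 0 0 0 le_rfl le_rfl)
  ds1 n i j h1 h2 := F.sq _ _ _ _ (Q.ds1 _ _ _ h1 h2)
  ds2 n j h := F.mid _ _ (Q.ds2 _ _ h)
  ds2' n j h := F.mid _ _ (Q.ds2' _ _ h)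
  ds3 n i j h1 h2 := F.sq _ _ _ _ (Q.ds3 _ _ _ h1 h2)

def Ac : Prop := (Q.app idF).Ac

theorem coeff_lift {T X Y : Type u} [CommRing X] [CommRing Y] (f : MvPolynomial T X →+ MvPolynomial T Y) (f' : X →+ Y) (hf : ∀ m p, coeff m (f p) = f' (coeff m p))
   (y : MvPolynomial T Y) (h : ∀ m, ∃ x, f' x = coeff m y) : ∃ x, f x = y := by
  classical
  choose c hc using h
  refine ⟨∑ m ∈ y.support, monomial m (c m), ?_⟩
  ext m
  rw [hf]
  simp only [coeff_sum, coeff_monomial, Finset.sum_ite_eq', mem_support_iff]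
  split_ifs with h
  · exact hc m
  · rw [map_zero]; exact (not_not.1 h).symm

theorem bdu_coeff {T : Type u} (n : ℕ) (p) (m) : coeff m (bdu (X := fun n => MvPolynomial T (Xa (n+1))) (Q.app (polF T)).d n p) = 
    bdu (X := fun n => Xa (n+1)) (Q.app idF).d n (coeff m p) :=
  bdu_map (X := fun n => MvPolynomial T (Xa (n+1))) (Y := fun n => Xa (n+1)) (Q.app (polF T)).d (Q.app idF).d n 
   (lcoeff (Xa (n+1)) m).toAddMonoidHom (lcoeff (Xa (n+2)) m).toAddMonoidHom (fun i hi x => coeff_map _ _ _) p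

theorem pol_ac (hQ : Q.Ac) (T : Type u) : (Q.app (polF T)).Ac := by
  refine ⟨fun y => ?_, fun x hx => ?_, fun n x hx => ?_⟩
  · exact coeff_lift (Q.app (polF T)).ε (Q.app idF).ε (fun m p => coeff_map _ _ _) y fun m => hQ.1 _
  · exact coeff_lift (bdu (X := fun n => MvPolynomial T (Xa (n+1))) (Q.app (polF T)).d 0) _ (fun m p => Q.bdu_coeff 0 p m) x fun m => hQ.2.1 _ 
      ((coeff_map (Q.d 0 0) x m).symm.trans (congrArg (coeff m) hx))
  · exact coeff_lift (bdu (X := fun n => MvPolynomial T (Xa (n+1))) (Q.app (polF T)).d (n+1)) _ (fun m p => Q.bdu_coeff (n+1) p m) x fun m => hQ.2.2 n _ 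
      ((Q.bdu_coeff n x m).symm.trans (congrArg (coeff m) hx))

theorem contr (hQ : Q.Ac) (q : ℕ) : ∃ h : ∀ n, AQV (Xa n) K q → AQV (Xa (n+1)) K q, (∀ n x, gb K (Q.d n 0) q (h n x) = x) ∧
    ∀ n i, i ≤ n → ∀ x, gb K (Q.d (n+1) (i+1)) q (h (n+1) x) = h n (gb K (Q.d n i) q x) := by
  induction q with
  | zero => exact ⟨fun n x => x, fun n x => rfl, fun n i hi x => rfl⟩
  | succ q ih =>
    obtain ⟨h, h0, h1⟩ := ih
    have rr : ∀ {X Y Z R : Type u} [CommRing R] (f : X → Y) (g : Y → Z) (p : MvPolynomial X R), rename g (rename f p) = rename (fun x => g (f x)) p := 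
      fun f g p => rename_rename f g p
    have hac : (Q.app (pxF K q)).Ac := by
      refine ncd (B := fun p q' => MvPolynomial (AQV (Xa q') K q) (Xa (p+1))) (fun p q' i => (Q.app (polF (AQV (Xa q') K q))).d p i) 
        (fun p q' i => (Q.app (polF (AQV (Xa q') K q))).s p i) (fun p q' i => (rename (R := Xa (p+1)) (gb K (Q.d q' i) q)).toRingHom.toAddMonoidHom)
        (fun p q' => rename (R := Xa (p+1)) (h q')) (Q.app (pxF K q)) (Q.app (polF (AQV (Xa 0) K q))) (fun n i hi x => rfl) (fun x => rfl) (fun n i hi x => rfl)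
        ?_ ?_ ?_ (fun n q' => (Q.app (polF (AQV (Xa q') K q))).ds1 n) (fun n q' => (Q.app (polF (AQV (Xa q') K q))).ds2 n)
        (fun n q' => (Q.app (polF (AQV (Xa q') K q))).ds2' n) (fun n q' => (Q.app (polF (AQV (Xa q') K q))).ds3 n)
        (fun p q' i j h1 h2 x => MvPolynomial.map_rename _ _ _) (fun p q' i j h1 h2 x => MvPolynomial.map_rename _ _ _) (fun p q' i hi x => MvPolynomial.map_rename _ _ _)
        (Q.pol_ac hQ _)
      · intro p n i j h1 h2 x
        change rename _ (rename _ x) = rename _ (rename _ x)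
        rw [rr, rr, funext fun x => gb_sq _ _ _ _ (Q.dd n i j h1 h2) q x]
      · intro p n x
        change rename _ (rename _ x) = x
        rw [rr, funext fun x => h0 n x]
        exact rename_id_apply x
      · intro p n i hi x
        change rename _ (rename _ x) = rename _ (rename _ x)
        rw [rr, rr, funext fun x => h1 n i hi x]
    obtain ⟨t, g, g0, g1, g2, g3⟩ := (Q.app (pxF K q)).contraction hac
    refine ⟨fun n => match n with | 0 => t | n+1 => g n, fun n x => ?_, fun n i hi x => ?_⟩
    · rcases n with _ | n
      exacts [g0 x, g1 n x]
    · rcases n with _ | n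
      · obtain rfl : i = 0 := by omega
        exact g2 x
      · exact g3 n i hi x

theorem G_sg {A B : Type u} [CommRing A] [CommRing B] [Algebra A K] [Algebra B K] (f : A →+* B) (n i : ℕ) (p) : G K f (n+1) (sg A K n i p) = sg B K n i (G K f n p) :=
  G_sgs (K := K) f (n+1) (i+1) p

/-- the diagonal -/
noncomputable def diag : SU K (fun n => PX (Xa (n+1)) K n) where
  d n i := ((G K (Q.d (n+1) i) n).comp (fc (Xa (n+2)) K n i).toRingHom).toAddMonoidHom
  s n i := ((G K (Q.s n i) (n+1)).comp (sg (Xa (n+1)) K n i).toRingHom).toAddMonoidHom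
  ε := (ag (Xa 1) K 0).toRingHom.toAddMonoidHom
  dd n i j h1 h2 x := by
    change G K _ _ (fc _ K _ _ (G K _ _ (fc _ K _ _ x))) = G K _ _ (fc _ K _ _ (G K _ _ (fc _ K _ _ x)))
    rw [fc_G _ (Q.hd _ _), fc_G _ (Q.hd _ _), fc_fc _ _ _ _ _ h1]
    exact G_sq K _ _ _ _ (Q.dd _ _ _ h1 h2) _ _
  de x := by
    change ag _ K _ (G K _ _ (fc _ K _ _ x)) = ag _ K _ (G K _ _ (fc _ K _ _ x))
    rw [ag_G _ (Q.hd _ _), ag_G _ (Q.hd _ _), ag_fc, ag_fc]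
  ds1 n i j h1 h2 x := by
    change G K _ _ (fc _ K _ _ (G K _ _ (sg _ K _ _ x))) = G K _ _ (sg _ K _ _ (G K _ _ (fc _ K _ _ x)))
    rw [fc_G _ (Q.hs _ _), ← G_sg, AQ.ds1 _ _ _ _ _ h1 h2]
    exact G_sq K _ _ _ _ (Q.ds1 _ _ _ h1 h2) _ _
  ds2 n j h x := by
    change G K _ _ (fc _ K _ _ (G K _ _ (sg _ K _ _ x))) = x
    rw [fc_G _ (Q.hs _ _), AQ.ds2 _ _ _ _ h, G_mid K _ _ (Q.ds2 _ _ h)]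
  ds2' n j h x := by
    change G K _ _ (fc _ K _ _ (G K _ _ (sg _ K _ _ x))) = x
    rw [fc_G _ (Q.hs _ _), AQ.ds2' _ _ _ _ h, G_mid K _ _ (Q.ds2' _ _ h)]
  ds3 n i j h1 h2 x := by
    change G K _ _ (fc _ K _ _ (G K _ _ (sg _ K _ _ x))) = G K _ _ (sg _ K _ _ (G K _ _ (fc _ K _ _ x)))
    rw [fc_G _ (Q.hs _ _), ← G_sg, AQ.ds3 _ _ _ _ _ h1 h2]
    exact G_sq K _ _ _ _ (Q.ds3 _ _ _ h1 h2) _ _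

/-- constant object -/
def cst (K : Type u) [AddCommGroup K] : SU K (fun _ => K) where
  d _ _ := AddMonoidHom.id K
  s _ _ := AddMonoidHom.id K
  ε := AddMonoidHom.id K
  dd _ _ _ _ _ _ := rfl
  de _ := rfl
  ds1 _ _ _ _ _ _ := rfl
  ds2 _ _ _ _ := rfl
  ds2' _ _ _ _ := rfl
  ds3 _ _ _ _ _ _ := rfl
theorem cst_ac (K : Type u) [AddCommGroup K] : (cst K).Ac := 
  acycU_first _ _ (AddMonoidHom.id K) (fun _ => AddMonoidHom.id K) (fun _ => rfl) (fun _ _ => rfl) (fun _ => rfl) (fun _ _ _ _ => rfl)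

theorem diag_ac : Q.diag.Ac := by
  refine ncd (B := fun p q => AugX K (fun q => PX (Xa (p+1)) K q) q) (fun p q i => match q with | 0 => AddMonoidHom.id K | q+1 => (Q.app (pxF K q)).d p i)
    (fun p q i => match q with | 0 => AddMonoidHom.id K | q+1 => (Q.app (pxF K q)).s p i)
    (fun p => augd (ag (Xa (p+1)) K 0).toRingHom.toAddMonoidHom (fun n i => (fc (Xa (p+1)) K n i).toRingHom.toAddMonoidHom))
    (fun p q => match q with | 0 => fun x => X (q0 x) | q+1 => fun x => X (qq x)) Q.diag (cst K) (fun n i hi x => rfl) (fun x => rfl) (fun n i hi x => rfl)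
    ?_ ?_ ?_ (fun n q => match q with | 0 => (cst K).ds1 n | q+1 => (Q.app (pxF K q)).ds1 n)
    (fun n q => match q with | 0 => (cst K).ds2 n | q+1 => (Q.app (pxF K q)).ds2 n)
    (fun n q => match q with | 0 => (cst K).ds2' n | q+1 => (Q.app (pxF K q)).ds2' n)
    (fun n q => match q with | 0 => (cst K).ds3 n | q+1 => (Q.app (pxF K q)).ds3 n) ?_ ?_ ?_ (cst_ac K)
  · intro p n i j h1 h2 x
    rcases n with _ | n
    · exact (ag_fc (Xa (p+1)) K 0 (j+1) x).trans (ag_fc (Xa (p+1)) K 0 i x).symm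
    · exact fc_fc _ K _ _ _ h1 _
  · intro p n x
    rcases n with _ | n
    · exact ag_zero (Xa (p+1)) K _
    · exact fc_zero (Xa (p+1)) K n _
  · intro p n i hi x
    rcases n with _ | n
    · exact fc_one (Xa (p+1)) K i _
    · exact fc_succ (Xa (p+1)) K n i _
  · intro p q i j h1 h2 x
    rcases q with _ | q
    · exact (ag_G _ (Q.hd (p+1) i) 0 x).symm
    · exact (fc_G _ (Q.hd _ _) _ _ _).symm
  · intro p q i j h1 h2 x
    rcases q with _ | q
    · exact (ag_G _ (Q.hs p i) 0 x).symm
    · exact (fc_G _ (Q.hs _ _) _ _ _).symm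
  · intro p q i hi x
    rcases q with _ | q
    · exact G_X (K := K) _ _ _
    · exact G_X (K := K) _ _ _
end SR

/-- constant simplicial ring -/
noncomputable def cstR (A K : Type u) [CommRing A] [CommRing K] [Algebra A K] : SR K (fun _ => A) where
  d _ _ := RingHom.id A
  s _ _ := RingHom.id A
  dd _ _ _ _ _ _ := rfl
  ds1 _ _ _ _ _ _ := rfl
  ds2 _ _ _ _ := rfl
  ds2' _ _ _ _ := rfl
  ds3 _ _ _ _ _ _ := rfl
  hd _ _ _ := rfl
  hs _ _ _ := rfl

theorem std_ac (A K : Type u) [CommRing A] [CommRing K] [Algebra A K] : (std A K).Ac := by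
  have := (cstR A K).diag_ac
  have e : (cstR A K).diag.d = (std A K).da := by
    funext n i
    refine AddMonoidHom.ext fun x => ?_
    exact (gb_id (K := K) (RingHom.id A) (fun _ => rfl) (n+1) (fc A K n i x))
  unfold SU.Ac at this
  rw [e] at this
  exact this
end AQ

namespace AQ
open MvPolynomial
namespace SR
variable {K : Type u} [CommRing K] {Xa : ℕ → Type u} [∀ n, CommRing (Xa n)] [∀ n, Algebra (Xa n) K] (Q : SR K Xa)

/-- composite augmentation -/
def e : ∀ p, Xa p →+* Xa 0
  | 0 => RingHom.id _
  | p+1 => (e p).comp (Q.d p 0)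
theorem e_d (p i : ℕ) (hi : i ≤ p) (x) : Q.e p (Q.d p i x) = Q.e (p+1) x := by
  induction p generalizing i with
  | zero => obtain rfl : i = 0 := by omega
            rfl
  | succ p ih =>
    rcases i with _ | i
    · rfl
    · change Q.e p (Q.d p 0 _) = _
      rw [Q.dd _ _ _ (by omega) (by omega), ih _ (by omega)]; rfl
theorem e_s (p i : ℕ) (hi : i ≤ p) (x) : Q.e (p+2) (Q.s p i x) = Q.e (p+1) x := by
  rw [← Q.e_d _ i (by omega), Q.ds2 _ _ hi]
theorem e_alg (p : ℕ) (x) : algebraMap (Xa 0) K (Q.e p x) = algebraMap (Xa p) K x := by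
  induction p with
  | zero => rfl
  | succ p ih => exact (ih _).trans (Q.hd _ _ _)

variable (N : Type u) [AddCommGroup N] [Module K N]

theorem md_sg {A : Type u} [CommRing A] [Algebra A K] (q i : ℕ) (x : AQV A K q →₀ N) : Finsupp.mapDomain (sgs A K q i) x = J N (ag A K (q+1)) (sg A K q i) x :=
  (J_rename _ _ x).symm

/-- the bisimplicial cotangent module -/
noncomputable def bm : BS (fun p q => AQV (Xa (p+1)) K q →₀ N) where
  dh p q i := (Q.app (avF N K q)).d p i
  sh p q i := (Q.app (avF N K q)).s p i
  dv p q i := aqd N q i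
  sv p q i := Finsupp.mapDomain.addMonoidHom (sgs _ K q i)
  hdd n q := (Q.app (avF N K q)).dd n
  hds1 n q := (Q.app (avF N K q)).ds1 n
  hds2 n q := (Q.app (avF N K q)).ds2 n
  hds2' n q := (Q.app (avF N K q)).ds2' n
  hds3 n q := (Q.app (avF N K q)).ds3 n
  vdd p n i j h1 h2 x := by
    change J N _ _ (J N _ _ x) = J N _ _ (J N _ _ x)
    rw [J_J _ _ _ _ (ag_fc _ K _ _), J_J _ _ _ _ (ag_fc _ K _ _)]
    exact J_congr _ _ _ (fun v => fc_fc _ K _ _ _ h1 _) x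
  vds1 p n i j h1 h2 x := by
    change J N _ _ (Finsupp.mapDomain _ x) = Finsupp.mapDomain _ (J N _ _ x)
    rw [md_sg, md_sg, J_J _ _ _ _ (ag_fc _ K _ _), J_J _ _ _ _ (ag_sg _ K _ _)]
    exact J_congr _ _ _ (fun v => AQ.ds1 _ K _ _ _ h1 h2 _) x
  vds2 p n j h x := by
    change J N _ _ (Finsupp.mapDomain _ x) = x
    rw [md_sg, J_J _ _ _ _ (ag_fc _ K _ _)]
    exact J_id _ _ (fun v => AQ.ds2 _ K _ _ h _) x
  vds2' p n j h x := by
    change J N _ _ (Finsupp.mapDomain _ x) = x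
    rw [md_sg, J_J _ _ _ _ (ag_fc _ K _ _)]
    exact J_id _ _ (fun v => AQ.ds2' _ K _ _ h _) x
  vds3 p n i j h1 h2 x := by
    change J N _ _ (Finsupp.mapDomain _ x) = Finsupp.mapDomain _ (J N _ _ x)
    rw [md_sg, md_sg, J_J _ _ _ _ (ag_fc _ K _ _), J_J _ _ _ _ (ag_sg _ K _ _)]
    exact J_congr _ _ _ (fun v => AQ.ds3 _ K _ _ _ h1 h2 _) x
  cdd p q i j h1 h2 x := mD_aqd _ (Q.hd _ _) N _ _ x
  csd p q i j h1 h2 x := mD_aqd _ (Q.hs _ _) N _ _ x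
  cds p q i j h1 h2 x := by
    change Finsupp.mapDomain _ (Finsupp.mapDomain _ x) = Finsupp.mapDomain _ (Finsupp.mapDomain _ x)
    rw [md_md, md_md]; exact congrArg (fun f => Finsupp.mapDomain f x) (_root_.funext fun x => G_sgs _ _ _ x)
  css p q i j h1 h2 x := by
    change Finsupp.mapDomain _ (Finsupp.mapDomain _ x) = Finsupp.mapDomain _ (Finsupp.mapDomain _ x)
    rw [md_md, md_md]; exact congrArg (fun f => Finsupp.mapDomain f x) (_root_.funext fun x => G_sgs _ _ _ x)

/-- projection -/
noncomputable def rho (p q : ℕ) : (AQV (Xa (p+1)) K q →₀ N) →+ (AQV (Xa 0) K q →₀ N) := Finsupp.mapDomain.addMonoidHom (gb K (Q.e (p+1)) q)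

theorem rho_dh (p q i : ℕ) (hi : i ≤ p + 1) (x) : Q.rho N p q ((Q.bm N).dh p q i x) = Q.rho N (p+1) q x := by
  change Finsupp.mapDomain _ (Finsupp.mapDomain _ x) = Finsupp.mapDomain _ x
  rw [md_md, funext fun x => gb_gb _ _ _ (Q.e_d _ _ hi) _ x]
theorem rho_sh (p q i : ℕ) (hi : i ≤ p) (x) : Q.rho N (p+1) q ((Q.bm N).sh p q i x) = Q.rho N p q x := by
  change Finsupp.mapDomain _ (Finsupp.mapDomain _ x) = Finsupp.mapDomain _ x
  rw [md_md, funext fun x => gb_gb _ _ _ (Q.e_s _ _ hi) _ x]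
theorem rho_dv (p q i : ℕ) (x) : Q.rho N p q ((Q.bm N).dv p q i x) = aqd N q i (Q.rho N p (q+1) x) :=
  mD_aqd _ (Q.e_alg _) N _ _ x
theorem rho_sv (p q i : ℕ) (x) : Q.rho N p (q+1) ((Q.bm N).sv p q i x) = Finsupp.mapDomain (sgs _ K q i) (Q.rho N p q x) := by
  change Finsupp.mapDomain _ (Finsupp.mapDomain _ x) = Finsupp.mapDomain _ (Finsupp.mapDomain _ x)
  rw [md_md, md_md]; exact congrArg (fun f => Finsupp.mapDomain f x) (_root_.funext fun x => G_sgs _ _ _ x)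

/-- kernel -/
noncomputable def UU (p q : ℕ) : AddSubgroup (AQV (Xa (p+1)) K q →₀ N) := (Q.rho N p q).ker
theorem u1 (p q i : ℕ) (hi : i ≤ p + 1) (x) (hx : x ∈ Q.UU N (p+1) q) : (Q.bm N).dh p q i x ∈ Q.UU N p q := 
  (Q.rho_dh N p q i hi x).trans hx
theorem u2 (p q i : ℕ) (hi : i ≤ p) (x) (hx : x ∈ Q.UU N p q) : (Q.bm N).sh p q i x ∈ Q.UU N (p+1) q := 
  (Q.rho_sh N p q i hi x).trans hx
theorem u3 (p q i : ℕ) (_ : i ≤ q + 1) (x) (hx : x ∈ Q.UU N p (q+1)) : (Q.bm N).dv p q i x ∈ Q.UU N p q := 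
  (Q.rho_dv N p q i x).trans ((congrArg _ hx).trans (map_zero _))
theorem u4 (p q i : ℕ) (_ : i ≤ q) (x) (hx : x ∈ Q.UU N p q) : (Q.bm N).sv p q i x ∈ Q.UU N p (q+1) := 
  (Q.rho_sv N p q i x).trans ((congrArg _ hx).trans Finsupp.mapDomain_zero)
noncomputable def um : BS (fun p q => Q.UU N p q) := (Q.bm N).sub (Q.UU N) (Q.u1 N) (Q.u2 N) (Q.u3 N) (Q.u4 N)

theorem tau (hQ : Q.Ac) (q : ℕ) : ∃ t : ∀ p, (AQV (Xa 0) K q →₀ N) →+ (AQV (Xa (p+1)) K q →₀ N), (∀ p x, Q.rho N p q (t p x) = x) ∧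
    ∀ p i, i ≤ p + 1 → ∀ x, (Q.bm N).dh p q i (t (p+1) x) = t p x := by
  obtain ⟨h, h0, h1⟩ := Q.contr hQ q
  let c : ∀ p, AQV (Xa 0) K q → AQV (Xa p) K q := ch h
  have c1 : ∀ p i, i ≤ p → ∀ x, gb K (Q.d p i) q (c (p+1) x) = c p x := by
    intro p
    induction p with
    | zero => intro i hi x
              obtain rfl : i = 0 := by omega
              exact h0 _ _
    | succ p ih =>
      intro i hi x
      rcases i with _ | i
      · exact h0 _ _
      · exact (h1 _ _ (by omega) _).trans (congrArg _ (ih i (by omega) x))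
  have c2 : ∀ p x, gb K (Q.e p) q (c p x) = x := by
    intro p
    induction p with
    | zero => intro x; exact gb_id _ (fun _ => rfl) _ _
    | succ p ih => intro x; rw [← gb_gb _ _ (Q.e (p+1)) (fun _ => rfl), c1 _ _ (by omega), ih]
  refine ⟨fun p => Finsupp.mapDomain.addMonoidHom (c (p+1)), fun p x => ?_, fun p i hi x => ?_⟩
  · change Finsupp.mapDomain _ (Finsupp.mapDomain _ x) = x
    rw [md_md, funext fun x => c2 _ x]; exact Finsupp.mapDomain_id
  · change Finsupp.mapDomain _ (Finsupp.mapDomain _ x) = Finsupp.mapDomain _ x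
    rw [md_md, funext fun x => c1 _ _ hi x]

omit [Module K N] in
theorem md_id {X Y : Type u} (f : X → Y) (g : Y → X) (h : ∀ x, g (f x) = x) (x : X →₀ N) : Finsupp.mapDomain g (Finsupp.mapDomain f x) = x := by
  rw [md_md, _root_.funext h]; exact Finsupp.mapDomain_id
omit [Module K N] in
theorem md_sq {X Y Y' Z : Type u} (f : X → Y) (g : Y → Z) (f' : X → Y') (g' : Y' → Z) (h : ∀ x, g (f x) = g' (f' x)) (x : X →₀ N) : 
    Finsupp.mapDomain g (Finsupp.mapDomain f x) = Finsupp.mapDomain g' (Finsupp.mapDomain f' x) := by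
  rw [md_md, md_md, _root_.funext h]
theorem row_ac (hQ : Q.Ac) (q : ℕ) : (Q.app (avF N K q)).Ac := by
  obtain ⟨h, h0, h1⟩ := Q.contr hQ q
  refine acycU_first _ _ (Finsupp.mapDomain.addMonoidHom (h 0)) (fun n => Finsupp.mapDomain.addMonoidHom (h (n+1))) (md_id N _ _ (h0 _)) (fun n => md_id N _ _ (h0 _)) 
    (md_sq N _ _ _ _ (h1 0 0 le_rfl)) (fun n i hi => md_sq N _ _ _ _ (h1 _ _ (by omega)))

theorem um_row (hQ : Q.Ac) : (Q.um N).RowEx := by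
  intro q
  obtain ⟨t, t1, t2⟩ := Q.tau N hQ q
  have e : ∀ n y, ((bdu (X := fun p => Q.UU N p q) (fun p i => (Q.um N).dh p q i) n y : Q.UU N n q) : AQV (Xa (n+1)) K q →₀ N) = 
      bdu (X := fun p => AQV (Xa (p+1)) K q →₀ N) (fun p i => (Q.bm N).dh p q i) n (y : AQV (Xa (n+2)) K q →₀ N) := fun n y =>
    bdu_map (X := fun p => Q.UU N p q) (Y := fun p => AQV (Xa (p+1)) K q →₀ N) (fun p i => (Q.um N).dh p q i) (fun p i => (Q.bm N).dh p q i) n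
      (Q.UU N n q).subtype (Q.UU N (n+1) q).subtype (fun i hi x => resM_coe (Q.u1 N _ _ _ hi) x) y
  have key : ∀ n (x : Q.UU N n q) (y : AQV (Xa (n+2)) K q →₀ N), bdu (X := fun p => AQV (Xa (p+1)) K q →₀ N) (fun p i => (Q.bm N).dh p q i) n y = x → 
     ∃ y, bdu (X := fun p => Q.UU N p q) (fun p i => (Q.um N).dh p q i) n y = x := by
    intro n x y hy
    refine ⟨⟨y - t (n+1) (Q.rho N (n+1) q y), ?_⟩, Subtype.ext ?_⟩
    · change Q.rho N _ _ _ = 0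
      rw [map_sub, t1, sub_self]
    · rw [e]
      simp only
      rw [map_sub, hy]
      have := bdu_map (X := fun p => AQV (Xa (p+1)) K q →₀ N) (Y := fun p => AQV (Xa (p+1)) K q →₀ N) (fun p i => (Q.bm N).dh p q i) (fun p i => (Q.bm N).dh p q i) n
        ((t n).comp (Q.rho N n q)) ((t (n+1)).comp (Q.rho N (n+1) q)) (fun i hi x => by
          simp only [AddMonoidHom.comp_apply]
          rw [Q.rho_dh N _ _ _ hi, t2 _ _ hi]) y
      rw [hy] at this
      have h2 : Q.rho N n q x = 0 := x.2
      simp only [AddMonoidHom.comp_apply, h2, map_zero] at this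
      rw [← this, sub_zero]
  have hr := Q.row_ac N hQ q
  refine ⟨fun x => ?_, fun n x hx => ?_⟩
  · obtain ⟨y, hy⟩ := hr.2.1 x.1 x.2
    exact key 0 x y hy
  · obtain ⟨y, hy⟩ := hr.2.2 n x.1 ((e n x).symm.trans (by rw [hx]; rfl))
    exact key _ x y hy

/-- exactness of the diagonal -/
def DEx (n : ℕ) : Prop := ∀ x, bdu (X := fun n => AQV (Xa (n+1)) K n →₀ N) (Q.bm N).dg n x = 0 → 
  ∃ y, bdu (X := fun n => AQV (Xa (n+1)) K n →₀ N) (Q.bm N).dg (n+1) y = x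

theorem lift (hQ : Q.Ac) (n : ℕ) (hD : Q.DEx N n) : ExAQ (Xa 0) K N n := by
  intro z hz
  simp only [AQdiff_eq] at hz ⊢
  have hr : ∀ n x, Q.rho N n n (bdu (X := fun n => AQV (Xa (n+1)) K n →₀ N) (Q.bm N).dg n x) = bdu (X := AX (Xa 0) K N) (aqd N) n (Q.rho N (n+1) (n+1) x) := fun n =>
    bdu_map (X := fun n => AQV (Xa (n+1)) K n →₀ N) (Y := AX (Xa 0) K N) (Q.bm N).dg (aqd N) n (Q.rho N n n) (Q.rho N (n+1) (n+1)) (fun i hi x => by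
      rw [BS.dg_apply, Q.rho_dh N _ _ _ hi, Q.rho_dv])
  have ek : ∀ n y, ((bdu (X := fun n => Q.UU N n n) (Q.um N).dg n y : Q.UU N n n) : AQV (Xa (n+1)) K n →₀ N) = 
      bdu (X := fun n => AQV (Xa (n+1)) K n →₀ N) (Q.bm N).dg n (y : AQV (Xa (n+2)) K (n+1) →₀ N) := fun n =>
      bdu_map (X := fun n => Q.UU N n n) (Y := fun n => AQV (Xa (n+1)) K n →₀ N) (Q.um N).dg (Q.bm N).dg n (Q.UU N n n).subtype (Q.UU N (n+1) (n+1)).subtype (fun i hi x => by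
        rw [BS.dg_apply, BS.dg_apply]
        exact (resM_coe (Q.u1 N _ _ _ hi) _).trans (congrArg _ (resM_coe (Q.u3 N _ _ _ hi) x)))
  obtain ⟨t, t1, t2⟩ := Q.tau N hQ (n+1)
  set w := t (n+1) z with hw
  obtain ⟨k, hk⟩ := (Q.um N).diag (Q.um_row N hQ) n ⟨bdu (X := fun n => AQV (Xa (n+1)) K n →₀ N) (Q.bm N).dg n w, by
      change Q.rho N _ _ _ = 0
      rw [hr, hw, t1, hz]⟩ (by
      rcases n with _ | n
      · trivial
      · apply Subtype.ext
        rw [ek]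
        exact bdu_bdu (X := fun n => AQV (Xa (n+1)) K n →₀ N) (Q.bm N).dg (Q.bm N).dg_dg n w)
  have hk2 := congrArg Subtype.val hk
  rw [ek] at hk2
  obtain ⟨y, hy⟩ := hD (w - k) (by rw [map_sub, hk2, sub_self])
  refine ⟨Q.rho N _ _ y, ?_⟩
  rw [← hr, hy, map_sub, hw, t1, (show Q.rho N (n+1) (n+1) k = 0 from k.2), sub_zero]
end SR
end AQ

namespace AQ
open MvPolynomial
/-- vanishing -/
def Van (A S : Type u) [CommRing A] [CommRing S] [Algebra A S] (k : ℕ) : Prop :=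
  ∀ (N : Type u) [AddCommGroup N] [Module S N] (n : ℕ), k ≤ n → ExAQ A S N n

theorem acycU_iso {S : Type u} {X X' : ℕ → Type u} [AddCommGroup S] [∀ n, AddCommGroup (X n)] [∀ n, AddCommGroup (X' n)] (ε : X 0 →+ S) (d : ∀ n, ℕ → X (n+1) →+ X n)
   (ε' : X' 0 →+ S) (d' : ∀ n, ℕ → X' (n+1) →+ X' n) (e : ∀ n, X n ≃+ X' n) (he : ∀ x, ε' (e 0 x) = ε x) (hd : ∀ n i, i ≤ n + 1 → ∀ x, e n (d n i x) = d' n i (e (n+1) x))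
   (h : AcycU ε' d') : AcycU ε d := by
  have hb : ∀ n x, e n (bdu d n x) = bdu d' n (e (n+1) x) := fun n => bdu_map d d' n (e n).toAddMonoidHom (e (n+1)).toAddMonoidHom (hd n)
  refine ⟨fun y => ?_, fun x hx => ?_, fun n x hx => ?_⟩
  · obtain ⟨x, hx⟩ := h.1 y
    exact ⟨(e 0).symm x, by rw [← he, AddEquiv.apply_symm_apply, hx]⟩
  · obtain ⟨y, hy⟩ := h.2.1 (e 0 x) (by rw [he, hx])
    exact ⟨(e 1).symm y, (e 0).injective (by rw [hb, AddEquiv.apply_symm_apply, hy])⟩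
  · obtain ⟨y, hy⟩ := h.2.2 n (e _ x) (by rw [← hb, hx, map_zero])
    exact ⟨(e _).symm y, (e _).injective (by rw [hb, AddEquiv.apply_symm_apply, hy])⟩

/-- rings of the augmented standard resolution -/
def XB (A B : Type u) [CommRing A] : ℕ → Type u
  | 0 => B
  | n+1 => PX A B n
noncomputable instance (A B : Type u) [CommRing A] [i : CommRing B] : ∀ n, CommRing (XB A B n)
  | 0 => i
  | n+1 => inferInstanceAs (CommRing (PX A B n))
noncomputable instance (A B K : Type u) [CommRing A] [CommRing B] [Algebra A B] [CommRing K] [i : Algebra B K] : ∀ n, Algebra (XB A B n) K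
  | 0 => i
  | n+1 => ((algebraMap B K).comp (ag A B n).toRingHom).toAlgebra

section
variable (A B K : Type u) [CommRing A] [CommRing B] [Algebra A B] [CommRing K] [Algebra B K]
/-- augmented standard resolution -/
noncomputable def QB : SR K (XB A B) where
  d n i := match n with
    | 0 => (ag A B 0).toRingHom
    | n+1 => (fc A B n i).toRingHom
  s n i := (sg A B n i).toRingHom
  dd n i j h1 h2 x := by
    rcases n with _ | n
    · exact (ag_fc A B 0 (j+1) x).trans (ag_fc A B 0 i x).symm
    · exact fc_fc _ _ _ _ _ h1 _
  ds1 n i j h1 h2 x := AQ.ds1 _ _ _ _ _ h1 h2 _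
  ds2 n j h x := AQ.ds2 _ _ _ _ h _
  ds2' n j h x := AQ.ds2' _ _ _ _ h _
  ds3 n i j h1 h2 x := AQ.ds3 _ _ _ _ _ h1 h2 _
  hd n i x := by
    rcases n with _ | n
    · rfl
    · exact congrArg (algebraMap B K) (ag_fc A B n i x)
  hs n i x := congrArg (algebraMap B K) (ag_sg A B n i x)

theorem QB_ac : (QB A B K).Ac := std_ac A B

/-- new variables -/
abbrev YW (n : ℕ) : Type u := AQV (XB A B (n+1)) K n
/-- flattening -/
noncomputable def ph (n : ℕ) : MvPolynomial (YW A B K n ⊕ AQV A B n) A ≃ₐ[A] MvPolynomial (YW A B K n) (MvPolynomial (AQV A B n) A) := sumAlgEquiv A _ _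
variable [Algebra A K] [IsScalarTower A B K]
noncomputable def Dd (n i : ℕ) : MvPolynomial (YW A B K (n+1)) (MvPolynomial (AQV A B (n+1)) A) →ₐ[A] MvPolynomial (YW A B K n) (MvPolynomial (AQV A B n) A) where
  toRingHom := (G K ((QB A B K).d (n+1) i) n).comp (fc (XB A B (n+2)) K n i).toRingHom
  commutes' a := by
    change G K ((QB A B K).d (n+1) i) n (fc (XB A B (n+2)) K n i (C (C a : MvPolynomial (AQV A B (n+1)) A))) = C (C a)
    have e1 : fc (XB A B (n+2)) K n i (C (C a : MvPolynomial (AQV A B (n+1)) A)) = C (C a : MvPolynomial (AQV A B (n+1)) A) := (fc (XB A B (n+2)) K n i).commutes _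
    exact (congrArg _ e1).trans ((G_C _ n _).trans (congrArg C ((fc A B n i).commutes a)))
noncomputable def Ds (n i : ℕ) : MvPolynomial (YW A B K n) (MvPolynomial (AQV A B n) A) →ₐ[A] MvPolynomial (YW A B K (n+1)) (MvPolynomial (AQV A B (n+1)) A) where
  toRingHom := (G K ((QB A B K).s n i) (n+1)).comp (sg (XB A B (n+1)) K n i).toRingHom
  commutes' a := by
    change G K ((QB A B K).s n i) (n+1) (sg (XB A B (n+1)) K n i (C (C a : MvPolynomial (AQV A B n) A))) = C (C a)
    have e1 : sg (XB A B (n+1)) K n i (C (C a : MvPolynomial (AQV A B n) A)) = C (C a : MvPolynomial (AQV A B n) A) := (sg (XB A B (n+1)) K n i).commutes _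
    exact (congrArg _ e1).trans ((G_C _ (n+1) _).trans (congrArg C ((sg A B n i).commutes a)))
noncomputable def De : MvPolynomial (YW A B K 0) (MvPolynomial (AQV A B 0) A) →ₐ[A] K where
  toRingHom := (ag (XB A B 1) K 0).toRingHom
  commutes' a := by
    change ag (XB A B 1) K 0 (C (C a : MvPolynomial (AQV A B 0) A)) = _
    refine ((ag (XB A B 1) K 0).commutes _).trans ?_
    refine (congrArg (algebraMap B K) ((ag A B 0).commutes a)).trans ?_
    exact (IsScalarTower.algebraMap_apply A B K a).symm

/-- composite resolution -/
noncomputable def Y : PR A K where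
  V n := YW A B K n ⊕ AQV A B n
  d n i := ((ph A B K n).symm.toAlgHom.comp (Dd A B K n i)).comp (ph A B K (n+1)).toAlgHom
  s n i := ((ph A B K (n+1)).symm.toAlgHom.comp (Ds A B K n i)).comp (ph A B K n).toAlgHom
  ε := (De A B K).comp (ph A B K 0).toAlgHom
  dd n i j h1 h2 x := by
    change (ph A B K n).symm (Dd A B K _ _ (ph A B K (n+1) ((ph A B K (n+1)).symm _))) = (ph A B K n).symm (Dd A B K _ _ (ph A B K (n+1) ((ph A B K (n+1)).symm _)))
    rw [AlgEquiv.apply_symm_apply, AlgEquiv.apply_symm_apply]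
    exact congrArg _ ((QB A B K).diag.dd n i j h1 h2 _)
  de x := by
    change De A B K (ph A B K 0 ((ph A B K 0).symm _)) = De A B K (ph A B K 0 ((ph A B K 0).symm _))
    rw [AlgEquiv.apply_symm_apply, AlgEquiv.apply_symm_apply]
    exact (QB A B K).diag.de _
  ds1 n i j h1 h2 x := by
    change (ph A B K _).symm (Dd A B K _ _ (ph A B K _ ((ph A B K _).symm _))) = (ph A B K _).symm (Ds A B K _ _ (ph A B K _ ((ph A B K _).symm _)))
    rw [AlgEquiv.apply_symm_apply, AlgEquiv.apply_symm_apply]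
    exact congrArg _ ((QB A B K).diag.ds1 n i j h1 h2 _)
  ds2 n j h x := by
    change (ph A B K _).symm (Dd A B K _ _ (ph A B K _ ((ph A B K _).symm _))) = x
    rw [AlgEquiv.apply_symm_apply]
    exact (congrArg _ ((QB A B K).diag.ds2 n j h _)).trans (AlgEquiv.symm_apply_apply _ _)
  ds2' n j h x := by
    change (ph A B K _).symm (Dd A B K _ _ (ph A B K _ ((ph A B K _).symm _))) = x
    rw [AlgEquiv.apply_symm_apply]
    exact (congrArg _ ((QB A B K).diag.ds2' n j h _)).trans (AlgEquiv.symm_apply_apply _ _)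
  ds3 n i j h1 h2 x := by
    change (ph A B K _).symm (Dd A B K _ _ (ph A B K _ ((ph A B K _).symm _))) = (ph A B K _).symm (Ds A B K _ _ (ph A B K _ ((ph A B K _).symm _)))
    rw [AlgEquiv.apply_symm_apply, AlgEquiv.apply_symm_apply]
    exact congrArg _ ((QB A B K).diag.ds3 n i j h1 h2 _)

theorem ph_d (n i : ℕ) (x) : ph A B K n ((Y A B K).d n i x) = Dd A B K n i (ph A B K (n+1) x) := AlgEquiv.apply_symm_apply _ _

theorem Y_ac : (Y A B K).Ac := acycU_iso (X := (Y A B K).X) (X' := fun n => PX (XB A B (n+1)) K n) _ _ (QB A B K).diag.ε (QB A B K).diag.d (fun n => (ph A B K n).toRingEquiv.toAddEquiv) 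
  (fun x => rfl) (fun n i hi x => ph_d A B K n i x) (QB A B K).diag_ac

/-- the augmentation as a map over the intermediate ring -/
noncomputable def agY (n : ℕ) : MvPolynomial (YW A B K n) (XB A B (n+1)) →ₐ[XB A B (n+1)] K := ag (XB A B (n+1)) K n

theorem Y_aug (n : ℕ) (f) : (Y A B K).aug n f = agY A B K n (ph A B K n f) := by
  induction n with
  | zero => rfl
  | succ n ih =>
    refine (ih _).trans ?_
    refine (congrArg (agY A B K n) (ph_d A B K n 0 f)).trans ?_
    refine (ag_G _ ((QB A B K).hd _ _) n _).trans (ag_fc _ K _ _ _)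

variable (N : Type u) [AddCommGroup N] [Module K N]

/-- projection -/
noncomputable def prj (W V : Type u) : (W ⊕ V →₀ N) →+ (W →₀ N) := Finsupp.comapDomain.addMonoidHom (Sum.inl_injective (α := W) (β := V))
omit [Module K N] in
theorem prj_inl (W V : Type u) (y : W →₀ N) : prj N W V (Finsupp.mapDomain Sum.inl y) = y := by
  ext w; exact Finsupp.mapDomain_apply Sum.inl_injective _ _
omit [Module K N] in
theorem prj_inr (W V : Type u) (y : V →₀ N) : prj N W V (Finsupp.mapDomain Sum.inr y) = 0 := by
  ext w; exact Finsupp.mapDomain_of_notMem_range _ _ (by simp)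
omit [Module K N] in
theorem prj_ex (W V : Type u) (x : W ⊕ V →₀ N) (h : prj N W V x = 0) : ∃ y, Finsupp.mapDomain Sum.inr y = x := by
  refine ⟨Finsupp.comapDomain Sum.inr x Sum.inr_injective.injOn, ?_⟩
  ext w
  rcases w with w | v
  · rw [Finsupp.mapDomain_of_notMem_range _ _ (by simp)]
    exact (DFunLike.congr_fun h w).symm
  · rw [Finsupp.mapDomain_apply Sum.inr_injective]; rfl
theorem prj_smul (W V : Type u) (k : K) (x : W ⊕ V →₀ N) : prj N W V (k • x) = k • prj N W V x := by ext w; rfl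

/-- augmentation, explicit type -/
noncomputable def Yau (n : ℕ) : MvPolynomial (YW A B K n ⊕ AQV A B n) A →ₐ[A] K := (Y A B K).aug n
/-- faces, explicit type -/
noncomputable def Yd (n i : ℕ) : MvPolynomial (YW A B K (n+1) ⊕ AQV A B (n+1)) A →ₐ[A] MvPolynomial (YW A B K n ⊕ AQV A B n) A := (Y A B K).d n i
/-- induced faces, explicit type -/
noncomputable def Yjd (n i : ℕ) : (YW A B K (n+1) ⊕ AQV A B (n+1) →₀ N) →+ (YW A B K n ⊕ AQV A B n →₀ N) := (J N (Yau A B K n) (Yd A B K n i)).toAddMonoidHom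
theorem Yau_ph (n : ℕ) (f) : Yau A B K n f = agY A B K n (ph A B K n f) := Y_aug A B K n f
theorem Yd_ph (n i : ℕ) (x) : ph A B K n (Yd A B K n i x) = Dd A B K n i (ph A B K (n+1) x) := ph_d A B K n i x

theorem prj_jac (n : ℕ) (f) (m : N) : prj N _ _ (jac N (Yau A B K n) f m) = jac N (agY A B K n) (ph A B K n f) m := by
  induction f using MvPolynomial.induction_on with
  | C r => 
    rw [jac_C, map_zero]
    rw [show ph A B K n (C r) = C (C r) from sumAlgEquiv_C_inl ..]
    exact (jac_C _ _ _).symm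
  | add p q hp hq => rw [jac_add, map_add, hp, hq, map_add]; exact (jac_add _ _ _ _).symm
  | mul_X p v hp => 
    rw [jac_mul, map_add, prj_smul, prj_smul, hp, map_mul]
    refine Eq.trans ?_ (jac_mul _ _ _ _).symm
    rw [Yau_ph, Yau_ph, jac_X]
    have : prj N _ _ (Finsupp.single v m) = jac N (agY A B K n) (ph A B K n (X v)) m := by
      rcases v with w | v
      · rw [show ph A B K n (X (Sum.inl w)) = X w from sumAlgEquiv_X_inl ..]
        refine Eq.trans ?_ (jac_X _ _ _).symm
        rw [← Finsupp.mapDomain_single, prj_inl]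
      · rw [show ph A B K n (X (Sum.inr v)) = C (X v) from sumAlgEquiv_X_inr ..]
        refine Eq.trans ?_ (jac_C _ _ _).symm
        rw [← Finsupp.mapDomain_single, prj_inr]
    rw [this]

theorem prj_jd (n i : ℕ) (x) : prj N _ _ (Yjd A B K N n i x) = ((QB A B K).bm N).dg n i (prj N _ _ x) := by
  induction x using Finsupp.induction_linear with
  | zero => simp
  | add x y hx hy => rw [map_add, map_add, hx, hy, map_add]; exact (map_add (((QB A B K).bm N).dg n i) _ _).symm
  | single v m =>
    refine (congrArg (prj N _ _) (J_single _ _ v m)).trans ?_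
    rw [prj_jac, Yd_ph]
    rcases v with w | v
    · rw [show ph A B K (n+1) (X (Sum.inl w)) = X w from sumAlgEquiv_X_inl .., ← Finsupp.mapDomain_single, prj_inl]
      refine (jac_base (G K ((QB A B K).d (n+1) i) n) _ (gb K ((QB A B K).d (n+1) i) n) (fun v => G_X _ n v) (fun r => G_C _ n r) (ag _ K n) (ag _ K n) (fun p => ag_G _ ((QB A B K).hd _ _) n p) _ _).symm.trans ?_
      exact congrArg (Finsupp.mapDomain _) (J_single _ _ w m).symm
    · rw [show ph A B K (n+1) (X (Sum.inr v)) = C (X v) from sumAlgEquiv_X_inr .., ← Finsupp.mapDomain_single, prj_inr]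
      refine Eq.trans ?_ (map_zero (((QB A B K).bm N).dg n i)).symm
      have : Dd A B K n i (C (X v)) = C (fc A B n i (X v)) := by
        change G K ((QB A B K).d (n+1) i) n (fc (XB A B (n+2)) K n i (C (X v : MvPolynomial (AQV A B (n+1)) A))) = _
        have e1 : fc (XB A B (n+2)) K n i (C (X v : MvPolynomial (AQV A B (n+1)) A)) = C (X v : MvPolynomial (AQV A B (n+1)) A) := (fc (XB A B (n+2)) K n i).commutes _
        exact (congrArg _ e1).trans (G_C _ n _)
      rw [this]
      exact jac_C _ _ _

theorem jac_up {A S S' W W' N : Type*} [CommRing A] [CommRing S] [CommRing S'] [Algebra A S] [Algebra A S'] [Algebra S S'] [AddCommGroup N] [Module S N] [Module S' N] [IsScalarTower S S' N]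
   (γ : W → W') (a : MvPolynomial W A →ₐ[A] S) (b : MvPolynomial W' A →ₐ[A] S') (hab : ∀ p, b (rename γ p) = algebraMap S S' (a p)) (p) (n : N) :
   Finsupp.mapDomain γ (jac N a p n) = jac N b (rename γ p) n := by
  induction p using MvPolynomial.induction_on with
  | C r => rw [jac_C, rename_C, jac_C, Finsupp.mapDomain_zero]
  | add p q hp hq => rw [jac_add, Finsupp.mapDomain_add, hp, hq, map_add, jac_add]
  | mul_X p v hp => 
    rw [jac_mul, Finsupp.mapDomain_add, Finsupp.mapDomain_smul, Finsupp.mapDomain_smul, hp, map_mul, jac_mul, hab, hab, rename_X, jac_X, jac_X, Finsupp.mapDomain_single,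
      algebraMap_smul, algebraMap_smul]

/-- complex, explicit type -/
abbrev YL (n : ℕ) : Type u := YW A B K n ⊕ AQV A B n →₀ N

theorem inr_jd [Module B N] [IsScalarTower B K N] (n i : ℕ) (x) : Finsupp.mapDomain Sum.inr (aqd (A := A) (S := B) N n i x) = Yjd A B K N n i (Finsupp.mapDomain Sum.inr x) := by
  have hr : ∀ n p, ph A B K n (rename Sum.inr p) = C p := fun n p => DFunLike.congr_fun (sumAlgEquiv_comp_rename_inr (R := A) (S₁ := YW A B K n) (S₂ := AQV A B n)) p
  have hab : ∀ n p, Yau A B K n (rename Sum.inr p) = algebraMap B K (ag A B n p) := by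
    intro n p
    rw [Yau_ph, hr]
    exact (agY A B K n).commutes p
  have hd : ∀ n i p, Yd A B K n i (rename Sum.inr p) = rename Sum.inr (fc A B n i p) := by
    intro n i p
    apply (ph A B K n).injective
    rw [Yd_ph, hr, hr]
    change G K ((QB A B K).d (n+1) i) n (fc (XB A B (n+2)) K n i (C (p : MvPolynomial (AQV A B (n+1)) A))) = _
    have e1 : fc (XB A B (n+2)) K n i (C (p : MvPolynomial (AQV A B (n+1)) A)) = C (p : MvPolynomial (AQV A B (n+1)) A) := (fc (XB A B (n+2)) K n i).commutes _
    exact (congrArg _ e1).trans (G_C _ n _)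
  induction x using Finsupp.induction_linear with
  | zero => simp
  | add x y hx hy => rw [map_add, Finsupp.mapDomain_add, hx, hy, Finsupp.mapDomain_add, map_add]
  | single v m =>
    rw [Finsupp.mapDomain_single]
    refine (congrArg (Finsupp.mapDomain _) (J_single _ _ v m)).trans ?_
    refine Eq.trans ?_ (J_single _ _ _ m).symm
    rw [← rename_X, hd]
    exact jac_up _ _ _ (hab n) _ _

theorem PR.jd_dd {A K : Type u} [CommRing A] [CommRing K] [Algebra A K] (P : PR A K) (N : Type u) [AddCommGroup N] [Module K N] (n : ℕ) (x) :
    bdu (X := P.L N) (P.jd N) n (bdu (X := P.L N) (P.jd N) (n+1) x) = 0 := by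
  refine bdu_bdu (X := P.L N) _ (fun n i j h1 h2 x => ?_) n x
  change J N _ _ (J N _ _ x) = J N _ _ (J N _ _ x)
  rw [J_J _ _ _ _ (P.aug_d n _ (by omega)), J_J _ _ _ _ (P.aug_d n _ (by omega))]
  exact J_congr _ _ _ (fun v => P.dd n i j h1 h2 _) x

theorem JZ (k : ℕ) (h1 : Van A B k) (h2 : Van A K (k+1)) : Van B K (k+1) := by
  intro N _ _ n hn
  obtain ⟨m, rfl⟩ : ∃ m, n = m + 1 := ⟨n - 1, by omega⟩
  refine (QB A B K).lift N (QB_ac A B K) (m+1) ?_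
  letI : Module B N := Module.compHom N (algebraMap B K)
  haveI : IsScalarTower B K N := IsScalarTower.of_algebraMap_smul fun _ _ => rfl
  have hA := h1 N m (by omega)
  have hY : ∀ x, bdu (X := YL A B K N) (Yjd A B K N) (m+1) x = 0 → ∃ y, bdu (X := YL A B K N) (Yjd A B K N) (m+2) y = x := (comparison N (Y A B K) (Y_ac A B K) (m+1)).2 (h2 N (m+1) hn)
  simp only [ExAQ, AQdiff_eq] at hA
  have b1 : ∀ n x, prj N _ _ (bdu (X := YL A B K N) (Yjd A B K N) n x) = bdu (X := fun n => AQV (XB A B (n+1)) K n →₀ N) ((QB A B K).bm N).dg n (prj N _ _ x) := fun n =>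
    bdu_map (X := YL A B K N) (Y := fun n => AQV (XB A B (n+1)) K n →₀ N) _ _ n (prj N _ _) (prj N _ _) (fun i hi x => prj_jd A B K N n i x)
  have b2 : ∀ n x, Finsupp.mapDomain Sum.inr (bdu (X := AX A B N) (aqd N) n x) = bdu (X := YL A B K N) (Yjd A B K N) n (Finsupp.mapDomain Sum.inr x) := fun n =>
    bdu_map (X := AX A B N) (Y := YL A B K N) _ _ n (Finsupp.mapDomain.addMonoidHom Sum.inr) (Finsupp.mapDomain.addMonoidHom Sum.inr) (fun i hi x => inr_jd A B K N n i x)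
  have dd : ∀ n x, bdu (X := YL A B K N) (Yjd A B K N) n (bdu (X := YL A B K N) (Yjd A B K N) (n+1) x) = 0 := by
    exact (Y A B K).jd_dd N
  intro x hx
  obtain ⟨v, hv⟩ := prj_ex N _ _ (bdu (X := YL A B K N) (Yjd A B K N) (m+1) (Finsupp.mapDomain Sum.inl x)) (by rw [b1, prj_inl, hx])
  obtain ⟨v', hv'⟩ := hA v (by
    apply Finsupp.mapDomain_injective (Sum.inr_injective (α := YW A B K m))
    rw [b2, hv, dd, Finsupp.mapDomain_zero])
  obtain ⟨y, hy⟩ := hY (Finsupp.mapDomain Sum.inl x - Finsupp.mapDomain Sum.inr v') (by rw [map_sub, ← b2, hv', hv, sub_self])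
  refine ⟨prj N _ _ y, ?_⟩
  rw [← b1, hy, map_sub, prj_inl, prj_inr, sub_zero]
end
end AQ

namespace AQ
open MvPolynomial
section
variable {A A' S S' : Type u} [CommRing A] [CommRing A'] [CommRing S] [CommRing S'] [Algebra A S] [Algebra A' S'] (π : A →+* A') (σ : S →+* S')

/-- base change of a map of polynomial algebras -/
noncomputable def bcm {W W' : Type u} (φ : MvPolynomial W A →ₐ[A] MvPolynomial W' A) : MvPolynomial W A' →ₐ[A'] MvPolynomial W' A' :=
  aeval (fun v => MvPolynomial.map π (φ (X v)))
theorem bcm_map {W W' : Type u} (φ : MvPolynomial W A →ₐ[A] MvPolynomial W' A) (x) : bcm π φ (MvPolynomial.map π x) = MvPolynomial.map π (φ x) := by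
  induction x using MvPolynomial.induction_on with
  | C r => 
    rw [map_C, show φ (C r) = C r from φ.commutes r, map_C]
    exact (bcm π φ).commutes _
  | add p q hp hq => simp only [map_add, hp, hq]
  | mul_X p v hp => 
    rw [map_mul, map_mul, hp, map_mul, map_mul, map_X]
    congr 1
    exact aeval_X _ _

theorem bc_ext {W T : Type u} [CommRing T] [Algebra A' T] (F G : MvPolynomial W A' →ₐ[A'] T) (h : ∀ x, F (MvPolynomial.map π x) = G (MvPolynomial.map π x)) (x) : F x = G x := by
  have : F = G := algHom_ext (fun v => by have := h (X v); rwa [map_X] at this)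
  rw [this]

variable (hc : ∀ a, σ (algebraMap A S a) = algebraMap A' S' (π a))
/-- base change of augmentations -/
noncomputable def bce {W : Type u} (φ : MvPolynomial W A →ₐ[A] S) : MvPolynomial W A' →ₐ[A'] S' :=
  aeval (fun v => σ (φ (X v)))
include hc in
theorem bce_map {W : Type u} (φ : MvPolynomial W A →ₐ[A] S) (x) : bce σ φ (MvPolynomial.map π x) = σ (φ x) := by
  induction x using MvPolynomial.induction_on with
  | C r => 
    rw [map_C, show φ (C r) = algebraMap A S r from φ.commutes r, hc]
    exact (bce σ φ).commutes _
  | add p q hp hq => simp only [map_add, hp, hq]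
  | mul_X p v hp => 
    rw [map_mul, map_mul, hp, map_mul, map_mul, map_X]
    congr 1
    exact aeval_X _ _

/-- base change -/
noncomputable def PR.bc (P : PR A S) : PR A' S' where
  V := P.V
  d n i := bcm π (P.d n i)
  s n i := bcm π (P.s n i)
  ε := bce σ P.ε
  dd n i j h1 h2 x := bc_ext π ((bcm π _).comp (bcm π _)) ((bcm π _).comp (bcm π _)) (fun y => by
    simp only [AlgHom.comp_apply, bcm_map, P.dd n i j h1 h2]) x
  de x := bc_ext π ((bce σ _).comp (bcm π _)) ((bce σ _).comp (bcm π _)) (fun y => by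
    simp only [AlgHom.comp_apply, bcm_map, bce_map π σ hc, P.de]) x
  ds1 n i j h1 h2 x := bc_ext π ((bcm π _).comp (bcm π _)) ((bcm π _).comp (bcm π _)) (fun y => by
    simp only [AlgHom.comp_apply, bcm_map, P.ds1 n i j h1 h2]) x
  ds2 n j h x := bc_ext π ((bcm π _).comp (bcm π _)) (AlgHom.id A' _) (fun y => by
    simp only [AlgHom.comp_apply, bcm_map, P.ds2 n j h, AlgHom.id_apply]) x
  ds2' n j h x := bc_ext π ((bcm π _).comp (bcm π _)) (AlgHom.id A' _) (fun y => by
    simp only [AlgHom.comp_apply, bcm_map, P.ds2' n j h, AlgHom.id_apply]) x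
  ds3 n i j h1 h2 x := bc_ext π ((bcm π _).comp (bcm π _)) ((bcm π _).comp (bcm π _)) (fun y => by
    simp only [AlgHom.comp_apply, bcm_map, P.ds3 n i j h1 h2]) x

theorem PR.bc_aug (P : PR A S) (n) (x) : (P.bc π σ hc).aug n (MvPolynomial.map π x) = σ (P.aug n x) := by
  induction n with
  | zero => exact bce_map π σ hc _ x
  | succ n ih =>
    refine Eq.trans ?_ (ih _)
    exact congrArg _ (bcm_map π _ x)

theorem jac_bc {W : Type u} {N : Type u} [AddCommGroup N] [Module S N] [Module S' N] (hN : ∀ (s : S) (n : N), σ s • n = s • n)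
   (a : MvPolynomial W A →ₐ[A] S) (b : MvPolynomial W A' →ₐ[A'] S') (hab : ∀ p, b (MvPolynomial.map π p) = σ (a p)) (p) (n : N) :
   jac N b (MvPolynomial.map π p) n = jac N a p n := by
  ext w
  rw [jac_apply, jac_apply, ← hN, ← hab]
  congr 2
  exact (pderiv_map)

theorem PR.bc_jd (P : PR A S) {N : Type u} [AddCommGroup N] [Module S N] [Module S' N] (hN : ∀ (s : S) (n : N), σ s • n = s • n) (n i : ℕ) (x : P.V (n+1) →₀ N) :
   (P.bc π σ hc).jd N n i x = P.jd N n i x := by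
  induction x using Finsupp.induction_linear with
  | zero => exact (map_zero ((P.bc π σ hc).jd N n i)).trans (map_zero (P.jd N n i)).symm
  | add x y hx hy => exact (map_add ((P.bc π σ hc).jd N n i) x y).trans ((congrArg₂ (· + ·) hx hy).trans (map_add (P.jd N n i) x y).symm)
  | single v m =>
    refine (J_single _ _ v m).trans (Eq.trans ?_ (J_single _ _ v m).symm)
    refine (congrArg (fun q => jac N ((P.bc π σ hc).aug n) q m) ?_).trans (jac_bc π σ hN (P.aug n) ((P.bc π σ hc).aug n) (P.bc_aug π σ hc n) _ m)
    exact aeval_X _ _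

theorem PR.bc_ExJ (P : PR A S) {N : Type u} [AddCommGroup N] [Module S N] [Module S' N] (hN : ∀ (s : S) (n : N), σ s • n = s • n) (n : ℕ) (h : P.ExJ N n) :
   (P.bc π σ hc).ExJ N n := by
  have e : ∀ n x, bdu (X := (P.bc π σ hc).L N) ((P.bc π σ hc).jd N) n x = bdu (X := P.L N) (P.jd N) n x := fun n x => 
    bdu_congr (X := P.L N) _ _ n x (fun i _ => P.bc_jd π σ hc hN n i x)
  intro x hx
  obtain ⟨y, hy⟩ := h x ((e n x).symm.trans hx)
  exact ⟨y, (e (n+1) y).trans hy⟩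
end

theorem acycU_quot {S S' : Type u} {X X' : ℕ → Type u} [AddCommGroup S] [AddCommGroup S'] [∀ n, AddCommGroup (X n)] [∀ n, AddCommGroup (X' n)] (ε : X 0 →+ S) (d : ∀ n, ℕ → X (n+1) →+ X n)
   (ε' : X' 0 →+ S') (d' : ∀ n, ℕ → X' (n+1) →+ X' n) 
   (hdd : ∀ n x, bdu d n (bdu d (n+1) x) = 0) (hed : ∀ x, ε (bdu d 0 x) = 0)
   (m : ∀ n, X n →+ X' n) (μ : S →+ S') (hm : ∀ n, Function.Surjective (m n)) (hμ : Function.Surjective μ) 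
   (α : ∀ n, X n →+ X n) (αS : S →+ S) (hα : ∀ n x, α n x = 0 → x = 0) (hαS : ∀ x, αS x = 0 → x = 0)
   (kα : ∀ n x, m n (α n x) = 0) (km : ∀ n x, m n x = 0 → ∃ z, α n z = x) (kμ : ∀ x, μ x = 0 → ∃ z, αS z = x)
   (cα : ∀ n i, i ≤ n + 1 → ∀ x, α n (d n i x) = d n i (α (n+1) x)) (cαe : ∀ x, αS (ε x) = ε (α 0 x))
   (cm : ∀ n i, i ≤ n + 1 → ∀ x, m n (d n i x) = d' n i (m (n+1) x)) (cme : ∀ x, μ (ε x) = ε' (m 0 x))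
   (h : AcycU ε d) : AcycU ε' d' := by
  have cα' : ∀ n x, α n (bdu d n x) = bdu d n (α (n+1) x) := fun n => bdu_map d d n (α n) (α (n+1)) (cα n)
  have cm' : ∀ n x, m n (bdu d n x) = bdu d' n (m (n+1) x) := fun n => bdu_map d d' n (m n) (m (n+1)) (cm n)
  refine ⟨fun y => ?_, fun x hx => ?_, fun n x hx => ?_⟩
  · obtain ⟨s, rfl⟩ := hμ y
    obtain ⟨x, rfl⟩ := h.1 s
    exact ⟨m 0 x, (cme x).symm⟩
  · obtain ⟨x, rfl⟩ := hm 0 x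
    rw [← cme] at hx
    obtain ⟨z, hz⟩ := kμ _ hx
    obtain ⟨t, rfl⟩ := h.1 z
    obtain ⟨y, hy⟩ := h.2.1 (x - α 0 t) (by rw [map_sub, ← cαe, hz, sub_self])
    exact ⟨m 1 y, by rw [← cm', hy, map_sub, kα, sub_zero]⟩
  · obtain ⟨x, rfl⟩ := hm _ x
    rw [← cm'] at hx
    obtain ⟨z, hz⟩ := km _ _ hx
    have : ∃ w, bdu d n w = z := by
      rcases n with _ | n
      · exact h.2.1 z (hαS _ (by rw [cαe, hz, hed]))
      · exact h.2.2 n z (hα _ _ (by rw [cα', hz, hdd]))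
    obtain ⟨w, rfl⟩ := this
    obtain ⟨y, hy⟩ := h.2.2 n (x - α _ w) (by rw [map_sub, ← cα', hz, sub_self])
    exact ⟨m _ y, by rw [← cm', hy, map_sub, kα, sub_zero]⟩

theorem PR.bdd {A K : Type u} [CommRing A] [CommRing K] [Algebra A K] (P : PR A K) (n : ℕ) (x) :
    bdu (X := P.X) P.da n (bdu (X := P.X) P.da (n+1) x) = 0 := 
  bdu_bdu (X := P.X) _ (fun n i j h1 h2 x => P.dd n i j h1 h2 x) n x

/-- regular base change -/
theorem van_bc {A A' S S' : Type u} [CommRing A] [CommRing A'] [CommRing S] [CommRing S'] [Algebra A S] [Algebra A' S'] (π : A →+* A') (σ : S →+* S')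
   (hc : ∀ a, σ (algebraMap A S a) = algebraMap A' S' (π a)) (a : A) (hπ : Function.Surjective π) (hσ : Function.Surjective σ)
   (ha : ∀ x, a * x = 0 → x = 0) (haS : ∀ x, algebraMap A S a * x = 0 → x = 0) (kπ : RingHom.ker π = Ideal.span {a}) (kσ : RingHom.ker σ = Ideal.span {algebraMap A S a})
   (k : ℕ) (h : Van A S k) : Van A' S' k := by
  intro N _ _ n hn
  letI : Module S N := Module.compHom N σ
  have hP := std_ac A S
  rw [← comparison N ((std A S).bc π σ hc)]
  · exact PR.bc_ExJ π σ hc (std A S) (fun _ _ => rfl) n ((comparison N (std A S) hP n).2 (h N n hn))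
  · set P := std A S
    refine acycU_quot (X := P.X) (X' := (P.bc π σ hc).X) (P.ε : P.X 0 →+ S) P.da _ _ P.bdd (eps_bdu (X := P.X) _ _ P.de) (fun n => (MvPolynomial.map π : P.X n →+* _).toAddMonoidHom) σ.toAddMonoidHom 
      (fun n => map_surjective _ hπ) hσ (fun n => AddMonoidHom.mulLeft (C a)) (AddMonoidHom.mulLeft (algebraMap A S a)) ?_ haS ?_ ?_ ?_ ?_ ?_ ?_ ?_ hP
    · intro n x hx
      ext m
      refine ha _ ?_
      rw [← coeff_C_mul]
      exact congrArg (coeff m) hx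
    · intro n x
      change MvPolynomial.map π (C a * x) = 0
      rw [map_mul, map_C, show π a = 0 from (kπ ▸ Ideal.mem_span_singleton_self a : a ∈ RingHom.ker π), C_0, zero_mul]
    · intro n x hx
      have : x ∈ RingHom.ker (MvPolynomial.map π : P.X n →+* _) := hx
      rw [ker_map, kπ, Ideal.map_span, Set.image_singleton, Ideal.mem_span_singleton] at this
      obtain ⟨z, rfl⟩ := this
      exact ⟨z, rfl⟩
    · intro x hx
      have : x ∈ RingHom.ker σ := hx
      rw [kσ, Ideal.mem_span_singleton] at this
      obtain ⟨z, rfl⟩ := this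
      exact ⟨z, rfl⟩
    · intro n i _ x
      change C a * P.d n i x = P.d n i (C a * x)
      rw [map_mul]; congr 1
      exact ((P.d n i).commutes a).symm
    · intro x
      change _ * P.ε x = P.ε (C a * x)
      rw [map_mul]; congr 1
      exact (P.ε.commutes a).symm
    · exact fun n i _ x => (bcm_map π (P.d n i) x).symm
    · exact fun x => (bce_map π σ hc P.ε x).symm

/-- constant resolution -/
noncomputable def cst (A V : Type u) [CommRing A] : PR A (MvPolynomial V A) where
  V _ := V
  d _ _ := AlgHom.id A _
  s _ _ := AlgHom.id A _
  ε := AlgHom.id A _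
  dd _ _ _ _ _ _ := rfl
  de _ := rfl
  ds1 _ _ _ _ _ _ := rfl
  ds2 _ _ _ _ := rfl
  ds2' _ _ _ _ := rfl
  ds3 _ _ _ _ _ _ := rfl

theorem cst_bdu {X : Type u} [AddCommGroup X] (d : ∀ n : ℕ, ℕ → X →+ X) (hd : ∀ n i x, d n i x = x) : 
   ∀ n, (∀ x, bdu (X := fun _ => X) d (2*n) x = 0) ∧ (∀ x, bdu (X := fun _ => X) d (2*n+1) x = x) := by
  have key : ∀ n x, (∑ i ∈ Finset.range (2*n), ((-1 : ℤ)^i) • (x : X)) = 0 := by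
    intro n x
    induction n with
    | zero => simp
    | succ n ih => 
      rw [show 2*(n+1) = 2*n+1+1 by ring, Finset.sum_range_succ, Finset.sum_range_succ, ih, pow_succ]
      simp
  intro n
  refine ⟨fun x => ?_, fun x => ?_⟩
  · refine (bdu_apply (X := fun _ => X) d (2*n) x).trans ?_
    simp only [hd]
    exact key (n+1) x
  · refine (bdu_apply (X := fun _ => X) d (2*n+1) x).trans ?_
    simp only [hd]
    rw [Finset.sum_range_succ, show 2*n+1+1 = 2*(n+1) by ring, key, pow_mul]
    simp

theorem cst_ex {X : Type u} [AddCommGroup X] (d : ∀ n : ℕ, ℕ → X →+ X) (hd : ∀ n i x, d n i x = x) (n : ℕ) (x : X) (h : bdu (X := fun _ => X) d n x = 0) : ∃ y, bdu (X := fun _ => X) d (n+1) y = x := by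
  obtain ⟨m, rfl | rfl⟩ := Nat.even_or_odd' n
  · exact ⟨x, (cst_bdu d hd m).2 x⟩
  · exact ⟨0, (map_zero _).trans (h.symm.trans ((cst_bdu d hd m).2 x))⟩

theorem cst_ac (A V : Type u) [CommRing A] : (cst A V).Ac := by
  refine ⟨fun x => ⟨x, rfl⟩, fun x hx => ⟨0, (map_zero _).trans hx.symm⟩, ?_⟩
  exact cst_ex (X := MvPolynomial V A) _ (fun _ _ _ => rfl)

theorem van_poly (A V : Type u) [CommRing A] (k : ℕ) : Van A (MvPolynomial V A) k := by
  intro N _ _ n _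
  rw [← comparison N (cst A V) (cst_ac A V)]
  exact cst_ex (X := V →₀ N) _ (fun n i x => J_id _ _ (fun _ => rfl) x) n

end AQ

namespace AQ
open MvPolynomial

theorem acycU_bij {S S' : Type u} {X X' : ℕ → Type u} [AddCommGroup S] [AddCommGroup S'] [∀ n, AddCommGroup (X n)] [∀ n, AddCommGroup (X' n)] (ε : X 0 →+ S) (d : ∀ n, ℕ → X (n+1) →+ X n)
   (ε' : X' 0 →+ S') (d' : ∀ n, ℕ → X' (n+1) →+ X' n) 
   (m : ∀ n, X n →+ X' n) (μ : S →+ S') (hm : ∀ n, Function.Bijective (m n)) (hμ : Function.Bijective μ) 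
   (cm : ∀ n i, i ≤ n + 1 → ∀ x, m n (d n i x) = d' n i (m (n+1) x)) (cme : ∀ x, μ (ε x) = ε' (m 0 x))
   (h : AcycU ε d) : AcycU ε' d' := by
  have cm' : ∀ n x, m n (bdu d n x) = bdu d' n (m (n+1) x) := fun n => bdu_map d d' n (m n) (m (n+1)) (cm n)
  refine ⟨fun y => ?_, fun x hx => ?_, fun n x hx => ?_⟩
  · obtain ⟨s, rfl⟩ := hμ.2 y
    obtain ⟨x, rfl⟩ := h.1 s
    exact ⟨m 0 x, (cme x).symm⟩
  · obtain ⟨x, rfl⟩ := (hm 0).2 x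
    rw [← cme] at hx
    obtain ⟨y, hy⟩ := h.2.1 x (hμ.1 (by rw [hx, map_zero]))
    exact ⟨m 1 y, by rw [← cm', hy]⟩
  · obtain ⟨x, rfl⟩ := (hm _).2 x
    rw [← cm'] at hx
    obtain ⟨y, hy⟩ := h.2.2 n x ((hm n).1 (by rw [hx, map_zero]))
    exact ⟨m _ y, by rw [← cm', hy]⟩

theorem van_iso {A A' S S' : Type u} [CommRing A] [CommRing A'] [CommRing S] [CommRing S'] [Algebra A S] [Algebra A' S'] (π : A →+* A') (σ : S →+* S')
   (hc : ∀ a, σ (algebraMap A S a) = algebraMap A' S' (π a)) (hπ : Function.Bijective π) (hσ : Function.Bijective σ)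
   (k : ℕ) (h : Van A S k) : Van A' S' k := by
  intro N _ _ n hn
  letI : Module S N := Module.compHom N σ
  have hP := std_ac A S
  rw [← comparison N ((std A S).bc π σ hc)]
  · exact PR.bc_ExJ π σ hc (std A S) (fun _ _ => rfl) n ((comparison N (std A S) hP n).2 (h N n hn))
  · set P := std A S
    refine acycU_bij (X := P.X) (X' := (P.bc π σ hc).X) (P.ε : P.X 0 →+ S) P.da _ _ (fun n => (MvPolynomial.map π : P.X n →+* _).toAddMonoidHom) σ.toAddMonoidHom 
      (fun n => ⟨map_injective _ hπ.1, map_surjective _ hπ.2⟩) hσ ?_ ?_ hP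
    · exact fun n i _ x => (bcm_map π (P.d n i) x).symm
    · exact fun x => (bce_map π σ hc P.ε x).symm

theorem van_self (A : Type u) [CommRing A] (k : ℕ) : Van A A k := by
  refine van_iso (RingHom.id A) (aeval (R := A) (PEmpty.elim : PEmpty.{u+1} → A)).toRingHom (fun a => (aeval (R := A) _).commutes a) Function.bijective_id ?_ k (van_poly A PEmpty k)
  have : aeval (R := A) (PEmpty.elim : PEmpty.{u+1} → A) = (isEmptyAlgEquiv A PEmpty.{u+1}).toAlgHom := algHom_ext (fun v => v.elim)
  rw [this]
  exact (isEmptyAlgEquiv A PEmpty.{u+1}).bijective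

/-- elementwise regular sequence -/
def Reg {A : Type*} [CommRing A] {g : ℕ} (y : Fin g → A) : Prop :=
  ∀ (k : Fin g) (a : A), y k * a ∈ Ideal.span (y '' {i | i.val < k.val}) → a ∈ Ideal.span (y '' {i | i.val < k.val})

theorem van_chain {B S : Type u} [CommRing B] [CommRing S] [Algebra B S] {g : ℕ} (a : Fin g → B) (ha : Reg a) (haS : Reg (fun i => algebraMap B S (a i))) (k : ℕ) (h : Van B S k) (j : ℕ) (hj : j ≤ g) :
    ∀ (A' S' : Type u) [CommRing A'] [CommRing S'] [Algebra A' S'] (π : B →+* A') (σ : S →+* S')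
    (_ : ∀ a, σ (algebraMap B S a) = algebraMap A' S' (π a)) (_ : Function.Surjective π) (_ : Function.Surjective σ)
    (_ : RingHom.ker π = Ideal.span (a '' {i | i.val < j})) (_ : RingHom.ker σ = Ideal.span ((fun i => algebraMap B S (a i)) '' {i | i.val < j})), Van A' S' k := by
  induction j with
  | zero =>
    intro A' S' _ _ _ π σ hc hπ hσ kπ kσ
    have e : {i : Fin g | i.val < 0} = ∅ := by ext; simp
    rw [e, Set.image_empty, Ideal.span_empty] at kπ kσ
    exact van_iso π σ hc ⟨(RingHom.injective_iff_ker_eq_bot π).2 kπ, hπ⟩ ⟨(RingHom.injective_iff_ker_eq_bot σ).2 kσ, hσ⟩ k h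
  | succ j ih =>
    intro A' S' _ _ _ π σ hc hπ hσ kπ kσ
    set I := Ideal.span (a '' {i | i.val < j}) with hI
    set I' := Ideal.span ((fun i => algebraMap B S (a i)) '' {i | i.val < j}) with hI'
    have hII : I' = I.map (algebraMap B S) := by rw [hI, Ideal.map_span, Set.image_image]
    have e : {i : Fin g | i.val < j+1} = insert ⟨j, hj⟩ {i | i.val < j} := by
      ext i; simp only [Set.mem_setOf_eq, Set.mem_insert_iff, Fin.ext_iff]; omega
    have e1 : RingHom.ker π = Ideal.span {a ⟨j, hj⟩} ⊔ I := by rw [kπ, e, Set.image_insert_eq, Ideal.span_insert]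
    have e2 : RingHom.ker σ = Ideal.span {algebraMap B S (a ⟨j, hj⟩)} ⊔ I' := by rw [kσ, e, Set.image_insert_eq, Ideal.span_insert]
    have le1 : I ≤ RingHom.ker π := by rw [e1]; exact le_sup_right
    have le2 : I' ≤ RingHom.ker σ := by rw [e2]; exact le_sup_right
    let t : B ⧸ I →+* S ⧸ I' := Ideal.quotientMap I' (algebraMap B S) (by rw [hII]; exact Ideal.le_comap_map)
    letI : Algebra (B ⧸ I) (S ⧸ I') := t.toAlgebra
    have ht : ∀ b, algebraMap (B ⧸ I) (S ⧸ I') (Ideal.Quotient.mk I b) = Ideal.Quotient.mk I' (algebraMap B S b) := fun b => Ideal.quotientMap_mk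
    have hv : Van (B ⧸ I) (S ⧸ I') k := ih (by omega) _ _ (Ideal.Quotient.mk I) (Ideal.Quotient.mk I') (fun b => (ht b).symm) Ideal.Quotient.mk_surjective Ideal.Quotient.mk_surjective Ideal.mk_ker Ideal.mk_ker
    refine van_bc (Ideal.Quotient.lift I π le1) (Ideal.Quotient.lift I' σ le2) ?_ (Ideal.Quotient.mk I (a ⟨j, hj⟩)) (Ideal.Quotient.lift_surjective_of_surjective _ _ hπ) (Ideal.Quotient.lift_surjective_of_surjective _ _ hσ) ?_ ?_ ?_ ?_ k hv
    · intro b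
      obtain ⟨b, rfl⟩ := Ideal.Quotient.mk_surjective b
      rw [ht]
      exact hc b
    · intro b hb
      obtain ⟨b, rfl⟩ := Ideal.Quotient.mk_surjective b
      rw [← map_mul, Ideal.Quotient.eq_zero_iff_mem] at hb
      exact Ideal.Quotient.eq_zero_iff_mem.2 (ha ⟨j, hj⟩ b hb)
    · intro b hb
      obtain ⟨b, rfl⟩ := Ideal.Quotient.mk_surjective b
      rw [ht, ← map_mul, Ideal.Quotient.eq_zero_iff_mem] at hb
      exact Ideal.Quotient.eq_zero_iff_mem.2 (haS ⟨j, hj⟩ b hb)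
    · rw [Ideal.ker_quotient_lift, e1, Ideal.map_sup, Ideal.map_quotient_self, sup_bot_eq, Ideal.map_span, Set.image_singleton]
    · rw [Ideal.ker_quotient_lift, e2, Ideal.map_sup, Ideal.map_quotient_self, sup_bot_eq, Ideal.map_span, Set.image_singleton, ht]

theorem van_reg {A S' : Type u} [CommRing A] [CommRing S'] [Algebra A S'] (hs : Function.Surjective (algebraMap A S')) {g : ℕ} (y : Fin g → A) (hy : Reg y) 
    (hk : RingHom.ker (algebraMap A S') = Ideal.span (Set.range y)) : Van A S' 1 := by
  let B := MvPolynomial (ULift.{u} (Fin g)) A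
  let f : B →ₐ[A] A := aeval (fun i => y i.down)
  letI : Algebra B A := f.toRingHom.toAlgebra
  haveI : IsScalarTower A B A := IsScalarTower.of_algebraMap_eq (fun a => (f.commutes a).symm)
  have hf : ∀ b, algebraMap B A b = f b := fun b => rfl
  have h1 : Van B A 1 := JZ A B A 0 (van_poly _ _ _) (van_self _ _)
  let a : Fin g → B := fun i => X ⟨i⟩
  have hay : (fun i => algebraMap B A (a i)) = y := by
    ext i; rw [hf]; exact aeval_X _ _
  have im : ∀ s : Set (Fin g), a '' s = X '' (ULift.up '' s) := fun s => by rw [Set.image_image]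
  have hu : {i : Fin g | i.val < g} = Set.univ := by ext i; simp
  refine van_chain a ?_ (by rw [hay]; exact hy) 1 h1 g le_rfl A S' (constantCoeff) (algebraMap A S') ?_ ?_ hs ?_ ?_
  · intro k p hp
    rw [im, mem_ideal_span_X_image] at hp ⊢
    intro m hm
    obtain ⟨i, hi, hi'⟩ := hp (Finsupp.single ⟨k⟩ 1 + m) (by
      rw [mem_support_iff, coeff_X_mul]; exact mem_support_iff.1 hm)
    refine ⟨i, hi, ?_⟩
    obtain ⟨i, hi, rfl⟩ := hi
    have : k ≠ i := by rintro rfl; exact lt_irrefl k.val hi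
    rwa [Finsupp.add_apply, Finsupp.single_apply, if_neg (by simpa using this), zero_add] at hi'
  · intro b
    have : (algebraMap A S').comp f.toRingHom = (algebraMap A S').comp constantCoeff := by
      refine MvPolynomial.ringHom_ext (fun r => ?_) (fun i => ?_)
      · change algebraMap A S' (f (C r)) = algebraMap A S' (constantCoeff (C r))
        rw [constantCoeff_C]; exact congrArg _ (f.commutes r)
      · change algebraMap A S' (f (X i)) = algebraMap A S' (constantCoeff (X i))
        rw [constantCoeff_X, map_zero, show f (X i) = y i.down from aeval_X _ _]
        change y i.down ∈ RingHom.ker (algebraMap A S')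
        rw [hk]; exact Ideal.subset_span ⟨_, rfl⟩
    exact DFunLike.congr_fun this b
  · exact fun r => ⟨C r, constantCoeff_C _ r⟩
  · ext p
    rw [im, mem_ideal_span_X_image, RingHom.mem_ker, constantCoeff_eq]
    constructor
    · intro h m hm
      by_contra hcon
      push Not at hcon
      have : m = 0 := by
        ext i; exact hcon i ⟨i.down, by simp, rfl⟩
      rw [this, mem_support_iff] at hm
      exact hm h
    · intro h
      by_contra hcon
      obtain ⟨i, _, hi⟩ := h 0 (mem_support_iff.2 hcon)
      exact hi rfl
  · rw [hk, hay, hu, Set.image_univ]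
end AQ

namespace AQ
open MvPolynomial
section
variable {K : Type u} [CommRing K] {X : ℕ → Type u} [∀ n, AddCommGroup (X n)] [∀ n, Module K (X n)] (d : ∀ n, ℕ → X (n+1) →ₗ[K] X n)
/-- linear boundary -/
noncomputable def dl (n : ℕ) : X (n+1) →ₗ[K] X n := ∑ i ∈ Finset.range (n+2), ((-1 : ℤ)^i) • d n i
theorem dl_apply (n x) : dl d n x = bdu (fun n i => (d n i).toAddMonoidHom) n x := by
  rw [bdu_apply, dl, LinearMap.sum_apply]; rfl
theorem bdu_td (M : Type u) [AddCommGroup M] [Module K M] (n : ℕ) (t) : 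
    bdu (X := fun n => M ⊗[K] X n) (fun n i => ((d n i).lTensor M).toAddMonoidHom) n t = (dl d n).lTensor M t := by
  induction t using TensorProduct.induction_on with
  | zero => simp
  | add x y hx hy => rw [map_add, map_add, hx, hy]
  | tmul m x =>
    rw [bdu_apply, LinearMap.lTensor_tmul, dl, LinearMap.sum_apply, TensorProduct.tmul_sum]
    refine Finset.sum_congr rfl fun i _ => ?_
    rw [LinearMap.smul_apply, TensorProduct.tmul_smul]; rfl
end

section
variable {R S R' : Type u} [CommRing R] [CommRing S] [CommRing R'] [Algebra R S] [Algebra R R']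

theorem flat_ac [Module.Flat R R'] (P : PR R S) (hP : P.Ac) 
   (hc : ∀ a, (Algebra.TensorProduct.includeRight : S →ₐ[R] R' ⊗[R] S).toRingHom (algebraMap R S a) = algebraMap R' (R' ⊗[R] S) (algebraMap R R' a)) : 
   (P.bc (algebraMap R R') (Algebra.TensorProduct.includeRight : S →ₐ[R] R' ⊗[R] S).toRingHom hc).Ac := by
  let dL : ∀ n, ℕ → P.X (n+1) →ₗ[R] P.X n := fun n i => (P.d n i).toLinearMap
  let εL : P.X 0 →ₗ[R] S := P.ε.toLinearMap
  have hdl : ∀ n x, dl dL n x = bdu (X := P.X) P.da n x := fun n x => dl_apply dL n x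
  have e0 : Function.Exact (dl dL 0) εL := by
    intro x
    refine ⟨fun h => ?_, ?_⟩
    · obtain ⟨y, hy⟩ := hP.2.1 x h
      exact ⟨y, (hdl 0 y).trans hy⟩
    · rintro ⟨y, rfl⟩
      rw [hdl]
      exact eps_bdu (X := P.X) (P.ε : P.X 0 →+ S) P.da P.de y
  have e1 : ∀ n, Function.Exact (dl dL (n+1)) (dl dL n) := by
    intro n x
    refine ⟨fun h => ?_, ?_⟩
    · obtain ⟨y, hy⟩ := hP.2.2 n x ((hdl n x).symm.trans h)
      exact ⟨y, (hdl _ y).trans hy⟩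
    · rintro ⟨y, rfl⟩
      rw [hdl, hdl]
      exact P.bdd n y
  set P' := P.bc (algebraMap R R') (Algebra.TensorProduct.includeRight : S →ₐ[R] R' ⊗[R] S).toRingHom hc
  let m : ∀ n, R' ⊗[R] P.X n →+ P'.X n := fun n => ((algebraTensorAlgEquiv (σ := P.V n) R R').toLinearEquiv.toLinearMap.toAddMonoidHom : R' ⊗[R] MvPolynomial (P.V n) R →+ MvPolynomial (P.V n) R')
  have hm : ∀ n i t, m n ((dL n i).lTensor R' t) = P'.da n i (m (n+1) t) := by
    intro n i t
    change algebraTensorAlgEquiv (σ := P.V n) R R' ((P.d n i).toLinearMap.lTensor R' t) = bcm (algebraMap R R') (P.d n i) (algebraTensorAlgEquiv (σ := P.V (n+1)) R R' t)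
    induction t using TensorProduct.induction_on with
    | zero => simp only [map_zero]
    | add x y hx hy => simp only [map_add, hx, hy]
    | tmul r x => 
      change algebraTensorAlgEquiv R R' (r ⊗ₜ[R] (P.d n i x)) = bcm (algebraMap R R') (P.d n i) (algebraTensorAlgEquiv R R' (r ⊗ₜ[R] x))
      rw [algebraTensorAlgEquiv_tmul, algebraTensorAlgEquiv_tmul, map_smul, bcm_map]
  have hm0 : ∀ t, εL.lTensor R' t = P'.ε (m 0 t) := by
    intro t
    change P.ε.toLinearMap.lTensor R' t = bce (A' := R') (Algebra.TensorProduct.includeRight : S →ₐ[R] R' ⊗[R] S).toRingHom P.ε (algebraTensorAlgEquiv (σ := P.V 0) R R' t)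
    induction t using TensorProduct.induction_on with
    | zero => simp only [map_zero]
    | add x y hx hy => simp only [map_add, hx, hy]
    | tmul r x => 
      change r ⊗ₜ[R] (P.ε x) = bce (A' := R') (Algebra.TensorProduct.includeRight : S →ₐ[R] R' ⊗[R] S).toRingHom P.ε (algebraTensorAlgEquiv R R' (r ⊗ₜ[R] x))
      rw [algebraTensorAlgEquiv_tmul, map_smul, bce_map _ _ hc]
      change _ = r • (1 : R') ⊗ₜ[R] (P.ε x)
      rw [TensorProduct.smul_tmul', smul_eq_mul, mul_one]
  refine acycU_bij (X := fun n => R' ⊗[R] P.X n) (X' := P'.X) (εL.lTensor R').toAddMonoidHom (fun n i => ((dL n i).lTensor R').toAddMonoidHom) _ _ 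
    m (AddMonoidHom.id _) (fun n => (algebraTensorAlgEquiv (σ := P.V n) R R').bijective) Function.bijective_id (fun n i _ t => hm n i t) hm0 ?_
  · refine ⟨LinearMap.lTensor_surjective R' hP.1, fun x hx => ?_, fun n x hx => ?_⟩
    · obtain ⟨y, hy⟩ := (Module.Flat.lTensor_exact R' e0 x).1 hx
      exact ⟨y, (bdu_td dL R' 0 y).trans hy⟩
    · obtain ⟨y, hy⟩ := (Module.Flat.lTensor_exact R' (e1 n) x).1 ((bdu_td dL R' n x).symm.trans hx)
      exact ⟨y, (bdu_td dL R' (n+1) y).trans hy⟩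

theorem J_tensor {A S M N : Type u} [CommRing A] [CommRing S] [Algebra A S] [AddCommGroup M] [Module S M] [AddCommGroup N] [Module S N] {V W : Type u} [DecidableEq V] [DecidableEq W]
   (a : MvPolynomial W A →ₐ[A] S) (φ : MvPolynomial V A →ₐ[A] MvPolynomial W A) (t : M ⊗[S] (V →₀ N)) :
   TensorProduct.finsuppRight S S M N W ((J N a φ).lTensor M t) = J (M ⊗[S] N) a φ (TensorProduct.finsuppRight S S M N V t) := by
  induction t using TensorProduct.induction_on with
  | zero => simp only [map_zero]
  | add x y hx hy => simp only [map_add, hx, hy]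
  | tmul m f =>
    induction f using Finsupp.induction_linear with
    | zero => simp only [map_zero, TensorProduct.tmul_zero]
    | add x y hx hy => simp only [map_add, hx, hy, TensorProduct.tmul_add]
    | single v n =>
      rw [LinearMap.lTensor_tmul, J_single, TensorProduct.finsuppRight_tmul_single, J_single]
      ext w
      rw [TensorProduct.finsuppRight_apply_tmul_apply, jac_apply, jac_apply, TensorProduct.tmul_smul]

theorem exj_ff {A S M N : Type u} [CommRing A] [CommRing S] [Algebra A S] [AddCommGroup M] [Module S M] [AddCommGroup N] [Module S N]
   (P : PR A S) [Module.FaithfullyFlat S M] (n : ℕ) (hX : P.ExJ (M ⊗[S] N) n) : P.ExJ N n := by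
  classical
  let dL : ∀ n, ℕ → (P.V (n+1) →₀ N) →ₗ[S] (P.V n →₀ N) := fun n i => J N (P.aug n) (P.d n i)
  let D : ∀ n, (P.V (n+1) →₀ N) →ₗ[S] (P.V n →₀ N) := fun n => dl (X := fun n => P.V n →₀ N) dL n
  have hdl : ∀ n x, D n x = bdu (X := P.L N) (P.jd N) n x := fun n x => dl_apply (X := fun n => P.V n →₀ N) dL n x
  let F : ∀ n, M ⊗[S] (P.V n →₀ N) ≃ₗ[S] (P.V n →₀ M ⊗[S] N) := fun n => TensorProduct.finsuppRight S S M N (P.V n)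
  let F1 : ∀ n, M ⊗[S] (P.V n →₀ N) →+ P.L (M ⊗[S] N) n := fun n => (F n).toLinearMap.toAddMonoidHom
  have hF' : ∀ n t, F1 n ((D n).lTensor M t) = bdu (X := P.L (M ⊗[S] N)) (P.jd (M ⊗[S] N)) n (F1 (n+1) t) := by
    intro n t
    refine (congrArg (F1 n) (bdu_td (X := fun n => P.V n →₀ N) dL M n t).symm).trans ?_
    refine bdu_map (X := fun n => M ⊗[S] (P.V n →₀ N)) (Y := P.L (M ⊗[S] N)) (fun n i => ((dL n i).lTensor M).toAddMonoidHom) (P.jd (M ⊗[S] N)) n (F1 n) (F1 (n+1)) (fun i _ t => ?_) t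
    exact J_tensor (P.aug n) (P.d n i) t
  have e : Function.Exact (D (n+1)) (D n) := by
    rw [← Module.FaithfullyFlat.lTensor_exact_iff_exact S M]
    intro x
    refine ⟨fun hx => ?_, ?_⟩
    · have h0 : F1 n ((D n).lTensor M x) = 0 := by rw [hx]; exact map_zero (F n)
      obtain ⟨y, hy⟩ := hX (F1 _ x) ((hF' n x).symm.trans h0)
      obtain ⟨y, rfl⟩ := (F _).surjective y
      exact ⟨y, (F _).injective ((hF' _ y).trans hy)⟩
    · rintro ⟨y, rfl⟩
      apply (F _).injective
      refine (hF' n _).trans (Eq.trans ?_ (map_zero (F1 n)).symm)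
      refine (congrArg _ (hF' (n+1) y)).trans ?_
      exact P.jd_dd (M ⊗[S] N) n _
  intro x hx
  obtain ⟨y, hy⟩ := (e x).1 ((hdl n x).trans hx)
  exact ⟨y, (hdl _ y).symm.trans hy⟩

theorem van_descent [Module.FaithfullyFlat R R'] (k : ℕ) (h : Van R' (R' ⊗[R] S) k) : Van R S k := by
  intro N _ _ n hn
  let σ : S →+* R' ⊗[R] S := (Algebra.TensorProduct.includeRight : S →ₐ[R] R' ⊗[R] S).toRingHom
  have hc : ∀ a, σ (algebraMap R S a) = algebraMap R' (R' ⊗[R] S) (algebraMap R R' a) := by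
    intro a
    change (1 : R') ⊗ₜ[R] (algebraMap R S a) = (algebraMap R R' a) ⊗ₜ[R] (1 : S)
    rw [Algebra.algebraMap_eq_smul_one, Algebra.algebraMap_eq_smul_one, TensorProduct.smul_tmul]
  letI : Algebra S (R' ⊗[R] S) := σ.toAlgebra
  haveI : Module.FaithfullyFlat S (R' ⊗[R] S) := by
    let e : (R' ⊗[R] S) ≃ₗ[S] (S ⊗[R] R') := 
      { (TensorProduct.comm R R' S) with
        map_smul' := by
          intro s t
          change TensorProduct.comm R R' S (σ s * t) = s • TensorProduct.comm R R' S t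
          induction t using TensorProduct.induction_on with
          | zero => simp only [map_zero, mul_zero, smul_zero]
          | add x y hx hy => simp only [map_add, mul_add, smul_add, hx, hy]
          | tmul r x =>
            change TensorProduct.comm R R' S ((1 ⊗ₜ s) * (r ⊗ₜ x)) = _
            rw [Algebra.TensorProduct.tmul_mul_tmul, one_mul, TensorProduct.comm_tmul, TensorProduct.comm_tmul]
            rfl }
    exact Module.FaithfullyFlat.of_linearEquiv S (S ⊗[R] R') e
  let P := std R S
  have hP := std_ac R S
  rw [← comparison N P hP]
  let N' := (R' ⊗[R] S) ⊗[S] N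
  let P' := P.bc (algebraMap R R') σ hc
  have hX : P'.ExJ N' n := (comparison N' P' (flat_ac P hP hc) n).2 (h N' n hn)
  have hN : ∀ (s : S) (n : N'), σ s • n = s • n := fun s n => (algebraMap_smul (R' ⊗[R] S) s n)
  refine exj_ff P n ?_ (M := R' ⊗[R] S)
  have e : ∀ n x, bdu (X := P'.L N') (P'.jd N') n x = bdu (X := P.L N') (P.jd N') n x := fun n x => 
    bdu_congr (X := P.L N') _ _ n x (fun i _ => P.bc_jd (algebraMap R R') σ hc hN n i x)
  intro x hx
  obtain ⟨y, hy⟩ := hX x ((e n x).trans hx)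
  exact ⟨y, (e (n+1) y).symm.trans hy⟩
end
end AQ

namespace AQ
section
variable {Q : Type u} [CommRing Q]

theorem flat_ker {P F : Type u} [AddCommGroup P] [Module Q P] [AddCommGroup F] [Module Q F] [Module.Flat Q P] [Module.Flat Q F]
    (f : P →ₗ[Q] F) (hf : Function.Surjective f) : Module.Flat Q (LinearMap.ker f) := by
  rw [Module.Flat.iff_rTensor_preserves_injective_linearMap]
  intro N N' _ _ _ _ i hi
  have h1 := LinearMap.lTensor_injective_of_exact_of_flat
    f hf _ (LinearMap.ker f).subtype_injective (LinearMap.exact_subtype_ker_map _) N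
  have h2 := Module.Flat.rTensor_preserves_injective_linearMap (M := P) i hi
  have h3 := h2.comp h1
  have h4 : (i.rTensor P) ∘ₗ ((LinearMap.ker f).subtype.lTensor N) = ((LinearMap.ker f).subtype.lTensor N') ∘ₗ (i.rTensor (LinearMap.ker f)) := by
    ext; rfl
  rw [← LinearMap.coe_comp, h4, LinearMap.coe_comp] at h3
  exact h3.of_comp

theorem fd_iso (k : ℕ) {N N' : Type u} [AddCommGroup N] [Module Q N] [AddCommGroup N'] [Module Q N'] (e : N ≃ₗ[Q] N') (h : FlatDimLE Q k N) : FlatDimLE Q k N' := by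
  cases k with
  | zero => 
    have : Module.Flat Q N := h
    exact Module.Flat.of_linearEquiv e.symm
  | succ k =>
    obtain ⟨F, _, _, f, h1, h2, h3⟩ := h
    refine ⟨F, _, _, e.toLinearMap ∘ₗ f, h1, e.surjective.comp h2, ?_⟩
    rw [LinearEquiv.ker_comp]
    exact h3

theorem fd_mk (k : ℕ) {N F K : Type u} [AddCommGroup N] [Module Q N] [AddCommGroup F] [Module Q F] [AddCommGroup K] [Module Q K] [Module.Flat Q F]
    (f : F →ₗ[Q] N) (hf : Function.Surjective f) (i : K →ₗ[Q] F) (hi : Function.Injective i) (he : Function.Exact i f) (h : FlatDimLE Q k K) : FlatDimLE Q (k+1) N := by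
  refine ⟨F, _, _, f, inferInstance, hf, fd_iso k ?_ h⟩
  exact (LinearEquiv.ofInjective i hi).trans (LinearEquiv.ofEq _ _ (LinearMap.exact_iff.1 he).symm)

theorem flat_prod {M P : Type u} [AddCommGroup M] [Module Q M] [AddCommGroup P] [Module Q P] [Module.Flat Q M] [Module.Flat Q P] : Module.Flat Q (M × P) := by
  rw [Module.Flat.iff_rTensor_preserves_injective_linearMap]
  intro N N' _ _ _ _ i hi
  have h1 := Module.Flat.rTensor_preserves_injective_linearMap (M := M) i hi
  have h2 := Module.Flat.rTensor_preserves_injective_linearMap (M := P) i hi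
  have h3 : (TensorProduct.prodRight Q Q N' M P).toLinearMap ∘ₗ (i.rTensor (M × P)) = ((i.rTensor M).prodMap (i.rTensor P)) ∘ₗ (TensorProduct.prodRight Q Q N M P).toLinearMap := by
    refine TensorProduct.ext' fun n x => ?_
    simp
  have h4 : Function.Injective ((TensorProduct.prodRight Q Q N' M P).toLinearMap ∘ₗ (i.rTensor (M × P))) := by
    rw [h3]
    exact (h1.prodMap h2).comp (TensorProduct.prodRight Q Q N M P).injective
  rw [LinearMap.coe_comp] at h4
  exact h4.of_comp

theorem fd_prod (k : ℕ) {N P : Type u} [AddCommGroup N] [Module Q N] [AddCommGroup P] [Module Q P] [Module.Flat Q P] (h : FlatDimLE Q k N) : FlatDimLE Q k (N × P) := by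
  cases k with
  | zero => 
    have : Module.Flat Q N := h
    exact flat_prod
  | succ k =>
    obtain ⟨F, _, _, f, h1, h2, h3⟩ := h
    have : Module.Flat Q (F × P) := flat_prod
    refine fd_mk k (f.prodMap (LinearMap.id : P →ₗ[Q] P)) (h2.prodMap Function.surjective_id) ((LinearMap.inl Q F P) ∘ₗ (LinearMap.ker f).subtype) ?_ ?_ h3
    · exact LinearMap.inl_injective.comp (Submodule.subtype_injective _)
    · rintro ⟨a, b⟩
      constructor
      · intro h
        have h' : f a = 0 ∧ b = 0 := by simpa using h
        exact ⟨⟨a, h'.1⟩, by simp [h'.2]⟩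
      · rintro ⟨⟨c, hc⟩, h⟩
        have h' : c = a ∧ 0 = b := by simpa using h
        simp [← h'.1, ← h'.2, LinearMap.mem_ker.1 hc]

theorem fd_kerflat (k : ℕ) {W F : Type u} [AddCommGroup W] [Module Q W] [AddCommGroup F] [Module Q F] [Module.Flat Q F] (f : W →ₗ[Q] F) (hf : Function.Surjective f)
    (h : FlatDimLE Q k W) : FlatDimLE Q k (LinearMap.ker f) := by
  cases k with
  | zero => 
    have : Module.Flat Q W := h
    exact flat_ker f hf
  | succ k =>
    obtain ⟨G, _, _, g, h1, h2, h3⟩ := h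
    have := flat_ker (f ∘ₗ g) (hf.comp h2)
    let r : LinearMap.ker (f ∘ₗ g) →ₗ[Q] LinearMap.ker f := (g ∘ₗ Submodule.subtype _).codRestrict _ (fun c => c.2)
    refine fd_mk k r ?_ (Submodule.inclusion (p := LinearMap.ker g) (p' := LinearMap.ker (f ∘ₗ g)) ?_) (Submodule.inclusion_injective _) ?_ h3
    · rintro ⟨w, hw⟩
      obtain ⟨c, rfl⟩ := h2 w
      exact ⟨⟨c, hw⟩, rfl⟩
    · intro c hc
      have : g c = 0 := hc
      simp [this]
    · rintro ⟨c, hc⟩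
      constructor
      · intro h
        exact ⟨⟨c, congrArg Subtype.val h⟩, rfl⟩
      · rintro ⟨⟨b, hb⟩, h⟩
        have : b = c := congrArg Subtype.val h
        subst this
        exact Subtype.ext hb

theorem fd_shift (k : ℕ) {Ω P : Type u} [AddCommGroup Ω] [Module Q Ω] [AddCommGroup P] [Module Q P] [Module.Free Q P] (p : P →ₗ[Q] Ω) (hp : Function.Surjective p)
    (h : FlatDimLE Q (k+1) Ω) : FlatDimLE Q k (LinearMap.ker p) := by
  obtain ⟨F, _, _, f, h1, h2, h3⟩ := h
  obtain ⟨s, hs⟩ := Module.projective_lifting_property f p h2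
  have hs' : ∀ b, f (s b) = p b := fun b => LinearMap.congr_fun hs b
  -- W = ker f × P → F, (a,b) ↦ a + s b
  let t : (LinearMap.ker f × P) →ₗ[Q] F := LinearMap.coprod (Submodule.subtype _) s
  have ht : ∀ a b, t (a, b) = a.1 + s b := fun a b => by simp [t]
  have hts : Function.Surjective t := by
    intro a
    obtain ⟨b, hb⟩ := hp (f a)
    refine ⟨(⟨a - s b, ?_⟩, b), ?_⟩
    · simp [hs', hb]
    · rw [ht]; simp
  refine fd_iso k ?_ (fd_kerflat k t hts (fd_prod k h3))
  have hfz : ∀ c : LinearMap.ker t, s c.1.2 = - c.1.1.1 := fun c => by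
    have := LinearMap.mem_ker.1 c.2
    rw [ht c.1.1 c.1.2] at this
    exact (neg_eq_of_add_eq_zero_right this).symm
  have hpz : ∀ c : LinearMap.ker t, p c.1.2 = 0 := fun c => by
    rw [← hs', hfz, map_neg, LinearMap.mem_ker.1 c.1.1.2, neg_zero]
  refine LinearEquiv.ofBijective ((LinearMap.snd Q _ _ ∘ₗ Submodule.subtype (LinearMap.ker t)).codRestrict (LinearMap.ker p) hpz) ⟨?_, ?_⟩
  · rw [injective_iff_map_eq_zero]
    rintro ⟨⟨⟨a, ha⟩, b⟩, hc⟩ h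
    have hb : b = 0 := congrArg Subtype.val h
    subst hb
    have := hfz ⟨⟨⟨a, ha⟩, 0⟩, hc⟩
    simp at this
    subst this
    rfl
  · rintro ⟨b, hb⟩
    refine ⟨⟨(⟨- s b, ?_⟩, b), ?_⟩, rfl⟩
    · simp [hs', LinearMap.mem_ker.1 hb]
    · rw [LinearMap.mem_ker, ht]; simp
end
end AQ

namespace AQ
section
variable {A : Type u} [CommRing A]
/-- Koszul one-boundaries of a linear form -/
def Bd {M : Type u} [AddCommGroup M] [Module A M] (d : M →ₗ[A] A) : Submodule A M :=
  Submodule.span A {m | ∃ u v, m = d u • v - d v • u}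
theorem Bd_mem {M : Type u} [AddCommGroup M] [Module A M] (d : M →ₗ[A] A) (u v : M) : d u • v - d v • u ∈ Bd d := Submodule.subset_span ⟨u, v, rfl⟩
theorem Bd_le {M : Type u} [AddCommGroup M] [Module A M] (d : M →ₗ[A] A) : Bd d ≤ LinearMap.ker d := by
  refine Submodule.span_le.2 ?_
  rintro _ ⟨u, v, rfl⟩
  simp [mul_comm]
theorem Bd_map {B : Type u} [CommRing B] (σ : A →+* B) {M M' : Type u} [AddCommGroup M] [Module A M] [AddCommGroup M'] [Module B M'] (d : M →ₗ[A] A) (d' : M' →ₗ[B] B) 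
   (φ : M →ₛₗ[σ] M') (h : ∀ m, d' (φ m) = σ (d m)) (m : M) (hm : m ∈ Bd d) : φ m ∈ Bd d' := by
  induction hm using Submodule.span_induction with
  | mem _ hx =>
    obtain ⟨u, v, rfl⟩ := hx
    rw [map_sub, LinearMap.map_smulₛₗ, LinearMap.map_smulₛₗ, ← h, ← h]
    exact Bd_mem d' _ _
  | zero => rw [map_zero]; exact zero_mem _
  | add x y _ _ hx hy => rw [map_add]; exact add_mem hx hy
  | smul a x _ hx => rw [LinearMap.map_smulₛₗ]; exact Submodule.smul_mem _ _ hx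

theorem kD_apply {c : ℕ} (x v : Fin c → A) : koszulD1 A x v = ∑ i, x i * v i := by
  simp [koszulD1]

theorem kD_cons {c : ℕ} (x : Fin (c+1) → A) (t : A) (v : Fin c → A) : koszulD1 A x (Fin.cons t v : Fin (c+1) → A) = x 0 * t + koszulD1 A (fun i => x i.succ) v := by
  simp [kD_apply, Fin.sum_univ_succ]

/-- cons -/
def csl (c : ℕ) : (A × (Fin c → A)) →ₗ[A] (Fin (c+1) → A) where
  toFun p := Fin.cons p.1 p.2
  map_add' p q := by
    ext i; refine Fin.cases ?_ (fun j => ?_) i <;> simp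
  map_smul' a p := by
    ext i; refine Fin.cases ?_ (fun j => ?_) i <;> simp

theorem kd_exists (m : Ideal A) (g : ℕ) (y z : Fin g → A) (hz : ∀ i, z i ∈ m) : ∃ (Λ : Type u) (_ : AddCommGroup Λ) (_ : Module A Λ) (D : Λ →ₗ[A] Λ) (p0 : Λ →ₗ[A] A) (p1 : Λ →ₗ[A] (Fin g → A)) (o : Λ),
   Module.Free A Λ ∧ Module.Finite A Λ ∧ (∀ a, D (D a) = koszulD1 A y z • a) ∧ p0 o = 1 ∧ D o ∈ m • (⊤ : Submodule A Λ) ∧ (∀ a, p0 (D a) = koszulD1 A y (p1 a)) ∧ 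
   ∀ a, p1 (D a) - p0 a • z ∈ Bd (koszulD1 A y) := by
  induction g with
  | zero => 
    refine ⟨A, _, _, 0, LinearMap.id, 0, 1, inferInstance, inferInstance, fun a => ?_, rfl, by simp, fun a => by simp [kD_apply], fun a => ?_⟩
    · simp [kD_apply]
    · convert zero_mem (Bd (koszulD1 A y))
  | succ n ih =>
    obtain ⟨Λ, _, _, D, p0, p1, o, _, _, h1, h2, h3, h4, h5⟩ := ih (fun i => y i.succ) (fun i => z i.succ) (fun i => hz _)
    let D' : (Λ × Λ) →ₗ[A] (Λ × Λ) := LinearMap.prod (LinearMap.coprod D (y 0 • LinearMap.id)) (LinearMap.coprod (z 0 • LinearMap.id) (-D))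
    have hD : ∀ a b, D' (a, b) = (D a + y 0 • b, z 0 • a - D b) := fun a b => by simp [D', sub_eq_add_neg]
    let p1' : (Λ × Λ) →ₗ[A] (Fin (n+1) → A) := csl n ∘ₗ LinearMap.prod (p0 ∘ₗ LinearMap.snd A Λ Λ) (p1 ∘ₗ LinearMap.fst A Λ Λ)
    have hp1 : ∀ a b, p1' (a, b) = Fin.cons (p0 b) (p1 a) := fun a b => rfl
    have hz0 : koszulD1 A y z = y 0 * z 0 + koszulD1 A (fun i => y i.succ) (fun i => z i.succ) := by simp [kD_apply, Fin.sum_univ_succ]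
    refine ⟨Λ × Λ, _, _, D', p0 ∘ₗ LinearMap.fst A Λ Λ, p1', (o, 0), inferInstance, inferInstance, ?_, by simpa using h2, ?_, ?_, ?_⟩
    · rintro ⟨a, b⟩
      rw [hD, hD, map_add, map_sub, h1, h1, map_smul, map_smul, hz0]
      ext
      · simp only [Prod.smul_fst]; module
      · simp only [Prod.smul_snd]; module
    · rw [hD]
      simp only [smul_zero, add_zero, map_zero, sub_zero]
      have e1 : m • (⊤ : Submodule A Λ) ≤ (m • (⊤ : Submodule A (Λ × Λ))).comap (LinearMap.inl A Λ Λ) := by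
        rw [← Submodule.map_le_iff_le_comap, Submodule.map_smul'']
        exact Submodule.smul_mono le_rfl le_top
      have e2 : (D o, z 0 • o) = LinearMap.inl A Λ Λ (D o) + z 0 • (LinearMap.inr A Λ Λ o) := by simp
      rw [e2]
      exact add_mem (e1 h3) (Submodule.smul_mem_smul (hz 0) trivial)
    · rintro ⟨a, b⟩
      rw [hp1, kD_cons, hD]
      simp [h4]; ring
    · rintro ⟨a, b⟩
      rw [hD, hp1]
      have e1 : (csl n) (0, (p1 (D a) - p0 a • fun i => z i.succ)) ∈ Bd (koszulD1 A y) := 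
        Bd_map (RingHom.id A) (koszulD1 A (fun i => y i.succ)) (koszulD1 A y) (csl n ∘ₗ LinearMap.inr A A (Fin n → A)) (fun v => by
          change koszulD1 A y (Fin.cons 0 v) = _
          rw [kD_cons]; simp) _ (h5 a)
      have e2 := Bd_mem (koszulD1 A y) (csl n (1, 0)) (csl n (0, p1 b))
      have e3 : koszulD1 A y (csl n (1, 0)) = y 0 := by
        change koszulD1 A y (Fin.cons 1 0) = _
        rw [kD_cons]; simp
      have e4 : koszulD1 A y (csl n (0, p1 b)) = koszulD1 A (fun i => y i.succ) (p1 b) := by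
        change koszulD1 A y (Fin.cons 0 _) = _
        rw [kD_cons]; simp
      rw [e3, e4, ← h4] at e2
      convert add_mem e1 e2 using 1
      ext i
      refine Fin.cases ?_ (fun j => ?_) i
      · simp [csl]; ring
      · simp [csl]; ring
end

section
variable {Q : Type u} [CommRing Q] {Λ M T : Type u} [AddCommGroup Λ] [Module Q Λ] [AddCommGroup M] [Module Q M] [AddCommGroup T] [Module Q T]
  (D : Λ →ₗ[Q] Λ) (p0 : Λ →ₗ[Q] Q) (p1 : Λ →ₗ[Q] M) (ε : Q →ₗ[Q] T) (d : M →ₗ[Q] Q)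

/-- even data -/
def ED (Ω : Type u) [AddCommGroup Ω] [Module Q Ω] : Prop := ∃ (w : Λ →ₗ[Q] Ω) (f : Ω →ₗ[Q] T) (v : Λ →ₗ[Q] T),
  (∀ a, w (D a) = 0) ∧ ∀ a, f (w a) - ε (p0 a) = v (D a)
/-- odd data -/
def OD (Ω : Type u) [AddCommGroup Ω] [Module Q Ω] : Prop := ∃ (w : Λ →ₗ[Q] Ω) (f : Ω →ₗ[Q] Q) (v : Λ →ₗ[Q] Q),
  (∀ a, w (D a) = 0) ∧ (∀ a, ε (f a) = 0) ∧ (∀ a, ε (v a) = 0) ∧ ∀ a, f (w a) - d (p1 a) = v (D a)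

variable {D p0 p1 ε d}
theorem e_step [Module.Free Q Λ] (hD : ∀ a, D (D a) = 0) (hε : Function.Surjective ε) (h01 : ∀ a, p0 (D a) = d (p1 a)) 
   {Ω F : Type u} [AddCommGroup Ω] [Module Q Ω] [AddCommGroup F] [Module Q F] [Module.Free Q F] (π : F →ₗ[Q] Ω) (hπ : Function.Surjective π)
   (h : ED D p0 ε Ω) : OD D p1 ε d (LinearMap.ker π) := by
  obtain ⟨w, f, v, h1, h2⟩ := h
  obtain ⟨w', hw⟩ := Module.projective_lifting_property π w hπ
  obtain ⟨f', hf⟩ := Module.projective_lifting_property ε (f ∘ₗ π) hε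
  obtain ⟨v', hv⟩ := Module.projective_lifting_property ε v hε
  replace hw : ∀ a, π (w' a) = w a := LinearMap.congr_fun hw
  replace hf : ∀ a, ε (f' a) = f (π a) := LinearMap.congr_fun hf
  replace hv : ∀ a, ε (v' a) = v a := LinearMap.congr_fun hv
  refine ⟨(w' ∘ₗ D).codRestrict _ (fun a => ?_), f' ∘ₗ Submodule.subtype _, f' ∘ₗ w' - p0 - v' ∘ₗ D, fun a => ?_, fun a => ?_, fun a => ?_, fun a => ?_⟩
  · rw [LinearMap.mem_ker]; exact (hw _).trans (h1 a)
  · ext; simp [hD]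
  · simp [hf, LinearMap.mem_ker.1 a.2]
  · simp [hf, hw, hv, ← h2]
  · simp [hD, h01]

theorem o_step [Module.Free Q Λ] (hD : ∀ a, D (D a) = 0) (hdI : ∀ q, ε q = 0 → ∃ a, d a = q) {z : M} (hz : d z = 0)
   (h1D : ∀ a, p1 (D a) - p0 a • z ∈ Bd d) (lam : LinearMap.ker d →ₗ[Q] T) (hlB : ∀ a : LinearMap.ker d, a.1 ∈ Bd d → lam a = 0) (hlz : lam ⟨z, hz⟩ = ε 1)
   {Ω F : Type u} [AddCommGroup Ω] [Module Q Ω] [AddCommGroup F] [Module Q F] [Module.Free Q F] (π : F →ₗ[Q] Ω) (hπ : Function.Surjective π)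
   (h : OD D p1 ε d Ω) : ED D p0 ε (LinearMap.ker π) := by
  obtain ⟨w, f, v, h1, h2, h3, h4⟩ := h
  have lift : ∀ {G : Type u} [AddCommGroup G] [Module Q G] [Module.Free Q G] (h : G →ₗ[Q] Q) (hh : ∀ a, ε (h a) = 0), ∃ h' : G →ₗ[Q] M, ∀ a, d (h' a) = h a := by
    intro G _ _ _ h hh
    obtain ⟨h', hh'⟩ := Module.projective_lifting_property (d.codRestrict (LinearMap.range d) (fun c => ⟨c, rfl⟩)) (h.codRestrict (LinearMap.range d) (fun c => hdI _ (hh c))) 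
      (by rintro ⟨_, c, rfl⟩; exact ⟨c, rfl⟩)
    exact ⟨h', fun a => congrArg Subtype.val (LinearMap.congr_fun hh' a)⟩
  obtain ⟨w', hw⟩ := Module.projective_lifting_property π w hπ
  replace hw : ∀ a, π (w' a) = w a := LinearMap.congr_fun hw
  obtain ⟨f', hf⟩ := lift (f ∘ₗ π) (fun a => h2 _)
  obtain ⟨v', hv⟩ := lift v h3
  let μ : Λ →ₗ[Q] LinearMap.ker d := (f' ∘ₗ w' - p1 - v' ∘ₗ D).codRestrict _ (fun a => by
    rw [LinearMap.mem_ker]; simp [hf, hw, hv, ← h4])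
  let w'' : Λ →ₗ[Q] LinearMap.ker π := (w' ∘ₗ D).codRestrict _ (fun a => by
    rw [LinearMap.mem_ker]; exact (hw _).trans (h1 a))
  let f'' : LinearMap.ker π →ₗ[Q] LinearMap.ker d := (f' ∘ₗ Submodule.subtype _).codRestrict _ (fun a => by
    rw [LinearMap.mem_ker]; exact (hf _).trans ((congrArg f a.2).trans (map_zero f)))
  refine ⟨w'', lam ∘ₗ f'', lam ∘ₗ μ, fun a => ?_, fun a => ?_⟩
  · ext; simp [w'', hD]
  · let b : LinearMap.ker d := ⟨p1 (D a) - p0 a • z, Bd_le d (h1D a)⟩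
    have e : f'' (w'' a) - p0 a • ⟨z, hz⟩ = μ (D a) + b := by
      ext
      simp [f'', w'', μ, b, hD]
    have e' := congrArg lam e
    rw [map_sub, map_add, map_smul, hlz, hlB b (h1D a), add_zero, ← map_smul, smul_eq_mul, mul_one] at e'
    exact e'

theorem e_sub (m : Ideal Q) {o : Λ} (ho : p0 o = 1) (hDo : D o ∈ m • (⊤ : Submodule Q Λ)) (hm : ε 1 ∉ m • (⊤ : Submodule Q T))
   {Ω : Type u} [AddCommGroup Ω] [Module Q Ω] [Subsingleton Ω] (h : ED D p0 ε Ω) : False := by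
  obtain ⟨w, f, v, h1, h2⟩ := h
  have h := h2 o
  rw [Subsingleton.elim (w o) 0, map_zero, zero_sub, ho] at h
  apply hm
  rw [← neg_mem_iff, h]
  have : m • (⊤ : Submodule Q Λ) ≤ (m • (⊤ : Submodule Q T)).comap v := by
    rw [← Submodule.map_le_iff_le_comap, Submodule.map_smul'']
    exact Submodule.smul_mono le_rfl le_top
  exact this hDo

theorem e_flat [Module.Free Q Λ] [Module.Finite Q Λ] {Ω : Type u} [AddCommGroup Ω] [Module Q Ω] [Module.Flat Q Ω] (h : ED D p0 ε Ω) : ∃ k : ℕ, ED D p0 ε (Fin k →₀ Q) := by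
  obtain ⟨w, f, v, h1, h2⟩ := h
  obtain ⟨k, a, y, h3, h4⟩ := Module.Flat.exists_factorization_of_comp_eq_zero_of_free (f := D) (x := w) (LinearMap.ext h1)
  refine ⟨k, a, f ∘ₗ y, v, LinearMap.congr_fun h4, fun b => ?_⟩
  rw [← h2, h3]; rfl
theorem o_flat [Module.Free Q Λ] [Module.Finite Q Λ] {Ω : Type u} [AddCommGroup Ω] [Module Q Ω] [Module.Flat Q Ω] (h : OD D p1 ε d Ω) : ∃ k : ℕ, OD D p1 ε d (Fin k →₀ Q) := by
  obtain ⟨w, f, v, h1, h2, h2', h2''⟩ := h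
  obtain ⟨k, a, y, h3, h4⟩ := Module.Flat.exists_factorization_of_comp_eq_zero_of_free (f := D) (x := w) (LinearMap.ext h1)
  refine ⟨k, a, f ∘ₗ y, v, LinearMap.congr_fun h4, fun b => h2 _, h2', fun b => ?_⟩
  rw [← h2'', h3]; rfl

theorem eo_main [Module.Free Q Λ] [Module.Finite Q Λ] (hD : ∀ a, D (D a) = 0) (hε : Function.Surjective ε) (h01 : ∀ a, p0 (D a) = d (p1 a)) (hdI : ∀ q, ε q = 0 → ∃ a, d a = q) {z : M} (hz : d z = 0)
   (h1D : ∀ a, p1 (D a) - p0 a • z ∈ Bd d) (lam : LinearMap.ker d →ₗ[Q] T) (hlB : ∀ a : LinearMap.ker d, a.1 ∈ Bd d → lam a = 0) (hlz : lam ⟨z, hz⟩ = ε 1)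
   (m : Ideal Q) {o : Λ} (ho : p0 o = 1) (hDo : D o ∈ m • (⊤ : Submodule Q Λ)) (hm : ε 1 ∉ m • (⊤ : Submodule Q T)) (k : ℕ) : 
   ∀ (Ω : Type u) [AddCommGroup Ω] [Module Q Ω], FlatDimLE Q k Ω → ¬ ED D p0 ε Ω ∧ ¬ OD D p1 ε d Ω := by
  have o_sub : ∀ (Ω : Type u) [AddCommGroup Ω] [Module Q Ω] [Subsingleton Ω], OD D p1 ε d Ω → False := fun Ω _ _ _ h => 
    e_sub m ho hDo hm (o_step hD hdI hz h1D lam hlB hlz (LinearMap.id : Ω →ₗ[Q] Ω) Function.surjective_id h)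
  have sub : ∀ (F : Type u) [AddCommGroup F] [Module Q F], Subsingleton (LinearMap.ker (LinearMap.id : F →ₗ[Q] F)) := fun F _ _ => by
    rw [LinearMap.ker_id]; infer_instance
  induction k with
  | zero =>
    intro Ω _ _ hΩ
    have : Module.Flat Q Ω := hΩ
    refine ⟨fun h => ?_, fun h => ?_⟩
    · obtain ⟨k, h⟩ := e_flat h
      have := sub (Fin k →₀ Q)
      exact o_sub _ (e_step hD hε h01 (LinearMap.id) Function.surjective_id h)
    · obtain ⟨k, h⟩ := o_flat h
      have := sub (Fin k →₀ Q)
      exact e_sub m ho hDo hm (o_step hD hdI hz h1D lam hlB hlz (LinearMap.id) Function.surjective_id h)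
  | succ k ih =>
    intro Ω _ _ hΩ
    let π : (Ω →₀ Q) →ₗ[Q] Ω := Finsupp.linearCombination Q fun a ↦ a
    have hπ : Function.Surjective π := Finsupp.linearCombination_surjective _ Function.surjective_id
    have h1 := ih (LinearMap.ker π) (fd_shift k π hπ hΩ)
    exact ⟨fun h => h1.2 (e_step hD hε h01 π hπ h), fun h => h1.1 (o_step hD hdI hz h1D lam hlB hlz π hπ h)⟩

/-- no periodic class can exist when the flat dimension is finite -/
theorem no_class {g : ℕ} (y : Fin g → Q) (ε : Q →ₗ[Q] T) (hε : Function.Surjective ε) (hI : ∀ q, ε q = 0 → ∃ a, koszulD1 Q y a = q) (hI' : ∀ a, ε (koszulD1 Q y a) = 0)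
   (k : ℕ) (hT : FlatDimLE Q k T) (m : Ideal Q) (hm : ε 1 ∉ m • (⊤ : Submodule Q T)) (z : Fin g → Q) (hz : koszulD1 Q y z = 0) (hzm : ∀ i, z i ∈ m)
   (lam : LinearMap.ker (koszulD1 Q y) →ₗ[Q] T) (hlB : ∀ a : LinearMap.ker (koszulD1 Q y), a.1 ∈ Bd (koszulD1 Q y) → lam a = 0) (hlz : lam ⟨z, hz⟩ = ε 1) : False := by
  obtain ⟨Λ, _, _, D, p0, p1, o, _, _, h1, h2, h3, h4, h5⟩ := kd_exists m g y z hzm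
  refine (eo_main (D := D) (p0 := p0) (p1 := p1) (ε := ε) (fun a => by rw [h1, hz, zero_smul]) hε h4 hI hz h5 lam hlB hlz m h2 h3 hm k T hT).1 ⟨ε ∘ₗ p0, LinearMap.id, 0, fun a => ?_, fun a => by simp⟩
  rw [LinearMap.comp_apply, h4, hI']
end
end AQ

namespace AQ
section
variable {A : Type u} [CommRing A] {g : ℕ} (y : Fin g → A)

/-- vectors supported on the first k coordinates -/
def Nk (A : Type u) [CommRing A] (g k : ℕ) : Submodule A (Fin g → A) where
  carrier := {a | ∀ i : Fin g, k ≤ i.val → a i = 0}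
  zero_mem' := fun i _ => rfl
  add_mem' := fun ha hb i hi => by simp [ha i hi, hb i hi]
  smul_mem' := fun c a ha i hi => by simp [ha i hi]

theorem Nk_d (k : ℕ) (a : Fin g → A) (ha : a ∈ Nk A g k) : koszulD1 A y a ∈ Ideal.span (y '' {i | i.val < k}) := by
  rw [kD_apply]
  refine Ideal.sum_mem _ fun i _ => ?_
  by_cases h : i.val < k
  · exact Ideal.mul_mem_right _ _ (Ideal.subset_span ⟨i, h, rfl⟩)
  · rw [ha i (not_lt.1 h), mul_zero]; exact zero_mem _

theorem Nk_ex (k : ℕ) (b : A) (hb : b ∈ Ideal.span (y '' {i | i.val < k})) : ∃ a ∈ Nk A g k, koszulD1 A y a = b := by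
  have : Ideal.span (y '' {i | i.val < k}) ≤ (Nk A g k).map (koszulD1 A y) := by
    refine Ideal.span_le.2 ?_
    rintro _ ⟨i, hi, rfl⟩
    refine ⟨Pi.single i 1, fun j hj => ?_, ?_⟩
    · refine Pi.single_eq_of_ne ?_ _
      rintro rfl
      exact absurd hi (not_lt.2 hj)
    · simp [kD_apply, Pi.single_apply]
  exact this hb

theorem kD_single (i : Fin g) (t : A) : koszulD1 A y (Pi.single i t) = y i * t := by
  simp [kD_apply, Pi.single_apply]

theorem Nk_split (k : Fin g) (a : Fin g → A) (ha : a ∈ Nk A g (k+1)) : a - Pi.single k (a k) ∈ Nk A g k := by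
  intro i hi
  by_cases h : i = k
  · subst h; simp
  · rw [Pi.sub_apply, Pi.single_eq_of_ne h, sub_zero]
    exact ha i (by have : i.val ≠ k.val := fun h' => h (Fin.ext h'); omega)

theorem reg_kos (hy : Reg y) (a : Fin g → A) (ha : koszulD1 A y a = 0) : a ∈ Bd (koszulD1 A y) := by
  have key : ∀ k, k ≤ g → ∀ a, koszulD1 A y a = 0 → a ∈ Nk A g k → a ∈ Bd (koszulD1 A y) := by
    intro k
    induction k with
    | zero =>
      intro _ a _ h
      have : a = 0 := by ext i; exact h i (Nat.zero_le _)
      rw [this]; exact zero_mem _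
    | succ k ih =>
      intro hk a ha h
      let K : Fin g := ⟨k, hk⟩
      have h1 := Nk_split K a h
      have h2 : y K * a K ∈ Ideal.span (y '' {i | i.val < K.val}) := by
        have := Nk_d y _ _ h1
        rw [map_sub, ha, zero_sub, kD_single, neg_mem_iff] at this
        exact this
      obtain ⟨c, hc, hc'⟩ := Nk_ex y _ _ (hy K _ h2)
      have h3 := Bd_mem (koszulD1 A y) c (Pi.single K 1)
      rw [hc', kD_single, mul_one] at h3
      have h4 := ih (by omega) (a - (a K • Pi.single K 1 - y K • c)) (by
        have := Bd_le _ h3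
        rw [map_sub, ha, LinearMap.mem_ker.1 this, sub_zero]) (by
        have e : a - (a K • Pi.single K 1 - y K • c) = (a - Pi.single K (a K)) + y K • c := by
          rw [← Pi.single_smul, smul_eq_mul, mul_one]; abel
        rw [e]
        exact add_mem h1 (Submodule.smul_mem _ _ hc))
      have := add_mem h4 h3
      rwa [sub_add_cancel] at this
  exact key g le_rfl a ha (fun i hi => absurd i.2 (not_lt.2 hi))

/-- truncated boundaries -/
def Bk (k : ℕ) : Submodule A (Fin g → A) := Submodule.span A {m | ∃ u ∈ Nk A g k, ∃ v ∈ Nk A g k, m = koszulD1 A y u • v - koszulD1 A y v • u}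

theorem Bk_le (k : ℕ) : Bk y k ≤ Nk A g k := by
  refine Submodule.span_le.2 ?_
  rintro _ ⟨u, hu, v, hv, rfl⟩
  exact sub_mem (Submodule.smul_mem _ _ hv) (Submodule.smul_mem _ _ hu)

theorem Bk_split (k : Fin g) (x) (hx : x ∈ Bk y (k+1)) : ∃ b ∈ Bk y k, ∃ v ∈ Nk A g k, x = b + y k • v - koszulD1 A y v • Pi.single k 1 := by
  induction hx using Submodule.span_induction with
  | zero => exact ⟨0, zero_mem _, 0, zero_mem _, by simp⟩
  | add x x' _ _ h h' =>
    obtain ⟨b, hb, v, hv, rfl⟩ := h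
    obtain ⟨b', hb', v', hv', rfl⟩ := h'
    refine ⟨b + b', add_mem hb hb', v + v', add_mem hv hv', ?_⟩
    rw [map_add]; module
  | smul t x _ h =>
    obtain ⟨b, hb, v, hv, rfl⟩ := h
    refine ⟨t • b, Submodule.smul_mem _ _ hb, t • v, Submodule.smul_mem _ _ hv, ?_⟩
    rw [map_smul, smul_eq_mul]; module
  | mem _ h =>
    obtain ⟨u, hu, v, hv, rfl⟩ := h
    have hu' := Nk_split k u hu
    have hv' := Nk_split k v hv
    obtain ⟨u', hu''⟩ : ∃ u', u' = u - Pi.single k (u k) := ⟨_, rfl⟩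
    obtain ⟨v', hv''⟩ : ∃ v', v' = v - Pi.single k (v k) := ⟨_, rfl⟩
    rw [← hu''] at hu'
    rw [← hv''] at hv'
    have eu : u = u' + u k • Pi.single k 1 := by rw [hu'', ← Pi.single_smul, smul_eq_mul, mul_one]; abel
    have ev : v = v' + v k • Pi.single k 1 := by rw [hv'', ← Pi.single_smul, smul_eq_mul, mul_one]; abel
    generalize u k = s at eu
    generalize v k = t at ev
    refine ⟨koszulD1 A y u' • v' - koszulD1 A y v' • u', Submodule.subset_span ⟨u', hu', v', hv', rfl⟩, s • v' - t • u', sub_mem (Submodule.smul_mem _ _ hv') (Submodule.smul_mem _ _ hu'), ?_⟩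
    rw [eu, ev]
    simp only [map_add, map_sub, map_smul, kD_single, smul_eq_mul, mul_one]
    module

theorem kos_reg [IsLocalRing A] [IsNoetherianRing A] (hm : ∀ i, y i ∈ maximalIdeal A) (h : ∀ a, koszulD1 A y a = 0 → a ∈ Bd (koszulD1 A y)) : Reg y := by
  have key : ∀ j k, k + j = g → LinearMap.ker (koszulD1 A y) ⊓ Nk A g k ≤ Bk y k := by
    intro j
    induction j with
    | zero =>
      rintro k rfl a ⟨ha, _⟩
      have h1 := h a ha
      have : Bd (koszulD1 A y) ≤ Bk y k := by
        refine Submodule.span_mono ?_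
        rintro _ ⟨u, v, rfl⟩
        exact ⟨u, fun i hi => absurd i.2 (not_lt.2 hi), v, fun i hi => absurd i.2 (not_lt.2 hi), rfl⟩
      exact this h1
    | succ j ih =>
      intro k hk
      let K : Fin g := ⟨k, by omega⟩
      have h1 := ih (k+1) (by omega)
      refine Submodule.le_of_le_smul_of_le_jacobson_bot (I := maximalIdeal A) (IsNoetherian.noetherian _) (by rw [IsLocalRing.jacobson_eq_maximalIdeal ⊥ bot_ne_top]) ?_
      rintro a ⟨ha, hak⟩
      obtain ⟨b, hb, v, hv, e⟩ := Bk_split y K a (h1 ⟨ha, fun i hi => hak i (by omega)⟩)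
      have h2 : koszulD1 A y v = 0 := by
        have := congrFun e K
        simp [hak K le_rfl, Bk_le y _ hb K le_rfl, hv K le_rfl] at this
        exact this
      rw [e, h2, zero_smul, sub_zero]
      refine Submodule.add_mem_sup hb (Submodule.smul_mem_smul (hm K) ⟨h2, hv⟩)
  intro K b hb
  obtain ⟨c, hc, hc'⟩ := Nk_ex y _ _ hb
  have h1 := key (g - (K+1)) (K.val+1) (by omega) (x := c - Pi.single K b) ⟨by change koszulD1 A y _ = 0; rw [map_sub, kD_single, hc', sub_self], fun i hi => by
    rw [Pi.sub_apply, hc i (by omega), Pi.single_eq_of_ne (by rintro rfl; omega), sub_zero]⟩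
  obtain ⟨b', hb', v, hv, e⟩ := Bk_split y K _ h1
  have := congrFun e K
  simp [hc K le_rfl, Bk_le y _ hb' K le_rfl, hv K le_rfl] at this
  rw [this]
  exact Nk_d y _ _ hv
end
end AQ

namespace AQ
section
/-- extraction property -/
def XP {A M T : Type u} [CommRing A] [AddCommGroup M] [Module A M] [AddCommGroup T] [Module A T] (m : Ideal A) (d : M →ₗ[A] A) (o : T) : Prop :=
  ∀ z (hz : d z = 0), z ∉ m • LinearMap.ker d ⊔ Bd d → ∃ lam : LinearMap.ker d →ₗ[A] T, (∀ a : LinearMap.ker d, a.1 ∈ Bd d → lam a = 0) ∧ lam ⟨z, hz⟩ = o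

theorem xp_free {A M T : Type u} [CommRing A] [IsLocalRing A] [AddCommGroup M] [Module A M] [AddCommGroup T] [Module A T] (d : M →ₗ[A] A) (o : T) (ho : ∀ t : T, ∃ a : A, t = a • o)
   (β : Type u) (θ : LinearMap.ker d →ₗ[A] (β →₀ T)) (hθ : Function.Surjective θ) (hB : ∀ a : LinearMap.ker d, θ a = 0 ↔ a.1 ∈ Bd d) : XP (maximalIdeal A) d o := by
  intro z hz hzm
  by_cases h : ∃ b : β, ∃ a : A, IsUnit a ∧ θ ⟨z, hz⟩ b = a • o
  · obtain ⟨b, a, ⟨a, rfl⟩, hab⟩ := h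
    refine ⟨(a⁻¹ : Aˣ).1 • (Finsupp.lapply b ∘ₗ θ), fun c hc => ?_, ?_⟩
    · rw [LinearMap.smul_apply, LinearMap.comp_apply, (hB c).2 hc, map_zero, smul_zero]
    · rw [LinearMap.smul_apply, LinearMap.comp_apply, Finsupp.lapply_apply, hab, smul_smul]; simp
  · exfalso
    apply hzm
    have h1 : θ ⟨z, hz⟩ ∈ maximalIdeal A • (⊤ : Submodule A (β →₀ T)) := by
      rw [← Finsupp.sum_single (θ ⟨z, hz⟩)]
      refine Submodule.sum_mem _ fun b _ => ?_
      obtain ⟨a, ha⟩ := ho (θ ⟨z, hz⟩ b)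
      rw [ha, ← Finsupp.smul_single]
      refine Submodule.smul_mem_smul ?_ trivial
      intro hu
      exact h ⟨b, a, hu, ha⟩
    rw [← LinearMap.range_eq_top.2 hθ, ← Submodule.map_top, ← Submodule.map_smul''] at h1
    obtain ⟨c, hc, hc'⟩ := h1
    have h2 : θ (⟨z, hz⟩ - c) = 0 := by rw [map_sub, hc', sub_self]
    have h3 := (hB _).1 h2
    have h4 : c.1 ∈ maximalIdeal A • LinearMap.ker d := by
      have : Submodule.map (LinearMap.ker d).subtype (maximalIdeal A • ⊤) = maximalIdeal A • LinearMap.ker d := by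
        rw [Submodule.map_smul'', Submodule.map_top, Submodule.range_subtype]
      rw [← this]
      exact ⟨c, hc, rfl⟩
    have := Submodule.add_mem_sup h4 h3
    simpa using this

/-- transfer along g -/
theorem xp_trans {Q A M N T : Type u} [CommRing Q] [CommRing A] [IsLocalRing A] [IsLocalRing Q] [AddCommGroup M] [Module A M] [AddCommGroup T] [Module A T] [Module Q T] [AddCommGroup N] [Module Q N] 
   (g : Q →+* A) (hg : Function.Surjective g) [IsLocalHom g] (hT : ∀ q (t : T), q • t = g q • t) (d : M →ₗ[A] A) (o : T) (e : N →ₗ[Q] Q) (π : N →ₛₗ[g] M) (hd : ∀ n, d (π n) = g (e n))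
   (hZ : ∀ z, d z = 0 → ∃ n, e n = 0 ∧ π n = z) (hB : ∀ n, e n = 0 → π n ∈ Bd d → n ∈ Bd e) (h : XP (maximalIdeal A) d o) : XP (maximalIdeal Q) e o := by
  intro z hz hzm
  let r : LinearMap.ker e →ₛₗ[g] LinearMap.ker d := 
    { toFun := fun a => ⟨π a.1, by rw [LinearMap.mem_ker, hd, LinearMap.mem_ker.1 a.2, map_zero]⟩
      map_add' := fun a b => Subtype.ext (map_add π _ _)
      map_smul' := fun q a => Subtype.ext (LinearMap.map_smulₛₗ π _ _) }
  have hz' : d (π z) = 0 := by rw [hd, hz, map_zero]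
  obtain ⟨lam, h1, h2⟩ := h (π z) hz' (by
    intro hzz
    apply hzm
    obtain ⟨p, hp, b, hb, e1⟩ := Submodule.mem_sup.1 hzz
    have h3 : ∃ p' ∈ maximalIdeal Q • LinearMap.ker e, π p' = p := by
      clear e1
      induction hp using Submodule.smul_induction_on' with
      | smul a ha n hn =>
        obtain ⟨q, rfl⟩ := hg a
        obtain ⟨n', hn', rfl⟩ := hZ n hn
        refine ⟨q • n', Submodule.smul_mem_smul ?_ hn', LinearMap.map_smulₛₗ π _ _⟩
        intro hu
        exact ha (hu.map g)
      | add x _ y _ hx hy =>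
        obtain ⟨x', hx, rfl⟩ := hx
        obtain ⟨y', hy, rfl⟩ := hy
        exact ⟨x' + y', add_mem hx hy, map_add π _ _⟩
    obtain ⟨p', hp', rfl⟩ := h3
    have hk : e p' = 0 := (Submodule.smul_le_right : maximalIdeal Q • LinearMap.ker e ≤ LinearMap.ker e) hp'
    have h4 : z - p' ∈ Bd e := hB _ (by rw [map_sub, hz, hk, sub_zero]) (by rw [map_sub, ← e1, add_sub_cancel_left]; exact hb)
    have := Submodule.add_mem_sup hp' h4
    simpa using this)
  refine ⟨{ toFun := fun a => lam (r a), map_add' := fun a b => by rw [map_add, map_add], map_smul' := fun q a => ?_ }, fun a ha => ?_, ?_⟩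
  · rw [LinearMap.map_smulₛₗ, map_smul, RingHom.id_apply, hT]
  · exact h1 _ (Bd_map g e d π hd _ ha)
  · exact h2

/-- deforming by a regular sequence -/
theorem xp_def {Q A T : Type u} [CommRing Q] [CommRing A] [IsLocalRing A] [IsLocalRing Q] [AddCommGroup T] [Module A T] [Module Q T] 
   (g : Q →+* A) (hg : Function.Surjective g) [IsLocalHom g] (hT : ∀ q (t : T), q • t = g q • t) {r c : ℕ} (q : Fin r → Q) (hq : Reg q) (hk : RingHom.ker g = Ideal.span (Set.range q))
   (x : Fin c → Q) (o : T) (h : XP (maximalIdeal A) (koszulD1 A (fun i => g (x i))) o) : 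
   XP (maximalIdeal Q) (LinearMap.coprod (koszulD1 Q q) (koszulD1 Q x)) o := by
  let π : ((Fin r → Q) × (Fin c → Q)) →ₛₗ[g] (Fin c → A) := 
    { toFun := fun p i => g (p.2 i)
      map_add' := fun a b => by ext i; simp
      map_smul' := fun a b => by ext i; simp }
  have hker : ∀ a, g a = 0 → ∃ b, koszulD1 Q q b = a := by
    intro a ha
    have : a ∈ Ideal.span (Set.range q) := by rw [← hk]; exact ha
    obtain ⟨b, hb⟩ := (Submodule.mem_span_range_iff_exists_fun Q).1 this
    exact ⟨b, by rw [kD_apply, ← hb]; simp [mul_comm]⟩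
  have hker' : ∀ b, g (koszulD1 Q q b) = 0 := by
    intro b
    change _ ∈ RingHom.ker g
    rw [hk, kD_apply]
    exact Ideal.sum_mem _ fun i _ => Ideal.mul_mem_right _ _ (Ideal.subset_span ⟨i, rfl⟩)
  set e := LinearMap.coprod (koszulD1 Q q) (koszulD1 Q x) with he
  have he' : ∀ a b, e (a, b) = koszulD1 Q q a + koszulD1 Q x b := fun a b => by simp [he]
  have hgx : ∀ b, koszulD1 A (fun i => g (x i)) (fun i => g (b i)) = g (koszulD1 Q x b) := by
    intro b; simp [kD_apply]
  refine xp_trans g hg hT _ o e π ?_ ?_ ?_ h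
  · rintro ⟨a, b⟩
    rw [he', map_add, hker', zero_add]
    exact hgx b
  · intro z hz
    choose b hb using fun i => hg (z i)
    have hb' : z = fun i => g (b i) := by ext i; exact (hb i).symm
    obtain ⟨a, ha⟩ := hker (koszulD1 Q x b) (by rw [← hgx, ← hb', hz])
    refine ⟨(-a, b), ?_, hb'.symm⟩
    rw [he', map_neg, ha, neg_add_cancel]
  · rintro ⟨a, b⟩ hn hB
    -- first, lift the boundary
    have lift : ∀ m ∈ Bd (koszulD1 A (fun i => g (x i))), ∃ b' ∈ Bd (koszulD1 Q x), m = fun i => g (b' i) := by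
      intro m hm
      induction hm using Submodule.span_induction with
      | zero => exact ⟨0, zero_mem _, by ext; simp⟩
      | add m m' _ _ h h' =>
        obtain ⟨b, hb, rfl⟩ := h
        obtain ⟨b', hb', rfl⟩ := h'
        exact ⟨b + b', add_mem hb hb', by ext; simp⟩
      | smul t m _ h =>
        obtain ⟨b, hb, rfl⟩ := h
        obtain ⟨t, rfl⟩ := hg t
        exact ⟨t • b, Submodule.smul_mem _ _ hb, by ext; simp⟩
      | mem m h =>
        obtain ⟨u, v, rfl⟩ := h
        choose u' hu using fun i => hg (u i)
        choose v' hv using fun i => hg (v i)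
        obtain rfl : u = fun i => g (u' i) := by ext i; exact (hu i).symm
        obtain rfl : v = fun i => g (v' i) := by ext i; exact (hv i).symm
        refine ⟨_, Bd_mem _ u' v', ?_⟩
        rw [hgx, hgx]
        ext i; simp
    obtain ⟨b', hb', e1⟩ := lift _ hB
    have h1 : (0, b') ∈ Bd e := Bd_map (RingHom.id Q) (koszulD1 Q x) e (LinearMap.inr Q (Fin r → Q) (Fin c → Q)) (fun v => by simp [he]) b' hb'
    have h2 : ∀ i, ∃ s, koszulD1 Q q s = b i - b' i := fun i => hker _ (by rw [map_sub, sub_eq_zero]; exact congrFun e1 i)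
    choose s hs using h2
    have h3 : ∑ i, (koszulD1 Q q (s i) • ((0 : Fin r → Q), (Pi.single i 1 : Fin c → Q)) - x i • (s i, (0 : Fin c → Q))) ∈ Bd e := by
      refine Submodule.sum_mem _ fun i _ => ?_
      have := Bd_mem e (s i, 0) (0, Pi.single i 1)
      rw [he', he', map_zero, map_zero, zero_add, add_zero, kD_single, mul_one] at this
      exact this
    have e4 : (a, b) - (0, b') - ∑ i, (koszulD1 Q q (s i) • ((0 : Fin r → Q), (Pi.single i 1 : Fin c → Q)) - x i • (s i, (0 : Fin c → Q))) = (a + ∑ i, x i • s i, 0) := by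
      ext j
      · simp [Prod.fst_sum]
      · simp [Prod.snd_sum, hs, Pi.single_apply]
    have e5 : e (a + ∑ i, x i • s i, 0) = 0 := by
      rw [← e4, map_sub, map_sub, hn, LinearMap.mem_ker.1 (Bd_le e h1), LinearMap.mem_ker.1 (Bd_le e h3)]; simp
    rw [he', map_zero, add_zero] at e5
    have h6 : (a + ∑ i, x i • s i, (0 : Fin c → Q)) ∈ Bd e := Bd_map (RingHom.id Q) (koszulD1 Q q) e (LinearMap.inl Q (Fin r → Q) (Fin c → Q)) (fun v => by simp [he]) _ (reg_kos q hq _ e5)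
    rw [← e4] at h6
    have := add_mem (add_mem h6 h3) h1
    simpa using this

/-- minimal generators -/
theorem min_gens {Q : Type u} [CommRing Q] [IsLocalRing Q] (I : Ideal Q) (hI : I.FG) : ∃ (g : ℕ) (y : Fin g → Q), Ideal.span (Set.range y) = I ∧ ∀ z, koszulD1 Q y z = 0 → ∀ i, z i ∈ maximalIdeal Q := by
  classical
  have hex : ∃ g : ℕ, ∃ y : Fin g → Q, Ideal.span (Set.range y) = I := by
    obtain ⟨n, y, hy⟩ := Submodule.fg_iff_exists_fin_generating_family.1 hI
    exact ⟨n, y, hy⟩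
  obtain ⟨y, hy⟩ := Nat.find_spec hex
  have hmin : ∀ m < Nat.find hex, ¬ ∃ y : Fin m → Q, Ideal.span (Set.range y) = I := fun m => Nat.find_min hex
  generalize Nat.find hex = g at y hy hmin
  refine ⟨g, y, hy, fun z hz i hu => ?_⟩
  cases g with
  | zero => exact i.elim0
  | succ n =>
    refine hmin n (Nat.lt_succ_self n) ⟨fun j => y (i.succAbove j), le_antisymm ?_ ?_⟩
    · rw [← hy]
      exact Ideal.span_mono (Set.range_comp_subset_range _ _)
    · rw [← hy]
      refine Ideal.span_le.2 ?_
      have h1 : ∀ j, y (i.succAbove j) ∈ Ideal.span (Set.range fun j => y (i.succAbove j)) := fun j => Ideal.subset_span ⟨j, rfl⟩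
      rintro _ ⟨j, rfl⟩
      rcases Fin.eq_self_or_eq_succAbove i j with rfl | ⟨j, rfl⟩
      · rw [kD_apply, Fin.sum_univ_succAbove _ j] at hz
        have h2 : y j * z j ∈ Ideal.span (Set.range fun k => y (j.succAbove k)) := by
          rw [eq_neg_of_add_eq_zero_left hz, neg_mem_iff]
          exact Ideal.sum_mem _ fun k _ => Ideal.mul_mem_right _ _ (h1 k)
        exact (Ideal.mul_unit_mem_iff_mem _ hu).1 h2
      · exact h1 j

theorem xp_min {Q N T : Type u} [CommRing Q] [IsLocalRing Q] [IsNoetherianRing Q] [AddCommGroup N] [Module Q N] [Module.Free Q N] [AddCommGroup T] [Module Q T] (e : N →ₗ[Q] Q) {g : ℕ} (y : Fin g → Q) 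
   (hy : Ideal.span (Set.range y) = LinearMap.range e) (hm : ∀ z, koszulD1 Q y z = 0 → ∀ i, z i ∈ maximalIdeal Q) (o : T) (h : XP (maximalIdeal Q) e o) :
   XP (maximalIdeal Q) (koszulD1 Q y) o := by
  have hr : LinearMap.range (koszulD1 Q y) = LinearMap.range e := by
    rw [← hy]
    ext a
    rw [LinearMap.mem_range]
    refine Iff.trans ?_ (Submodule.mem_span_range_iff_exists_fun Q).symm
    refine exists_congr fun b => ?_
    rw [kD_apply]; simp [mul_comm]
  have lift : ∀ {G H : Type u} [AddCommGroup G] [Module Q G] [Module.Free Q G] [AddCommGroup H] [Module Q H] (u : G →ₗ[Q] Q) (d : H →ₗ[Q] Q) (_ : LinearMap.range u = LinearMap.range d), ∃ h' : G →ₗ[Q] H, ∀ a, d (h' a) = u a := by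
    intro G H _ _ _ _ _ u d hh
    obtain ⟨h', hh'⟩ := Module.projective_lifting_property (d.codRestrict (LinearMap.range d) (fun c => ⟨c, rfl⟩)) (u.codRestrict (LinearMap.range d) (fun c => by rw [← hh]; exact ⟨c, rfl⟩)) 
      (by rintro ⟨_, c, rfl⟩; exact ⟨c, rfl⟩)
    exact ⟨h', fun a => congrArg Subtype.val (LinearMap.congr_fun hh' a)⟩
  obtain ⟨α, hα⟩ := lift (koszulD1 Q y) e hr
  obtain ⟨β, hβ⟩ := lift e (koszulD1 Q y) hr.symm
  have hsurj : Function.Surjective (β ∘ₗ α) := by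
    rw [← LinearMap.range_eq_top, eq_top_iff]
    refine Submodule.le_of_le_smul_of_le_jacobson_bot (I := maximalIdeal Q) (IsNoetherian.noetherian _) (by rw [IsLocalRing.jacobson_eq_maximalIdeal ⊥ bot_ne_top]) ?_
    intro a _
    have h1 : koszulD1 Q y (a - β (α a)) = 0 := by rw [map_sub, hβ, hα, sub_self]
    have h2 : a - β (α a) ∈ maximalIdeal Q • (⊤ : Submodule Q (Fin g → Q)) := by
      rw [← Finset.univ_sum_single (a - β (α a))]
      refine Submodule.sum_mem _ fun i _ => ?_
      have : (Pi.single i ((a - β (α a)) i) : Fin g → Q) = ((a - β (α a)) i) • Pi.single i 1 := by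
        rw [← Pi.single_smul, smul_eq_mul, mul_one]
      rw [this]
      exact Submodule.smul_mem_smul (hm _ h1 i) trivial
    have := Submodule.add_mem_sup (show (β ∘ₗ α) a ∈ LinearMap.range (β ∘ₗ α) from ⟨a, rfl⟩) h2
    simpa using this
  have hinj := OrzechProperty.injective_of_surjective_endomorphism (β ∘ₗ α) hsurj
  let τ := LinearEquiv.ofBijective (β ∘ₗ α) ⟨hinj, hsurj⟩
  let β' : N →ₗ[Q] (Fin g → Q) := τ.symm.toLinearMap ∘ₗ β
  have hβα : ∀ a, β' (α a) = a := fun a => τ.symm_apply_apply a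
  have hβ' : ∀ n, koszulD1 Q y (β' n) = e n := by
    intro n
    have h1 : koszulD1 Q y (τ (β' n)) = koszulD1 Q y (β' n) := by
      change koszulD1 Q y (β (α _)) = _
      rw [hβ, hα]
    have h2 : τ (β' n) = β n := τ.apply_symm_apply _
    rw [← h1, h2, hβ]
  intro z hz hzm
  obtain ⟨lam, h1, h2⟩ := h (α z) ((hα z).trans hz) (by
    intro h
    apply hzm
    obtain ⟨p, hp, b, hb, e1⟩ := Submodule.mem_sup.1 h
    rw [← hβα z, ← e1, map_add]
    refine Submodule.add_mem_sup ?_ (Bd_map (RingHom.id Q) e _ β' hβ' _ hb)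
    have : maximalIdeal Q • LinearMap.ker e ≤ (maximalIdeal Q • LinearMap.ker (koszulD1 Q y)).comap β' := by
      rw [← Submodule.map_le_iff_le_comap, Submodule.map_smul'']
      refine Submodule.smul_mono le_rfl ?_
      rintro _ ⟨n, hn, rfl⟩
      exact (hβ' n).trans hn
    exact this hp)
  refine ⟨lam ∘ₗ (α ∘ₗ Submodule.subtype _).codRestrict _ (fun a => (hα _).trans a.2), fun a ha => h1 _ ?_, h2⟩
  exact Bd_map (RingHom.id Q) _ e α hα _ ha
end
end AQ

namespace AQ
section
variable {A : Type u} [CommRing A]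
theorem Bd_eq {c : ℕ} (x : Fin c → A) : koszulB1 A x = Bd (koszulD1 A x) := by
  apply le_antisymm
  · refine Submodule.span_le.2 ?_
    rintro _ ⟨i, j, rfl⟩
    have := Bd_mem (koszulD1 A x) (Pi.single i 1) (Pi.single j 1)
    simpa [kD_apply, Pi.single_apply] using this
  · refine Submodule.span_le.2 ?_
    rintro _ ⟨u, v, rfl⟩
    have : koszulD1 A x u • v - koszulD1 A x v • u = ∑ i, ∑ j, (u i * v j) • (x i • (Pi.single j (1 : A) : Fin c → A) - x j • (Pi.single i (1 : A) : Fin c → A)) := by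
      ext k
      simp only [kD_apply, Pi.sub_apply, Pi.smul_apply, smul_eq_mul, Finset.sum_apply, Pi.single_apply, mul_sub, Finset.sum_sub_distrib, mul_ite, mul_one, mul_zero, Finset.sum_ite_eq, Finset.mem_univ, if_true, Finset.sum_mul]
      congr 1
      · exact Finset.sum_congr rfl fun i _ => by ring
      · rw [Finset.sum_comm]
        simp only [Finset.sum_ite_eq, Finset.mem_univ, if_true]
        exact Finset.sum_congr rfl fun i _ => by ring
    change _ ∈ koszulB1 A x
    rw [this]
    exact Submodule.sum_mem _ fun i _ => Submodule.sum_mem _ fun j _ => Submodule.smul_mem _ _ (Submodule.subset_span ⟨i, j, rfl⟩)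

theorem theta0 {S : Type u} [CommRing S] [Algebra A S] (hs : Function.Surjective (algebraMap A S)) {c : ℕ} (x : Fin c → A) 
    (hx : Ideal.span (Set.range x) = RingHom.ker (algebraMap A S)) (hf : Module.Free S (S ⊗[A] KoszulH1 A x)) : 
    ∃ (β : Type u) (θ : LinearMap.ker (koszulD1 A x) →ₗ[A] (β →₀ S)), Function.Surjective θ ∧ ∀ a, θ a = 0 ↔ a.1 ∈ Bd (koszulD1 A x) := by
  let π : LinearMap.ker (koszulD1 A x) →ₗ[A] KoszulH1 A x := ((koszulB1 A x).comap (koszulZ1 A x).subtype).mkQ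
  have hπ : Function.Surjective π := Submodule.mkQ_surjective ((koszulB1 A x).comap (koszulZ1 A x).subtype)
  have hπ0 : ∀ a, π a = 0 ↔ a.1 ∈ Bd (koszulD1 A x) := by
    intro a
    rw [← Bd_eq]
    exact Submodule.Quotient.mk_eq_zero _
  have hJ : ∀ a ∈ RingHom.ker (algebraMap A S), ∀ h : KoszulH1 A x, a • h = 0 := by
    intro a ha h
    obtain ⟨z, rfl⟩ := hπ h
    rw [← map_smul, hπ0]
    rw [← hx] at ha
    obtain ⟨u, hu⟩ := (Submodule.mem_span_range_iff_exists_fun A).1 ha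
    have h1 : koszulD1 A x u = a := by rw [kD_apply, ← hu]; simp [mul_comm]
    have h2 := Bd_mem (koszulD1 A x) u z.1
    rw [h1, LinearMap.mem_ker.1 z.2, zero_smul, sub_zero] at h2
    exact h2
  let μ : KoszulH1 A x →ₗ[A] S ⊗[A] KoszulH1 A x := TensorProduct.mk A S _ 1
  have hμ : Function.Surjective μ := by
    intro t
    induction t with
    | zero => exact ⟨0, map_zero _⟩
    | add t t' h h' =>
      obtain ⟨a, rfl⟩ := h
      obtain ⟨b, rfl⟩ := h'
      exact ⟨a + b, map_add _ _ _⟩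
    | tmul s h =>
      obtain ⟨a, rfl⟩ := hs s
      refine ⟨a • h, ?_⟩
      change (1 : S) ⊗ₜ[A] (a • h) = _
      rw [← TensorProduct.smul_tmul, Algebra.algebraMap_eq_smul_one]
  have hμi : Function.Injective μ := by
    choose σ hσ using hs
    let ρ : S →ₗ[A] KoszulH1 A x →ₗ[A] KoszulH1 A x := 
      { toFun := fun s => σ s • LinearMap.id
        map_add' := fun s t => by
          ext h
          have := hJ (σ (s + t) - (σ s + σ t)) (by rw [RingHom.mem_ker]; simp [hσ]) h
          rw [sub_smul, sub_eq_zero] at this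
          rw [← add_smul]; exact this
        map_smul' := fun a t => by
          ext h
          have := hJ (σ (a • t) - a * σ t) (by rw [RingHom.mem_ker]; simp [hσ, Algebra.smul_def]) h
          rw [sub_smul, sub_eq_zero, mul_smul] at this
          exact this }
    have : ∀ h, TensorProduct.lift ρ (μ h) = h := by
      intro h
      change σ 1 • h = h
      have := hJ (σ 1 - 1) (by rw [RingHom.mem_ker]; simp [hσ]) h
      rw [sub_smul, sub_eq_zero, one_smul] at this
      exact this
    exact Function.LeftInverse.injective this
  let b := (Module.Free.chooseBasis S (S ⊗[A] KoszulH1 A x)).repr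
  refine ⟨_, (b.toLinearMap.restrictScalars A) ∘ₗ μ ∘ₗ π, b.surjective.comp (hμ.comp hπ), fun a => ?_⟩
  rw [← hπ0]
  constructor
  · intro h
    have h1 : b (μ (π a)) = b 0 := by rw [map_zero]; exact h
    exact hμi ((b.injective h1).trans (map_zero μ).symm)
  · intro h
    change b (μ (π a)) = 0
    rw [h, map_zero, map_zero]

theorem kerEq {A' : Type u} [CommRing A'] [Algebra A A'] [Module.Flat A A'] {c : ℕ} (x : Fin c → A) (d : (Fin c → A) →ₗ[A] A) (hd : d = koszulD1 A x)
    (d' : (Fin c → A') →ₗ[A'] A') (hd' : d' = koszulD1 A' (fun i => algebraMap A A' (x i))) :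
    ∃ Ψ : A' ⊗[A] LinearMap.ker d ≃ₗ[A'] LinearMap.ker d', ∀ t z, (Ψ (t ⊗ₜ z)).1 = fun i => z.1 i • t := by
  let e := TensorProduct.piScalarRight A A' A' (Fin c)
  have he : ∀ t (v : Fin c → A), e (t ⊗ₜ v) = fun i => v i • t := fun t v => by ext i; simp [e]
  let ψ : A' ⊗[A] LinearMap.ker d →ₗ[A'] (Fin c → A') := e.toLinearMap ∘ₗ LinearMap.baseChange A' (LinearMap.ker d).subtype
  have hψ1 : ∀ t z, ψ (t ⊗ₜ z) = fun i => z.1 i • t := fun t z => he t z.1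
  have hψi : Function.Injective ψ := e.injective.comp (Module.Flat.lTensor_preserves_injective_linearMap (M := A') (LinearMap.ker d).subtype (Submodule.injective_subtype _))
  have hde : ∀ t, d' (e t) = TensorProduct.rid A A' (LinearMap.lTensor A' d t) := by
    intro t
    induction t with
    | zero => simp
    | add s t h h' => simp only [map_add, h, h']
    | tmul t v =>
      rw [he, LinearMap.lTensor_tmul, TensorProduct.rid_tmul, hd', kD_apply, hd, kD_apply, Finset.sum_smul]
      refine Finset.sum_congr rfl fun i _ => ?_
      rw [Algebra.smul_def, Algebra.smul_def, map_mul, mul_assoc]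
  have hex : Function.Exact (LinearMap.lTensor A' (LinearMap.ker d).subtype) (LinearMap.lTensor A' d) := Module.Flat.lTensor_exact A' (fun v => by simp)
  have hψk : ∀ t, ψ t ∈ LinearMap.ker d' := by
    intro t
    rw [LinearMap.mem_ker]
    refine (hde _).trans ?_
    have : LinearMap.lTensor A' d (LinearMap.baseChange A' (LinearMap.ker d).subtype t) = 0 := (hex _).2 ⟨t, rfl⟩
    rw [this, map_zero]
  let Ψ : A' ⊗[A] LinearMap.ker d ≃ₗ[A'] LinearMap.ker d' := LinearEquiv.ofBijective (ψ.codRestrict _ hψk) ⟨fun a b h => hψi (congrArg Subtype.val h), by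
    rintro ⟨z, hz⟩
    have h1 := hde (e.symm z)
    rw [e.apply_symm_apply, LinearMap.mem_ker.1 hz] at h1
    have h2 : LinearMap.lTensor A' d (e.symm z) = 0 := (TensorProduct.rid A A').injective (h1.symm.trans (map_zero _).symm)
    obtain ⟨t, ht⟩ := (hex _).1 h2
    refine ⟨t, Subtype.ext ?_⟩
    have : e (LinearMap.lTensor A' (LinearMap.ker d).subtype t) = z := by rw [ht, e.apply_symm_apply]
    exact this⟩
  exact ⟨Ψ, hψ1⟩

theorem lexK {M N : Type u} [AddCommGroup M] [Module A M] [AddCommGroup N] [Module A N] (A' : Type u) [CommRing A'] [Algebra A A'] (θ : M →ₗ[A] N) (hθ : Function.Surjective θ) :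
    Function.Exact (LinearMap.lTensor A' (LinearMap.ker θ).subtype) (LinearMap.lTensor A' θ) := _root_.lTensor_exact A' (LinearMap.exact_subtype_ker_map θ) hθ

theorem theta' {S A' : Type u} [CommRing S] [Algebra A S] [CommRing A'] [Algebra A A'] [Module.Flat A A'] {c : ℕ} (x : Fin c → A) (d : (Fin c → A) →ₗ[A] A) (hd : d = koszulD1 A x)
    (d' : (Fin c → A') →ₗ[A'] A') (hd' : d' = koszulD1 A' (fun i => algebraMap A A' (x i)))
    (β : Type u) (θ : LinearMap.ker d →ₗ[A] (β →₀ S)) (hθ : Function.Surjective θ) (hB : ∀ a, θ a = 0 ↔ a.1 ∈ Bd d) :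
    ∃ θ' : LinearMap.ker d' →ₗ[A'] (β →₀ (A' ⊗[A] S)), Function.Surjective θ' ∧ 
      ∀ a, θ' a = 0 ↔ a.1 ∈ Bd d' := by
  classical
  obtain ⟨Ψ, hψ1⟩ := kerEq (A' := A') x d hd d' hd'
  obtain ⟨F⟩ : Nonempty ((A' ⊗[A] (β →₀ S)) ≃ₗ[A'] (β →₀ (A' ⊗[A] S))) := ⟨TensorProduct.finsuppRight A A' A' S β⟩
  refine ⟨F.toLinearMap ∘ₗ LinearMap.baseChange A' θ ∘ₗ Ψ.symm.toLinearMap, F.surjective.comp ((LinearMap.lTensor_surjective A' hθ).comp Ψ.symm.surjective), fun a => ?_⟩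
  obtain ⟨t, rfl⟩ := Ψ.surjective a
  have h0 : (F.toLinearMap ∘ₗ LinearMap.baseChange A' θ ∘ₗ Ψ.symm.toLinearMap) (Ψ t) = F (LinearMap.lTensor A' θ t) := by
    simp only [LinearMap.comp_apply, LinearEquiv.coe_coe, Ψ.symm_apply_apply]; rfl
  rw [h0]
  have hex2 : Function.Exact (LinearMap.lTensor A' (LinearMap.ker θ).subtype) (LinearMap.lTensor A' θ) := lexK A' θ hθ
  have key : F (LinearMap.lTensor A' θ t) = 0 ↔ ∃ s, LinearMap.lTensor A' (LinearMap.ker θ).subtype s = t := 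
    ⟨fun h => (hex2 _).1 (F.injective (h.trans (map_zero F).symm)), fun h => by rw [(hex2 _).2 h, map_zero]⟩
  rw [key]
  obtain ⟨ω, hω'⟩ : ∃ ω : A' ⊗[A] LinearMap.ker θ →ₗ[A'] (Fin c → A'), ∀ s, ω s = (Ψ (LinearMap.lTensor A' (LinearMap.ker θ).subtype s)).1 := ⟨(LinearMap.ker d').subtype ∘ₗ Ψ.toLinearMap ∘ₗ LinearMap.baseChange A' (LinearMap.ker θ).subtype, fun s => rfl⟩
  have hω : ∀ t z, ω (t ⊗ₜ z) = fun i => z.1.1 i • t := fun t z => (hω' _).trans (hψ1 t z.1)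
  constructor
  · rintro ⟨s, rfl⟩
    rw [← hω']
    clear h0 key
    induction s with
    | zero => rw [map_zero]; exact zero_mem _
    | add s t h h' => rw [map_add]; exact add_mem h h'
    | tmul t z =>
      rw [hω]
      let φ : (Fin c → A) →ₛₗ[algebraMap A A'] (Fin c → A') := 
        { toFun := fun v i => algebraMap A A' (v i)
          map_add' := fun a b => by ext i; simp
          map_smul' := fun a b => by ext i; simp }
      have h1 := Bd_map (algebraMap A A') d d' φ (fun v => by
        change d' (fun i => algebraMap A A' (v i)) = _
        rw [hd, hd', kD_apply, kD_apply, map_sum]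
        simp) z.1.1 ((hB _).1 z.2)
      have h2 : (fun i => z.1.1 i • t) = t • φ z.1.1 := by
        ext i
        change z.1.1 i • t = t * algebraMap A A' (z.1.1 i)
        rw [Algebra.smul_def, mul_comm]
      rw [h2]
      exact Submodule.smul_mem _ _ h1
  · intro h
    have : Bd d' ≤ LinearMap.range ω := by
      rw [hd', ← Bd_eq]
      refine Submodule.span_le.2 ?_
      rintro _ ⟨i, j, rfl⟩
      have hm : x i • (Pi.single j (1 : A) : Fin c → A) - x j • (Pi.single i (1 : A) : Fin c → A) ∈ Bd d := by
        rw [hd, ← Bd_eq]; exact Submodule.subset_span ⟨i, j, rfl⟩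
      refine ⟨1 ⊗ₜ ⟨⟨_, Bd_le d hm⟩, (hB _).2 hm⟩, ?_⟩
      rw [hω]
      ext k
      simp only [Pi.sub_apply, Pi.smul_apply, Pi.single_apply, smul_eq_mul]
      split_ifs <;> simp [Algebra.smul_def]
    obtain ⟨s, hs⟩ := this h
    exact ⟨s, Ψ.injective (Subtype.ext ((hω' s).symm.trans hs))⟩
end
end AQ

namespace AQ
section
theorem reg_list {Q : Type u} [CommRing Q] (rs : List Q) (h : RingTheory.Sequence.IsRegular Q rs) : Reg (fun i : Fin rs.length => rs.get i) := by
  intro k a ha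
  have h1 := h.regular_mod_prev k.1 k.2
  have h2 : (Ideal.ofList (rs.take k.1) • ⊤ : Submodule Q Q) = Ideal.span ((fun i : Fin rs.length => rs.get i) '' {i | i.val < k.val}) := by
    rw [smul_eq_mul, Ideal.mul_top]
    change Ideal.span _ = _
    congr 1
    ext b
    simp only [Set.mem_setOf_eq, Set.mem_image, List.mem_take_iff_getElem]
    constructor
    · rintro ⟨j, hj, rfl⟩
      exact ⟨⟨j, by omega⟩, by simp; omega, by simp⟩
    · rintro ⟨j, hj, rfl⟩
      exact ⟨j.1, by have := j.2; omega, by simp⟩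
  rw [← h2] at ha ⊢
  rw [← Submodule.Quotient.mk_eq_zero] at ha ⊢
  refine h1 ?_
  change rs[k.1] • _ = rs[k.1] • _
  rw [smul_zero, ← Submodule.Quotient.mk_smul]
  exact ha

theorem van_mono {A S : Type u} [CommRing A] [CommRing S] [Algebra A S] {k l : ℕ} (hkl : k ≤ l) (h : Van A S k) : Van A S l := 
  fun N _ _ n hn => h N n (hkl.trans hn)

theorem kD_range {Q : Type u} [CommRing Q] {g : ℕ} (y : Fin g → Q) : LinearMap.range (koszulD1 Q y) = Ideal.span (Set.range y) := by
  ext a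
  refine Iff.trans ?_ (Submodule.mem_span_range_iff_exists_fun Q).symm
  rw [LinearMap.mem_range]
  refine exists_congr fun v => ?_
  rw [kD_apply]
  simp [mul_comm]

theorem vanT {Q B T : Type u} [CommRing Q] [CommRing B] [CommRing T] [Algebra Q B] [Algebra B T] [IsLocalRing Q] [IsLocalRing B] [IsNoetherianRing Q] [Nontrivial T] 
    [IsLocalHom (algebraMap Q B)] (hg : Function.Surjective (algebraMap Q B)) (hs : Function.Surjective (algebraMap B T)) {r : ℕ} (q : Fin r → Q) (hq : Reg q) 
    (hk : RingHom.ker (algebraMap Q B) = Ideal.span (Set.range q)) {c : ℕ} (x : Fin c → B) (hx : Ideal.span (Set.range x) = RingHom.ker (algebraMap B T)) 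
    (h : XP (maximalIdeal B) (koszulD1 B x) (1 : T)) (k : ℕ) (hT : letI : Module Q T := Module.compHom _ (algebraMap Q B); FlatDimLE Q k T) : Van B T 2 := by
  letI : Algebra Q T := Algebra.compHom _ (algebraMap Q B)
  haveI : IsScalarTower Q B T := IsScalarTower.of_algebraMap_eq (fun a => rfl)
  choose x' hx' using fun i => hg (x i)
  have hxx : x = fun i => algebraMap Q B (x' i) := by ext i; exact (hx' i).symm
  rw [hxx] at h
  have h1 := xp_def (algebraMap Q B) hg (fun q t => (algebraMap_smul B q t).symm) q hq hk x' (1 : T) h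
  have hsT : Function.Surjective (algebraMap Q T) := by
    rw [IsScalarTower.algebraMap_eq Q B T]; exact hs.comp hg
  let I := RingHom.ker (algebraMap Q T)
  have hI : I = LinearMap.range (LinearMap.coprod (koszulD1 Q q) (koszulD1 Q x')) := by
    rw [LinearMap.range_coprod, kD_range, kD_range, ← hk]
    have e1 : I = (RingHom.ker (algebraMap B T)).comap (algebraMap Q B) := by
      ext a
      rw [Ideal.mem_comap, RingHom.mem_ker, RingHom.mem_ker, ← IsScalarTower.algebraMap_apply]
    have e2 : RingHom.ker (algebraMap B T) = (Ideal.span (Set.range x')).map (algebraMap Q B) := by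
      rw [Ideal.map_span, ← hx, hxx, ← Set.range_comp]; rfl
    rw [e1, e2, Ideal.comap_map_of_surjective _ hg, sup_comm]
    rfl
  obtain ⟨g, y, hy, hym⟩ := min_gens I (IsNoetherian.noetherian I)
  have h2 := xp_min _ y (hy.trans hI) hym (1 : T) h1
  have hIm : I ≤ maximalIdeal Q := IsLocalRing.le_maximalIdeal (RingHom.ker_ne_top _)
  have hyI : ∀ i, y i ∈ I := fun i => by rw [← hy]; exact Ideal.subset_span ⟨i, rfl⟩
  let ε : Q →ₗ[Q] T := Algebra.linearMap Q T
  have hε1 : ε 1 = 1 := map_one (algebraMap Q T)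
  have hm : ε 1 ∉ maximalIdeal Q • (⊤ : Submodule Q T) := by
    intro hh
    have : (⊤ : Submodule Q T) = Submodule.map ε ⊤ := by rw [Submodule.map_top]; exact (LinearMap.range_eq_top.2 hsT).symm
    rw [this, ← Submodule.map_smul'', smul_eq_mul, Ideal.mul_top] at hh
    obtain ⟨a, ha, ha'⟩ := hh
    have h3 : 1 - a ∈ I := by
      have : ε (1 - a) = 0 := by rw [map_sub, ha', sub_self]
      exact this
    have := add_mem (hIm h3) ha
    rw [sub_add_cancel] at this
    exact (Ideal.ne_top_iff_one _).1 (maximalIdeal.isMaximal Q).ne_top this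
  have hkos : ∀ a, koszulD1 Q y a = 0 → a ∈ Bd (koszulD1 Q y) := by
    have : LinearMap.ker (koszulD1 Q y) ≤ Bd (koszulD1 Q y) := by
      refine Submodule.le_of_le_smul_of_le_jacobson_bot (I := maximalIdeal Q) (IsNoetherian.noetherian _) (IsLocalRing.maximalIdeal_le_jacobson _) ?_
      intro z hz
      by_contra hn
      obtain ⟨lam, hl1, hl2⟩ := h2 z hz (by rwa [sup_comm])
      refine no_class y ε hsT (fun a ha => ?_) (fun a => ?_) k hT (maximalIdeal Q) hm z hz (hym z hz) lam hl1 (hl2.trans hε1.symm)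
      · have : a ∈ I := ha
        rw [← hy, ← kD_range] at this
        exact this
      · have : koszulD1 Q y a ∈ I := by
          rw [← hy, ← kD_range]; exact ⟨a, rfl⟩
        exact this
    exact fun a ha => this ha
  have hreg := kos_reg y (fun i => hIm (hyI i)) hkos
  exact JZ Q B T 1 (van_reg hg q hq hk) (van_mono one_le_two (van_reg hsT y hreg hy.symm))

theorem ker_bc {R S R' : Type u} [CommRing R] [CommRing S] [Algebra R S] (hsur : Function.Surjective (algebraMap R S)) {c : ℕ} (x : Fin c → R)
    (hx : Ideal.span (Set.range x) = RingHom.ker (algebraMap R S)) [CommRing R'] [Algebra R R'] : 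
    Ideal.span (Set.range fun i => algebraMap R R' (x i)) = RingHom.ker (algebraMap R' (R' ⊗[R] S)) := by
  have e : ∀ a ∈ RingHom.ker (algebraMap R S), algebraMap R R' a ∈ Ideal.span (Set.range fun i => algebraMap R R' (x i)) := by
    intro a ha
    rw [← hx] at ha
    have := Ideal.mem_map_of_mem (algebraMap R R') ha
    rw [Ideal.map_span, ← Set.range_comp] at this
    exact this
  apply le_antisymm
  · refine Ideal.span_le.2 ?_
    rintro _ ⟨i, rfl⟩
    have h0 : algebraMap R S (x i) = 0 := by
      rw [← RingHom.mem_ker, ← hx]; exact Ideal.subset_span ⟨i, rfl⟩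
    change (algebraMap R R' (x i)) ⊗ₜ[R] (1 : S) = 0
    rw [Algebra.algebraMap_eq_smul_one, TensorProduct.smul_tmul, ← Algebra.algebraMap_eq_smul_one, h0, TensorProduct.tmul_zero]
  · intro a ha
    have hex := lexK R' (Algebra.linearMap R S) hsur
    have h1 : LinearMap.lTensor R' (Algebra.linearMap R S) (a ⊗ₜ 1) = 0 := by
      rw [LinearMap.lTensor_tmul, Algebra.linearMap_apply, map_one]
      exact ha
    obtain ⟨s, hs⟩ := (hex _).1 h1
    have h2 : a = TensorProduct.rid R R' (a ⊗ₜ 1) := by simp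
    rw [h2, ← hs]
    clear hs h1 h2
    induction s with
    | zero => simp
    | add s t h h' => rw [map_add, map_add]; exact add_mem h h'
    | tmul t z =>
      rw [LinearMap.lTensor_tmul, TensorProduct.rid_tmul, Algebra.smul_def]
      exact Ideal.mul_mem_right _ _ (e _ z.2)

theorem vanS {R S R' Q : Type u} [CommRing R] [CommRing S] [IsLocalRing R] [IsLocalRing S] [Algebra R S] (hsur : Function.Surjective (algebraMap R S)) {c : ℕ} (x : Fin c → R)
    (hx : Ideal.span (Set.range x) = RingHom.ker (algebraMap R S)) (hfree : Module.Free S (S ⊗[R] KoszulH1 R x)) [CommRing R'] [CommRing Q] [Algebra R R'] [Algebra Q R'] [IsLocalRing R'] [IsLocalRing Q]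
    [IsNoetherianRing Q] [IsLocalHom (algebraMap R R')] [IsLocalHom (algebraMap Q R')] [Module.Flat R R'] (hg : Function.Surjective (algebraMap Q R')) 
    (hq : GeneratedByRegularSequence Q (RingHom.ker (algebraMap Q R'))) (k : ℕ) (hT : letI : Module Q (R' ⊗[R] S) := Module.compHom _ (algebraMap Q R'); FlatDimLE Q k (R' ⊗[R] S)) : Van R S 2 := by
  haveI : Module.FaithfullyFlat R R' := Module.FaithfullyFlat.of_flat_of_isLocalHom
  refine van_descent (R' := R') 2 ?_
  obtain ⟨rs, hrs, hrk⟩ := hq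
  obtain ⟨β, θ, hθ, hB⟩ := theta0 hsur x hx hfree
  obtain ⟨θ', hθ', hB'⟩ := theta' (A' := R') x _ rfl _ rfl β θ hθ hB
  have hs : Function.Surjective (algebraMap R' (R' ⊗[R] S)) := by
    intro t
    induction t with
    | zero => exact ⟨0, map_zero _⟩
    | add a b ha hb =>
      obtain ⟨a, rfl⟩ := ha
      obtain ⟨b, rfl⟩ := hb
      exact ⟨a + b, map_add _ _ _⟩
    | tmul t s =>
      obtain ⟨a, rfl⟩ := hsur s
      refine ⟨a • t, ?_⟩
      change (a • t) ⊗ₜ[R] (1 : S) = _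
      rw [TensorProduct.smul_tmul, Algebra.algebraMap_eq_smul_one]
  have hxp := xp_free _ (1 : R' ⊗[R] S) (fun t => by
    obtain ⟨a, rfl⟩ := hs t
    exact ⟨a, Algebra.algebraMap_eq_smul_one a⟩) β θ' hθ' hB'
  haveI : Nontrivial (R' ⊗[R] S) := Module.FaithfullyFlat.lTensor_nontrivial R R' S
  refine vanT (Q := Q) hg hs (fun i : Fin rs.length => rs.get i) (reg_list rs hrs) ?_ (fun i => algebraMap R R' (x i)) ?_ hxp k hT
  · rw [← hrk]
    congr 1
    ext a
    simp [List.mem_iff_get]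
  · exact ker_bc hsur x hx
end
end AQ

/-- (Corollary 3.3) If `φ : R → S` is surjective, `CI-dim_R S < ∞` and `H₁` of the
Koszul complex on a generating set of `ker φ` is a free `S`-module, then
`AQ-dim_R S ≤ 2`. -/
theorem aqdim_le_two_of_surjective_koszulH1_free
    (R S : Type u) [CommRing R] [CommRing S]
    [IsLocalRing R] [IsLocalRing S] [IsNoetherianRing R] [IsNoetherianRing S]
    [Algebra R S] [IsLocalHom (algebraMap R S)]
    (hsur : Function.Surjective (algebraMap R S))
    {c : ℕ} (x : Fin c → R)
    (hx : Ideal.span (Set.range x) = RingHom.ker (algebraMap R S))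
    (hfd : HasFiniteCIDim R S)
    (hfree : Module.Free S (S ⊗[R] KoszulH1 R x)) :
    AQdimLE R S 2 := by
  obtain ⟨R', Q, _, _, f, g, hqd, hfin⟩ := hfd
  obtain ⟨_, _, _, _, hf, hg, hflat, hgs, hreg⟩ := hqd
  letI := f.toAlgebra
  letI := g.toAlgebra
  obtain ⟨⟨k, hk⟩, -⟩ := hfin
  haveI : IsLocalHom (algebraMap R R') := hf
  haveI : IsLocalHom (algebraMap Q R') := hg
  haveI : Module.Flat R R' := hflat
  have hV : AQ.Van R S 2 := AQ.vanS (R' := R') (Q := Q) hsur x hx hfree hgs hreg k hk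
  intro n hn N _ _
  obtain ⟨j, rfl⟩ : ∃ j, n = j + 1 := ⟨n - 1, by omega⟩
  refine ⟨fun a b => ?_⟩
  have key : ∀ a : AQH R S N (j+1), a = 0 := by
    intro a
    obtain ⟨⟨z, hz⟩, rfl⟩ := Submodule.mkQ_surjective ((LinearMap.range (AQdiff R S N (j+1))).comap (AQcycles R S N (j+1)).subtype) a
    exact (Submodule.Quotient.mk_eq_zero _).2 (hV N j (by omega) z hz)
  rw [key a, key b]
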